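/- There exist constants C, N₀ > 0 such that for all real N ≥ N₀ and all positive integers r with |r − (1/2)·log log N| < (log log N)^{2/3}: the number of d ∈ 𝒟_r(N) that are not N-nice is at most C·|𝒟_r(N)|·exp(−(log log log N)^{1/4}). -/

import Mathlib

/-- `𝒟`: squarefree positive integers all of whose prime divisors are `≡ 1, 2 (mod 4)`. -/
def PellD : Set ℕ :=
  {d | Squarefree d ∧ 0 < d ∧ ∀ p : ℕ, p.Prime → p ∣ d → p % 4 = 1 ∨ p % 4 = 2}

/-- `𝒟_r(N)`: elements of `𝒟` below `N` with exactly `r` distinct prime factors. -/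
def PellDr (r : ℕ) (N : ℝ) : Set ℕ :=
  {d ∈ PellD | (d : ℝ) < N ∧ d.primeFactors.card = r}

/-- `D₁ = exp((log log N)^{1/10})`. -/
noncomputable def D₁ (N : ℝ) : ℝ := Real.exp ((Real.log (Real.log N)) ^ ((1 : ℝ) / 10))

/-- `C₀ = √(log log log N)`. -/
noncomputable def C₀ (N : ℝ) : ℝ := Real.sqrt (Real.log (Real.log (Real.log N)))

/-- The increasing list of prime divisors `p₁ < p₂ < ⋯` of `d` (as a `List`, `0`-indexed). -/
noncomputable def primeList (d : ℕ) : List ℕ := d.primeFactors.sort (· ≤ ·)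

/-- `d` is `N`-nice: writing `d = p₁ ⋯ p_r` with `p₁ < ⋯ < p_r`, (i) `p_i > D₁` implies
`2 p_i < p_{i+1}`; (ii) `|½ log log p_i − i| < C₀^{1/5} max(i, C₀)^{4/5}` for `1 ≤ i < r/3`;
(iii) some `i` with `√r/2 < i < r/2` has `log p_i ≥ (log log p_i)² (log log log N) ∑_{j<i} log p_j`.
(The paper's `1`-based index `i` corresponds to list index `i − 1`.) -/
noncomputable def NNice (N : ℝ) (d : ℕ) : Prop :=
  let ps := primeList d
  let r := ps.length
  (∀ i : ℕ, i + 1 < r → D₁ N < (ps.getD i 0 : ℝ) →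
      2 * (ps.getD i 0 : ℝ) < (ps.getD (i + 1) 0 : ℝ)) ∧
  (∀ i : ℕ, 1 ≤ i → (i : ℝ) < (r : ℝ) / 3 →
      |(1 / 2) * Real.log (Real.log (ps.getD (i - 1) 0 : ℝ)) - (i : ℝ)| <
        (C₀ N) ^ ((1 : ℝ) / 5) * (max (i : ℝ) (C₀ N)) ^ ((4 : ℝ) / 5)) ∧
  (∃ i : ℕ, Real.sqrt r / 2 < (i : ℝ) ∧ (i : ℝ) < (r : ℝ) / 2 ∧
      (Real.log (Real.log (ps.getD (i - 1) 0 : ℝ))) ^ 2 * Real.log (Real.log (Real.log N)) *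
          (∑ j ∈ Finset.range (i - 1), Real.log (ps.getD j 0 : ℝ)) ≤
        Real.log (ps.getD (i - 1) 0 : ℝ))

namespace PNN
open Finset

/-- discrete Abel / Dirichlet bound -/
lemma dirichlet_bound (A f : ℕ → ℝ) (M : ℝ) (a : ℕ) (hA : ∀ n, a ≤ n → |A n| ≤ M)
    (hf0 : ∀ n, a < n → 0 ≤ f n) (hf : ∀ n, a < n → f (n+1) ≤ f n) (b : ℕ) (hab : a ≤ b) :
    |∑ k ∈ Ioc a b, (A k - A (k-1)) * f k| ≤ 2 * M * f (a+1) := by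
  have hM : 0 ≤ M := (abs_nonneg _).trans (hA a le_rfl)
  have key : |∑ k ∈ Ioc a b, (A k - A (k-1)) * f k - A b * f (b+1) + A a * f (a+1)|
      ≤ M * (f (a+1) - f (b+1)) := by
    induction b, hab using Nat.le_induction with
    | base => simp
    | succ n hn ih =>
      rw [Finset.sum_Ioc_succ_top hn]
      have h1 : ∑ k ∈ Ioc a n, (A k - A (k-1)) * f k + (A (n+1) - A (n+1-1)) * f (n+1)
          - A (n+1) * f (n+1+1) + A a * f (a+1)
        = (∑ k ∈ Ioc a n, (A k - A (k-1)) * f k - A n * f (n+1) + A a * f (a+1))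
          + A (n+1) * (f (n+1) - f (n+1+1)) := by
        simp only [Nat.add_sub_cancel]; ring
      rw [h1]
      refine (abs_add_le _ _).trans ?_
      rw [abs_mul]
      have h2 : 0 ≤ f (n+1) - f (n+1+1) := sub_nonneg.2 (hf _ (by omega))
      rw [abs_of_nonneg h2]
      have := mul_le_mul_of_nonneg_right (hA (n+1) (by omega)) h2
      linarith
  have h3 : |A b * f (b+1)| ≤ M * f (b+1) := by
    rw [abs_mul, abs_of_nonneg (hf0 (b+1) (by omega))]
    exact mul_le_mul_of_nonneg_right (hA b hab) (hf0 (b+1) (by omega))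
  have h4 : |A a * f (a+1)| ≤ M * f (a+1) := by
    rw [abs_mul, abs_of_nonneg (hf0 (a+1) (by omega))]
    exact mul_le_mul_of_nonneg_right (hA a le_rfl) (hf0 (a+1) (by omega))
  rw [abs_le] at *
  constructor <;> linarith [key.1, key.2, h3.1, h3.2, h4.1, h4.2]

/-- the character mod 4 with real values -/
noncomputable def chi (n : ℕ) : ℝ := ((ZMod.χ₄ (n : ZMod 4) : ℤ) : ℝ)

lemma chi_mul (m n : ℕ) : chi (m * n) = chi m * chi n := by
  unfold chi
  rw [Nat.cast_mul, map_mul, Int.cast_mul]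

lemma chi_eq (n : ℕ) : chi n = if n % 2 = 0 then 0 else if n % 4 = 1 then 1 else -1 := by
  unfold chi
  rw [ZMod.χ₄_nat_eq_if_mod_four]
  split_ifs <;> simp

lemma abs_chi_le (n : ℕ) : |chi n| ≤ 1 := by
  rw [chi_eq]; split_ifs <;> simp

noncomputable def chiA (n : ℕ) : ℝ := if n % 4 = 1 ∨ n % 4 = 2 then 1 else 0

lemma chi_eq_diff (n : ℕ) (hn : 0 < n) : chi n = chiA n - chiA (n-1) := by
  rw [chi_eq, chiA, chiA]
  have h : n % 4 = 0 ∨ n % 4 = 1 ∨ n % 4 = 2 ∨ n % 4 = 3 := by omega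
  rcases h with h | h | h | h
  · have h1 : n % 2 = 0 := by omega
    have h2 : (n-1) % 4 = 3 := by omega
    simp [h, h1, h2]
  · have h1 : n % 2 = 1 := by omega
    have h2 : (n-1) % 4 = 0 := by omega
    simp [h, h1, h2]
  · have h1 : n % 2 = 0 := by omega
    have h2 : (n-1) % 4 = 1 := by omega
    simp [h, h1, h2]
  · have h1 : n % 2 = 1 := by omega
    have h2 : (n-1) % 4 = 2 := by omega
    simp [h, h1, h2]

lemma chi_sum_bound (f : ℕ → ℝ) (a b : ℕ) (hab : a ≤ b)
    (hf0 : ∀ n, a < n → 0 ≤ f n) (hf : ∀ n, a < n → f (n+1) ≤ f n) :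
    |∑ k ∈ Ioc a b, chi k * f k| ≤ 2 * f (a+1) := by
  have := dirichlet_bound chiA f 1 a (fun n _ => by unfold chiA; split_ifs <;> simp) hf0 hf b hab
  rw [mul_one] at this
  convert this using 3 with k hk
  rw [chi_eq_diff k (by simp at hk; omega)]

lemma chi_inv_bound (a b : ℕ) (hab : a ≤ b) :
    |∑ k ∈ Ioc a b, chi k / k| ≤ 2 / (a + 1) := by
  have := chi_sum_bound (fun k => 1 / (k:ℝ)) a b hab (fun n _ => by positivity)
    (fun n hn => by
      have : (0:ℝ) < n := by exact_mod_cast (by omega : 0 < n)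
      exact one_div_le_one_div_of_le this (by push_cast; linarith))
  push_cast at this
  simpa [div_eq_mul_inv] using this

lemma exists_L : ∃ L : ℝ, 1/3 ≤ L ∧ ∀ n : ℕ, |∑ k ∈ Ioc 0 n, chi k / k - L| ≤ 2 / (n + 1) := by
  set s : ℕ → ℝ := fun n => ∑ k ∈ Ioc 0 n, chi k / k with hs
  have hd : ∀ a b, a ≤ b → |s b - s a| ≤ 2 / (a + 1) := by
    intro a b hab
    have : s b - s a = ∑ k ∈ Ioc a b, chi k / k := by
      rw [hs]; simp only
      rw [← Finset.sum_Ioc_consecutive _ (Nat.zero_le a) hab]; ring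
    rw [this]; exact chi_inv_bound a b hab
  have hlim : Filter.Tendsto (fun n : ℕ => 2 / ((n:ℝ) + 1)) Filter.atTop (nhds 0) :=
    (tendsto_const_div_atTop_nhds_zero_nat (2:ℝ)).comp (Filter.tendsto_add_atTop_nat 1) |>.congr
      (fun n => by simp)
  have hc : CauchySeq s := cauchySeq_of_le_tendsto_0 (fun n : ℕ => 4 / ((n:ℝ) + 1)) (by
      intro n m N hn hm
      rw [Real.dist_eq]
      have h1 := hd N n hn
      have h2 := hd N m hm
      have : (4:ℝ) / (N+1) = 2/(N+1) + 2/(N+1) := by ring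
      rw [this]
      rw [abs_le] at *
      constructor <;> linarith [h1.1, h1.2, h2.1, h2.2]) (by
      have := hlim.const_mul 2
      rw [mul_zero] at this
      refine this.congr (fun n => by ring))
  obtain ⟨L, hL⟩ := cauchySeq_tendsto_of_complete hc
  have hb : ∀ n, |s n - L| ≤ 2 / (n+1) := by
    intro n
    have h1 : Filter.Tendsto (fun m => |s n - s m|) Filter.atTop (nhds |s n - L|) :=
      (tendsto_const_nhds.sub hL).abs
    refine le_of_tendsto h1 ?_
    filter_upwards [Filter.eventually_ge_atTop n] with m hm
    rw [abs_sub_comm]; exact hd n m hm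
  refine ⟨L, ?_, hb⟩
  have h2 : s 2 = 1 := by
    simp only [hs]
    rw [show Ioc 0 2 = ({1, 2} : Finset ℕ) from rfl]
    simp [chi_eq]
  have := hb 2
  rw [h2, abs_le] at this
  norm_num at this
  linarith [this.2]

open ArithmeticFunction in
lemma chi_vonMangoldt : ∃ C : ℝ, ∀ n : ℕ, |∑ k ∈ Ioc 0 n, chi k * Λ k / k| ≤ C := by
  obtain ⟨L, hL, hLs⟩ := exists_L
  refine ⟨3 * (2 + 2 * (Real.log 4 + 4)), fun n => ?_⟩
  rcases Nat.eq_zero_or_pos n with rfl | hn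
  · simp; positivity
  have hn' : (0:ℝ) < n := by exact_mod_cast hn
  let F : ArithmeticFunction ℝ := ⟨fun k => chi k * Λ k / k, by simp⟩
  let G : ArithmeticFunction ℝ := ⟨fun k => chi k / k, by simp⟩
  have hFG : ∀ k : ℕ, (F * G) k = chi k * Real.log k / k := by
    intro k
    rw [ArithmeticFunction.mul_apply]
    have : ∀ x ∈ k.divisorsAntidiagonal, F x.1 * G x.2 = chi k / k * Λ x.1 := by
      intro x hx
      rw [Nat.mem_divisorsAntidiagonal] at hx
      show chi x.1 * Λ x.1 / x.1 * (chi x.2 / x.2) = _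
      rw [← hx.1, chi_mul]
      have h1 : x.1 ≠ 0 := by rintro h; simp [h] at hx; omega
      have h2 : x.2 ≠ 0 := by rintro h; simp [h] at hx; omega
      push_cast
      field_simp
    rw [sum_congr rfl this, ← mul_sum, Nat.sum_divisorsAntidiagonal (fun d _ => Λ d),
      vonMangoldt_sum]
    ring
  have hsum := sum_Ioc_mul_eq_sum_sum F G n
  have hlhs : |∑ k ∈ Ioc 0 n, (F * G) k| ≤ 2 := by
    simp_rw [hFG]
    have hmono : ∀ m, 2 < m → Real.log ((m+1:ℕ):ℝ) / ((m+1:ℕ):ℝ) ≤ Real.log (m:ℝ) / (m:ℝ) := by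
      intro m hm
      have h3 : (3:ℝ) ≤ m := by exact_mod_cast hm
      have he := Real.exp_one_lt_d9
      apply Real.log_div_self_antitoneOn
      · simp only [Set.mem_Ici]; linarith
      · simp only [Set.mem_Ici]; push_cast; linarith
      · push_cast; linarith
    have hlog3 : Real.log 3 ≤ 2 := by
      have := Real.log_le_sub_one_of_pos (show (0:ℝ) < 3 by norm_num); linarith
    rcases Nat.lt_or_ge n 2 with h | h
    · have : n = 1 := by omega
      subst this; simp
    · rw [← Finset.sum_Ioc_consecutive _ (Nat.zero_le 2) h]
      have h2 : ∑ k ∈ Ioc 0 2, chi k * Real.log k / k = 0 := by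
        rw [show Ioc 0 2 = ({1, 2} : Finset ℕ) from rfl]
        simp [chi_eq]
      rw [h2, zero_add]
      have := chi_sum_bound (fun k => Real.log k / k) 2 n h
        (fun m hm => by positivity) hmono
      simp only [mul_div_assoc]
      refine this.trans ?_
      norm_num
      linarith
  rw [hsum] at hlhs
  have hpsi : ∑ k ∈ Ioc 0 n, Λ k ≤ (Real.log 4 + 4) * n := by
    have := Chebyshev.psi_le_const_mul_self hn'.le
    rw [Chebyshev.psi] at this
    simpa using this
  have hdiff : |∑ k ∈ Ioc 0 n, F k * ∑ m ∈ Ioc 0 (n/k), G m - L * ∑ k ∈ Ioc 0 n, F k| ≤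
      2 * (Real.log 4 + 4) := by
    rw [mul_sum, ← sum_sub_distrib]
    refine (abs_sum_le_sum_abs _ _).trans ?_
    have : ∀ k ∈ Ioc 0 n, |F k * ∑ m ∈ Ioc 0 (n/k), G m - L * F k| ≤ 2 / n * Λ k := by
      intro k hk
      rw [mem_Ioc] at hk
      have hk' : (0:ℝ) < k := by exact_mod_cast hk.1
      have e1 : F k * ∑ m ∈ Ioc 0 (n/k), G m - L * F k = F k * (∑ m ∈ Ioc 0 (n/k), G m - L) := by
        ring
      rw [e1, abs_mul]
      have e2 : |F k| ≤ Λ k / k := by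
        show |chi k * Λ k / k| ≤ _
        rw [abs_div, abs_mul, abs_of_nonneg (vonMangoldt_nonneg : 0 ≤ Λ k), abs_of_pos hk']
        have := mul_le_mul_of_nonneg_right (abs_chi_le k) (vonMangoldt_nonneg : 0 ≤ Λ k)
        rw [one_mul] at this
        gcongr
      have e3 : |∑ m ∈ Ioc 0 (n/k), G m - L| ≤ 2 * k / n := by
        refine (hLs (n/k)).trans ?_
        rw [div_le_div_iff₀ (by positivity) hn']
        have : (n:ℝ) < k * ((n/k : ℕ) + 1) := by
          have := Nat.lt_mul_div_succ n hk.1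
          exact_mod_cast this
        nlinarith
      calc _ ≤ Λ k / k * (2 * k / n) := by gcongr
        _ = _ := by field_simp
    refine (sum_le_sum this).trans ?_
    rw [← mul_sum]
    calc _ ≤ 2 / n * ((Real.log 4 + 4) * n) := by gcongr
      _ = _ := by field_simp
  have hfin : |L * ∑ k ∈ Ioc 0 n, F k| ≤ 2 + 2 * (Real.log 4 + 4) := by
    rw [abs_le] at *
    constructor <;> linarith [hdiff.1, hdiff.2, hlhs.1, hlhs.2]
  rw [abs_mul, abs_of_pos (by linarith)] at hfin
  show |∑ k ∈ Ioc 0 n, F k| ≤ _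
  have := mul_le_mul_of_nonneg_right hL (abs_nonneg (∑ k ∈ Ioc 0 n, F k))
  linarith

open ArithmeticFunction in
lemma mertens_one : ∃ C : ℝ, ∀ n : ℕ, 0 < n → |∑ k ∈ Ioc 0 n, Λ k / k - Real.log n| ≤ C := by
  refine ⟨Real.log 4 + 5, fun n hn => ?_⟩
  have hn' : (0:ℝ) < n := by exact_mod_cast hn
  have h1 := sum_Ioc_mul_zeta_eq_sum (R := ℝ) Λ n
  have h2 : ∑ k ∈ Ioc 0 n, (Λ * (ArithmeticFunction.zeta : ArithmeticFunction ℝ)) k = Real.log (n.factorial) := by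
    rw [vonMangoldt_mul_zeta]
    clear h1 hn hn'
    induction n with
    | zero => simp
    | succ m ih =>
      rw [Finset.sum_Ioc_succ_top (Nat.zero_le m), ih, Nat.factorial_succ]
      push_cast
      rw [Real.log_mul (by positivity) (by positivity)]
      simp [add_comm]
  rw [h2] at h1
  have hpsi : ∑ k ∈ Ioc 0 n, Λ k ≤ (Real.log 4 + 4) * n := by
    have := Chebyshev.psi_le_const_mul_self hn'.le
    rw [Chebyshev.psi] at this
    simpa using this
  have hup : Real.log n.factorial ≤ n * Real.log n := by
    rw [← Real.log_pow]
    apply Real.log_le_log (by positivity)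
    exact_mod_cast Nat.factorial_le_pow n
  have hlo : n * Real.log n - n ≤ Real.log n.factorial := by
    have hs := Stirling.le_log_factorial_stirling hn.ne'
    have : 0 ≤ Real.log n := Real.log_natCast_nonneg n
    have : 0 ≤ Real.log (2 * Real.pi) := Real.log_nonneg (by nlinarith [Real.pi_gt_three])
    linarith
  have hA : Real.log n.factorial ≤ n * ∑ k ∈ Ioc 0 n, Λ k / k := by
    rw [h1, mul_sum]
    refine sum_le_sum fun k hk => ?_
    rw [mem_Ioc] at hk
    have hk' : (0:ℝ) < k := by exact_mod_cast hk.1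
    have : ((n / k : ℕ) : ℝ) ≤ n / k := Nat.cast_div_le
    calc Λ k * ((n/k : ℕ):ℝ) ≤ Λ k * (n / k) := by
          gcongr
      _ = _ := by ring
  have hB : n * ∑ k ∈ Ioc 0 n, Λ k / k ≤ Real.log n.factorial + (Real.log 4 + 4) * n := by
    refine le_trans ?_ (add_le_add_right hpsi _)
    rw [h1, mul_sum, ← sum_add_distrib]
    refine sum_le_sum fun k hk => ?_
    rw [mem_Ioc] at hk
    have hk' : (0:ℝ) < k := by exact_mod_cast hk.1
    have : (n:ℝ) / k ≤ ((n / k : ℕ) : ℝ) + 1 := by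
      rw [div_le_iff₀ hk']
      have := Nat.lt_mul_div_succ n hk.1
      have : (n:ℝ) < k * ((n/k : ℕ) + 1) := by
        exact_mod_cast this
      linarith
    calc n * (Λ k / k) = Λ k * (n / k) := by ring
      _ ≤ Λ k * (((n / k : ℕ) : ℝ) + 1) := by gcongr
      _ = _ := by ring
  have hl4 : 0 ≤ Real.log 4 := Real.log_nonneg (by norm_num)
  rw [abs_le]
  constructor
  · have : n * (Real.log n - 1) ≤ n * ∑ k ∈ Ioc 0 n, Λ k / k := by linarith
    have := le_of_mul_le_mul_left this hn'
    linarith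
  · have : n * ∑ k ∈ Ioc 0 n, Λ k / k ≤ n * (Real.log n + (Real.log 4 + 4)) := by linarith
    have := le_of_mul_le_mul_left this hn'
    linarith

end PNN

namespace PNN
open Finset

/-- primes `≡ 1, 2 (mod 4)` -/
def PPr (p : ℕ) : Prop := p.Prime ∧ (p % 4 = 1 ∨ p % 4 = 2)

instance : DecidablePred PPr := fun _ => by unfold PPr; infer_instance

open ArithmeticFunction in
lemma nonprime_bound : ∃ C : ℝ, ∀ n : ℕ,
    ∑ k ∈ Ioc 0 n, (if k.Prime then 0 else Λ k) / k ≤ C := by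
  have h := ArithmeticFunction.vonMangoldt.summable_residueClass_non_primes_div (q := 1) (0 : ZMod 1)
  refine ⟨_, fun n => le_trans (le_of_eq ?_) (h.sum_le_tsum (Ioc 0 n) ?_)⟩
  · refine sum_congr rfl fun k _ => ?_
    congr 1
    split_ifs
    · rfl
    · simp only [ArithmeticFunction.vonMangoldt.residueClass]
      rw [Set.indicator_of_mem]
      exact Subsingleton.elim _ _
  · intro k _
    have := ArithmeticFunction.vonMangoldt.residueClass_nonneg (q := 1) (0 : ZMod 1) k
    split_ifs <;> positivity

open ArithmeticFunction in
lemma mertens_log : ∃ E : ℝ, ∀ n : ℕ, 0 < n →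
    |∑ k ∈ (Ioc 0 n).filter PPr, Real.log k / k - 1/2 * Real.log n| ≤ E := by
  obtain ⟨C1, h1⟩ := chi_vonMangoldt
  obtain ⟨C2, h2⟩ := mertens_one
  obtain ⟨C3, h3⟩ := nonprime_bound
  refine ⟨C1 + C2 + C3 + 1, fun n hn => ?_⟩
  have hl2 : Real.log 2 ≤ 1 := by have := Real.log_two_lt_d9; linarith
  have hl2' : 0 ≤ Real.log 2 := Real.log_nonneg (by norm_num)
  have key : ∀ k ∈ Ioc 0 n, (if PPr k then Real.log k / k else 0) =
      1/2 * (Λ k / k) + 1/2 * (chi k * Λ k / k)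
      - 1/2 * ((1 + chi k) * ((if k.Prime then 0 else Λ k) / k))
      + (if k = 2 then Real.log 2 / 4 else 0) := by
    intro k hk
    by_cases hp : k.Prime
    · have hL : Λ k = Real.log k := vonMangoldt_apply_prime hp
      rw [if_pos hp, hL, chi_eq]
      rcases hp.eq_two_or_odd with rfl | hodd
      · simp [PPr, Nat.prime_two]; ring
      · have hne : k ≠ 2 := by omega
        have h4 : k % 4 = 1 ∨ k % 4 = 3 := by omega
        rcases h4 with h4 | h4
        · simp [PPr, hp, h4, hodd, hne]; ring
        · simp [PPr, h4, hodd, hne]; ring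
    · have hne : k ≠ 2 := by rintro rfl; exact hp Nat.prime_two
      simp only [PPr, hp, hne, false_and, if_false]
      ring
  rw [sum_filter, sum_congr rfl key, sum_add_distrib, sum_sub_distrib, sum_add_distrib,
    ← mul_sum, ← mul_sum, ← mul_sum]
  have e1 : |∑ k ∈ Ioc 0 n, (1 + chi k) * ((if k.Prime then 0 else Λ k) / k)| ≤ 2 * C3 := by
    refine (abs_sum_le_sum_abs _ _).trans ?_
    refine le_trans ?_ (mul_le_mul_of_nonneg_left (h3 n) (by norm_num))
    rw [mul_sum]
    refine sum_le_sum fun k _ => ?_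
    have hnn : (0:ℝ) ≤ (if k.Prime then 0 else Λ k) / k := by
      have : 0 ≤ Λ k := vonMangoldt_nonneg
      split_ifs <;> positivity
    rw [abs_mul, abs_of_nonneg hnn]
    refine mul_le_mul_of_nonneg_right ?_ hnn
    have := abs_chi_le k
    refine (abs_add_le _ _).trans ?_
    simp; linarith
  have e2 : (0:ℝ) ≤ ∑ k ∈ Ioc 0 n, (if k = 2 then Real.log 2 / 4 else 0) := by
    refine sum_nonneg fun k _ => ?_
    split_ifs <;> positivity
  have e3 : ∑ k ∈ Ioc 0 n, (if k = 2 then Real.log 2 / 4 else 0) ≤ 1 := by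
    rw [sum_ite_eq']
    split_ifs <;> linarith
  have h1 := h1 n
  have h2 := h2 n hn
  have h1p := (abs_nonneg _).trans h1
  have h2p := (abs_nonneg _).trans h2
  rw [abs_le] at *
  constructor <;> linarith [h1.1, h1.2, h2.1, h2.2, e1.1, e1.2]

lemma loglog_step (k : ℕ) (hk : 2 ≤ k) :
    let d := Real.log (k+1:ℕ) - Real.log k
    0 ≤ Real.log (Real.log (k+1:ℕ)) - Real.log (Real.log k) - d / Real.log (k+1:ℕ) ∧
    Real.log (Real.log (k+1:ℕ)) - Real.log (Real.log k) - d / Real.log (k+1:ℕ) ≤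
      1 / Real.log k - 1 / Real.log (k+1:ℕ) := by
  intro d
  have hk2 : (2:ℝ) ≤ k := by exact_mod_cast hk
  have a0 : 0 < Real.log k := Real.log_pos (by linarith)
  have b0 : 0 < Real.log (k+1:ℕ) := Real.log_pos (by push_cast; linarith)
  have hd0 : 0 ≤ d := sub_nonneg.2 (Real.log_le_log (by linarith) (by push_cast; linarith))
  have hd1 : d ≤ 1 := by
    have : d = Real.log ((k+1:ℕ) / k) := by
      rw [Real.log_div (by positivity) (by positivity)]
    rw [this]
    refine (Real.log_le_sub_one_of_pos (by positivity)).trans ?_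
    rw [sub_le_iff_le_add, div_le_iff₀ (by linarith)]
    push_cast; linarith
  have hlog : Real.log (Real.log (k+1:ℕ)) - Real.log (Real.log k)
      = Real.log (Real.log (k+1:ℕ) / Real.log k) := by
    rw [Real.log_div b0.ne' a0.ne']
  have hlog2 : Real.log (Real.log (k+1:ℕ)) - Real.log (Real.log k)
      = - Real.log (Real.log k / Real.log (k+1:ℕ)) := by
    rw [Real.log_div a0.ne' b0.ne']; ring
  have hup := Real.log_le_sub_one_of_pos (div_pos b0 a0)
  have hlo := Real.log_le_sub_one_of_pos (div_pos a0 b0)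
  have e1 : d / Real.log (k+1:ℕ) = 1 - Real.log k / Real.log (k+1:ℕ) := by
    simp only [d]; field_simp
  have e2 : Real.log (k+1:ℕ) / Real.log k - 1 = d * (1 / Real.log k) := by
    simp only [d]; field_simp
  have e3 : d / Real.log (k+1:ℕ) = d * (1 / Real.log (k+1:ℕ)) := by ring
  constructor
  · rw [hlog2, e1]; linarith
  · rw [hlog, e3]
    have h0 : 0 ≤ 1 / Real.log k - 1 / Real.log (k+1:ℕ) :=
      sub_nonneg.2 (one_div_le_one_div_of_le a0 (by simp only [d] at hd0; linarith))
    have := mul_le_mul_of_nonneg_right hd1 h0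
    linarith

lemma mertens_two_nat : ∃ M : ℝ, ∀ n : ℕ, 2 ≤ n →
    |∑ k ∈ (Ioc 0 n).filter PPr, (1:ℝ) / k - 1/2 * Real.log (Real.log n)| ≤ M := by
  obtain ⟨E, hE⟩ := mertens_log
  have hlog2 : 0 < Real.log 2 := Real.log_pos (by norm_num)
  have hlog3 : 0 < Real.log 3 := Real.log_pos (by norm_num)
  set B : ℕ → ℝ := fun n => ∑ k ∈ (Ioc 0 n).filter PPr, Real.log k / k - 1/2 * Real.log n with hB
  refine ⟨1/2 + 1/2 * |Real.log (Real.log 2)| + 2 * E * (1 / Real.log 3) + 1 / Real.log 2,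
    fun n hn => ?_⟩
  -- Abel
  have hAb := dirichlet_bound B (fun k => 1 / Real.log k) E 2 (fun m hm => hE m (by omega))
    (fun m hm => by positivity) (fun m hm => by
      have h3 : (3:ℝ) ≤ m := by exact_mod_cast hm
      exact one_div_le_one_div_of_le (Real.log_pos (by linarith))
        (Real.log_le_log (by linarith) (by push_cast; linarith))) n hn
  have hBd : ∀ k ∈ Ioc 2 n, (B k - B (k-1)) * (1 / Real.log k) =
      (if PPr k then (1:ℝ)/k else 0) - 1/2 * ((Real.log k - Real.log (k-1:ℕ)) / Real.log k) := by
    intro k hk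
    rw [mem_Ioc] at hk
    obtain ⟨m, rfl⟩ : ∃ m, k = m + 1 := ⟨k-1, by omega⟩
    have hl : Real.log ((m+1:ℕ):ℝ) ≠ 0 := by
      apply ne_of_gt; apply Real.log_pos; exact_mod_cast (by omega : 1 < m+1)
    simp only [hB, Nat.add_sub_cancel]
    rw [sum_filter, sum_filter, Finset.sum_Ioc_succ_top (Nat.zero_le m)]
    split_ifs with h
    · field_simp; ring
    · field_simp; ring
  rw [sum_congr rfl hBd, sum_sub_distrib, ← mul_sum] at hAb
  -- telescoping
  have htel : |∑ k ∈ Ioc 2 n, (Real.log k - Real.log (k-1:ℕ)) / Real.log k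
      - (Real.log (Real.log n) - Real.log (Real.log 2))| ≤ 1 / Real.log 2 := by
    have : 0 ≤ (Real.log (Real.log n) - Real.log (Real.log 2)) -
        ∑ k ∈ Ioc 2 n, (Real.log k - Real.log (k-1:ℕ)) / Real.log k ∧
        (Real.log (Real.log n) - Real.log (Real.log 2)) -
        ∑ k ∈ Ioc 2 n, (Real.log k - Real.log (k-1:ℕ)) / Real.log k ≤
        1 / Real.log 2 - 1 / Real.log n := by
      clear hAb hBd
      induction n, hn using Nat.le_induction with
      | base => simp
      | succ m hm ih =>
        rw [Finset.sum_Ioc_succ_top hm]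
        have := loglog_step m hm
        simp only [Nat.add_sub_cancel]
        constructor
        · linarith [ih.1, this.1]
        · linarith [ih.2, this.2]
    have hp : 0 ≤ 1 / Real.log n := by positivity
    rw [abs_le]
    constructor <;> linarith [this.1, this.2]
  have hsplit : ∑ k ∈ (Ioc 0 n).filter PPr, (1:ℝ) / k
      = 1/2 + ∑ k ∈ Ioc 2 n, (if PPr k then (1:ℝ)/k else 0) := by
    rw [sum_filter, ← Finset.sum_Ioc_consecutive _ (Nat.zero_le 2) hn]
    congr 1
    rw [show Ioc 0 2 = ({1, 2} : Finset ℕ) from rfl]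
    simp [PPr, Nat.prime_two, Nat.not_prime_one]
  rw [hsplit]
  have hab := abs_nonneg (Real.log (Real.log 2))
  have h1 := le_abs_self (Real.log (Real.log 2))
  have h2 := neg_abs_le (Real.log (Real.log 2))
  push_cast at hAb
  norm_num at hAb htel ⊢
  have hi : 0 ≤ (Real.log 2)⁻¹ := by positivity
  rw [abs_le] at *
  constructor <;> linarith [hAb.1, hAb.2, htel.1, htel.2]

/-- `log log p` -/
noncomputable def lam (p : ℕ) : ℝ := Real.log (Real.log p)

lemma loglog_floor {x : ℝ} (hx : 2 ≤ x) : 0 ≤ Real.log (Real.log x) - Real.log (Real.log ⌊x⌋₊) ∧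
    Real.log (Real.log x) - Real.log (Real.log ⌊x⌋₊) ≤ 1 / Real.log 2 := by
  have h2 : 2 ≤ ⌊x⌋₊ := Nat.le_floor (by exact_mod_cast hx)
  have h2' : (2:ℝ) ≤ ⌊x⌋₊ := by exact_mod_cast h2
  have hfl : (⌊x⌋₊:ℝ) ≤ x := Nat.floor_le (by linarith)
  have hfu : x ≤ ((⌊x⌋₊ + 1 : ℕ):ℝ) := by push_cast; exact (Nat.lt_floor_add_one x).le
  have hlog2 : 0 < Real.log 2 := Real.log_pos (by norm_num)
  have a0 : 0 < Real.log ⌊x⌋₊ := Real.log_pos (by linarith)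
  have m1 : Real.log ⌊x⌋₊ ≤ Real.log x := Real.log_le_log (by linarith) hfl
  have m2 : Real.log x ≤ Real.log (⌊x⌋₊+1:ℕ) := Real.log_le_log (by linarith) hfu
  have n1 := Real.log_le_log a0 m1
  have n2 := Real.log_le_log (by linarith) m2
  have st := (loglog_step _ h2).2
  have q1 : 1 / Real.log ⌊x⌋₊ ≤ 1 / Real.log 2 :=
    one_div_le_one_div_of_le hlog2 (Real.log_le_log (by norm_num) h2')
  have b0 : 0 < Real.log (⌊x⌋₊+1:ℕ) := by linarith
  have q2 : (Real.log (⌊x⌋₊+1:ℕ) - Real.log ⌊x⌋₊) / Real.log (⌊x⌋₊+1:ℕ) ≤ 1 / Real.log (⌊x⌋₊+1:ℕ) := by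
    gcongr
    rw [← Real.log_div (by positivity) (by positivity)]
    refine (Real.log_le_sub_one_of_pos (by positivity)).trans ?_
    rw [sub_le_iff_le_add, div_le_iff₀ (by linarith)]
    push_cast; linarith
  constructor
  · linarith
  · linarith

lemma mertens_two : ∃ M : ℝ, 1 ≤ M ∧ ∀ x : ℝ, 2 ≤ x →
    |∑ k ∈ (Ioc 0 ⌊x⌋₊).filter PPr, (1:ℝ) / k - 1/2 * Real.log (Real.log x)| ≤ M := by
  obtain ⟨M, hM⟩ := mertens_two_nat
  refine ⟨max 1 (M + 1 / Real.log 2), le_max_left _ _, fun x hx => le_trans ?_ (le_max_right _ _)⟩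
  have h := hM ⌊x⌋₊ (Nat.le_floor (by exact_mod_cast hx))
  have h2 := loglog_floor hx
  rw [abs_le] at *
  constructor <;> linarith [h.1, h.2]

/-- Mertens in windows of the `log log` scale. -/
lemma mertens_window : ∃ M : ℝ, 1 ≤ M ∧ ∀ u v : ℝ, 0 ≤ u → u ≤ v → ∀ F : Finset ℕ,
    (∀ p, p ∈ F ↔ PPr p ∧ u < lam p ∧ lam p ≤ v) →
    |∑ p ∈ F, (1:ℝ)/p - (v - u)/2| ≤ M := by
  obtain ⟨M, hM1, hM⟩ := mertens_two
  refine ⟨2*M, by linarith, fun u v hu huv F hF => ?_⟩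
  have hx : ∀ w : ℝ, 0 ≤ w → 2 ≤ Real.exp (Real.exp w) := by
    intro w hw
    have h1 := Real.add_one_le_exp w
    have h2 := Real.add_one_le_exp (Real.exp w)
    linarith
  have hmem : ∀ w : ℝ, ∀ p, p ∈ (Ioc 0 ⌊Real.exp (Real.exp w)⌋₊).filter PPr ↔
      PPr p ∧ lam p ≤ w := by
    intro w p
    rw [mem_filter, mem_Ioc]
    constructor
    · rintro ⟨⟨h1, h2⟩, h3⟩
      refine ⟨h3, ?_⟩
      have hp2 : (2:ℝ) ≤ p := by exact_mod_cast h3.1.two_le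
      rw [Nat.le_floor_iff (by positivity)] at h2
      unfold lam
      rw [Real.log_le_iff_le_exp (Real.log_pos (by linarith)), Real.log_le_iff_le_exp (by linarith)]
      exact h2
    · rintro ⟨h3, h2⟩
      have hp2 : (2:ℝ) ≤ p := by exact_mod_cast h3.1.two_le
      refine ⟨⟨h3.1.pos, ?_⟩, h3⟩
      rw [Nat.le_floor_iff (by positivity)]
      unfold lam at h2
      rwa [Real.log_le_iff_le_exp (Real.log_pos (by linarith)), Real.log_le_iff_le_exp (by linarith)] at h2
  have hFe : F = ((Ioc 0 ⌊Real.exp (Real.exp v)⌋₊).filter PPr) \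
      ((Ioc 0 ⌊Real.exp (Real.exp u)⌋₊).filter PPr) := by
    ext p
    rw [mem_sdiff, hmem, hmem, hF]
    constructor
    · rintro ⟨h1, h2, h3⟩; exact ⟨⟨h1, h3⟩, fun h => by linarith [h.2]⟩
    · rintro ⟨⟨h1, h2⟩, h3⟩; exact ⟨h1, by by_contra hc; exact h3 ⟨h1, by linarith⟩, h2⟩
  have hsub : ((Ioc 0 ⌊Real.exp (Real.exp u)⌋₊).filter PPr) ⊆
      ((Ioc 0 ⌊Real.exp (Real.exp v)⌋₊).filter PPr) := by
    intro p; rw [hmem, hmem]; rintro ⟨h1, h2⟩; exact ⟨h1, by linarith⟩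
  have hs := sum_sdiff (f := fun p : ℕ => (1:ℝ)/p) hsub
  rw [← hFe] at hs
  have hv := hM _ (hx v (hu.trans huv))
  have hu' := hM _ (hx u hu)
  rw [Real.log_exp, Real.log_exp] at hv hu'
  rw [abs_le] at *
  constructor <;> linarith [hv.1, hv.2, hu'.1, hu'.2]

/-- Mertens from the start of the `log log` scale. -/
lemma mertens_start : ∃ M : ℝ, 1 ≤ M ∧ ∀ v : ℝ, 0 ≤ v → ∀ F : Finset ℕ,
    (∀ p, p ∈ F ↔ PPr p ∧ lam p ≤ v) →
    |∑ p ∈ F, (1:ℝ)/p - v/2| ≤ M := by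
  obtain ⟨M, hM1, hM⟩ := mertens_two
  refine ⟨M, hM1, fun v hv F hF => ?_⟩
  have hx : 2 ≤ Real.exp (Real.exp v) := by
    have h1 := Real.add_one_le_exp v
    have h2 := Real.add_one_le_exp (Real.exp v)
    linarith
  have hFe : F = ((Ioc 0 ⌊Real.exp (Real.exp v)⌋₊).filter PPr) := by
    ext p
    rw [hF, mem_filter, mem_Ioc]
    constructor
    · rintro ⟨h3, h2⟩
      have hp2 : (2:ℝ) ≤ p := by exact_mod_cast h3.1.two_le
      refine ⟨⟨h3.1.pos, ?_⟩, h3⟩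
      rw [Nat.le_floor_iff (by positivity)]
      unfold lam at h2
      rwa [Real.log_le_iff_le_exp (Real.log_pos (by linarith)), Real.log_le_iff_le_exp (by linarith)] at h2
    · rintro ⟨⟨h1, h2⟩, h3⟩
      refine ⟨h3, ?_⟩
      have hp2 : (2:ℝ) ≤ p := by exact_mod_cast h3.1.two_le
      rw [Nat.le_floor_iff (by positivity)] at h2
      unfold lam
      rw [Real.log_le_iff_le_exp (Real.log_pos (by linarith)), Real.log_le_iff_le_exp (by linarith)]
      exact h2
  have hv := hM _ hx
  rw [Real.log_exp, Real.log_exp] at hv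
  rw [hFe]
  convert hv using 2
  ring

/-- upper bound for `∑ log p / p` -/
lemma sum_log_div : ∃ C : ℝ, 1 ≤ C ∧ ∀ v : ℝ, 0 ≤ v → ∀ F : Finset ℕ,
    (∀ p ∈ F, PPr p ∧ Real.log p ≤ Real.exp v) →
    ∑ p ∈ F, Real.log p / p ≤ C * Real.exp v := by
  obtain ⟨E, hE⟩ := mertens_log
  refine ⟨max 1 (E + 1), le_max_left _ _, fun v hv F hF => ?_⟩
  have h1 : 1 ≤ Real.exp v := Real.one_le_exp hv
  have hpos : 1 ≤ Real.exp (Real.exp v) := Real.one_le_exp (by linarith)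
  have hfl : 0 < ⌊Real.exp (Real.exp v)⌋₊ := Nat.floor_pos.2 hpos
  have hsub : F ⊆ (Ioc 0 ⌊Real.exp (Real.exp v)⌋₊).filter PPr := by
    intro p hp
    obtain ⟨h3, h4⟩ := hF p hp
    have hp2 : (2:ℝ) ≤ p := by exact_mod_cast h3.1.two_le
    rw [mem_filter, mem_Ioc]
    refine ⟨⟨h3.1.pos, ?_⟩, h3⟩
    rw [Nat.le_floor_iff (by positivity)]
    rwa [Real.log_le_iff_le_exp (by linarith)] at h4
  have h2 := hE _ hfl
  rw [abs_le] at h2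
  have hlog : Real.log ⌊Real.exp (Real.exp v)⌋₊ ≤ Real.exp v := by
    rw [Real.log_le_iff_le_exp (by exact_mod_cast hfl)]
    exact Nat.floor_le (by positivity)
  have hlog0 : 0 ≤ Real.log ⌊Real.exp (Real.exp v)⌋₊ := Real.log_natCast_nonneg _
  have hE0 : 0 ≤ E := by have := hE 1 (by norm_num); exact (abs_nonneg _).trans this
  calc ∑ p ∈ F, Real.log p / p ≤ ∑ p ∈ (Ioc 0 ⌊Real.exp (Real.exp v)⌋₊).filter PPr, Real.log p / p := by
        refine sum_le_sum_of_subset_of_nonneg hsub fun p _ _ => ?_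
        have := Real.log_natCast_nonneg p
        positivity
    _ ≤ 1/2 * Real.exp v + E * 1 := by linarith [h2.2]
    _ ≤ 1/2 * Real.exp v + E * Real.exp v := by gcongr
    _ ≤ (E + 1) * Real.exp v := by nlinarith
    _ ≤ _ := by gcongr; exact le_max_right _ _

/-- lower bound for the number of primes in `(X/K, X]` -/
lemma prime_count_lower : ∃ K : ℝ, 1 < K ∧ ∀ X : ℝ, K ≤ X →
    X / (K * Real.log X) ≤
      (((Ioc 0 ⌊X⌋₊).filter (fun p => PPr p ∧ X / K < p)).card : ℝ) := by
  obtain ⟨E, hE⟩ := mertens_log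
  have hE0 : 0 ≤ E := by have := hE 1 (by norm_num); exact (abs_nonneg _).trans this
  set K := Real.exp (4 * E + 6) with hK
  have hK1 : 1 < K := by rw [hK]; exact Real.one_lt_exp_iff.2 (by linarith)
  refine ⟨K, hK1, fun X hX => ?_⟩
  have hX0 : 0 < X := by linarith
  have hlX : 0 < Real.log X := Real.log_pos (by linarith)
  have hXK : 1 ≤ X / K := by rw [le_div_iff₀ (by linarith)]; linarith
  have f1 : 0 < ⌊X⌋₊ := Nat.floor_pos.2 (by linarith)
  have f2 : 0 < ⌊X/K⌋₊ := Nat.floor_pos.2 hXK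
  have g1 := (abs_le.1 (hE _ f1)).1
  have g2 := (abs_le.1 (hE _ f2)).2
  have l1 : Real.log X - 1 ≤ Real.log ⌊X⌋₊ := by
    have : X ≤ 2 * ⌊X⌋₊ := by
      have := Nat.lt_floor_add_one X
      have : (1:ℝ) ≤ ⌊X⌋₊ := by exact_mod_cast f1
      linarith
    have := Real.log_le_log hX0 this
    rw [Real.log_mul (by norm_num) (by positivity)] at this
    have := Real.log_two_lt_d9
    linarith
  have l2 : Real.log ⌊X/K⌋₊ ≤ Real.log X - (4 * E + 6) := by
    have : Real.log X - (4 * E + 6) = Real.log (X / K) := by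
      rw [Real.log_div (by positivity) (by positivity), hK, Real.log_exp]
    rw [this]
    exact Real.log_le_log (by exact_mod_cast f2) (Nat.floor_le (by linarith))
  have hdiff : 1 ≤ ∑ k ∈ (Ioc 0 ⌊X⌋₊).filter (fun p => PPr p ∧ X / K < p), Real.log k / k := by
    have hsub : (Ioc 0 ⌊X/K⌋₊).filter PPr ⊆ (Ioc 0 ⌊X⌋₊).filter PPr := by
      apply filter_subset_filter
      apply Ioc_subset_Ioc_right
      apply Nat.floor_mono
      apply div_le_self <;> linarith
    have hs := sum_sdiff (f := fun p : ℕ => Real.log p / p) hsub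
    have : (Ioc 0 ⌊X⌋₊).filter PPr \ (Ioc 0 ⌊X/K⌋₊).filter PPr =
        (Ioc 0 ⌊X⌋₊).filter (fun p => PPr p ∧ X / K < p) := by
      ext p
      simp only [mem_sdiff, mem_filter, mem_Ioc]
      constructor
      · rintro ⟨⟨⟨h1, h2⟩, h3⟩, h4⟩
        refine ⟨⟨h1, h2⟩, h3, ?_⟩
        by_contra hc
        exact h4 ⟨⟨h1, Nat.le_floor (by linarith)⟩, h3⟩
      · rintro ⟨⟨h1, h2⟩, h3, h4⟩
        refine ⟨⟨⟨h1, h2⟩, h3⟩, fun h => ?_⟩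
        have := (Nat.le_floor_iff (by linarith)).1 h.1.2
        linarith
    rw [this] at hs
    linarith
  have hterm : ∀ k ∈ (Ioc 0 ⌊X⌋₊).filter (fun p => PPr p ∧ X / K < p),
      Real.log k / k ≤ Real.log X * K / X := by
    intro k hk
    simp only [mem_filter, mem_Ioc] at hk
    have hk0 : (0:ℝ) < k := by exact_mod_cast hk.1.1
    have hkX : (k:ℝ) ≤ X := (Nat.le_floor_iff (by linarith)).1 hk.1.2
    rw [div_le_div_iff₀ hk0 hX0]
    have h1 : Real.log k ≤ Real.log X := Real.log_le_log hk0 hkX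
    have h2 : X ≤ K * k := by
      have := hk.2.2
      rw [div_lt_iff₀ (by linarith)] at this
      linarith
    calc Real.log k * X ≤ Real.log X * (K * k) := by gcongr
      _ = _ := by ring
  have := hdiff.trans (sum_le_card_nsmul _ _ _ hterm)
  rw [nsmul_eq_mul] at this
  rw [div_le_iff₀ (by positivity)]
  have h5 := mul_le_mul_of_nonneg_right this hX0.le
  rw [one_mul] at h5
  refine h5.trans (le_of_eq ?_)
  field_simp

/-- Chebyshev upper bound -/
lemma pi_upper (x : ℝ) (hx : 2 ≤ x) (F : Finset ℕ) (hF : ∀ p ∈ F, p.Prime ∧ (p:ℝ) ≤ x) :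
    (F.card : ℝ) ≤ 8 * x / Real.log x := by
  have h1 : F.card ≤ Nat.primeCounting ⌊x⌋₊ := by
    rw [Nat.primeCounting, Nat.primeCounting', Nat.count_eq_card_filter_range]
    apply card_le_card
    intro p hp
    obtain ⟨h1, h2⟩ := hF p hp
    rw [mem_filter, mem_range]
    exact ⟨by have := Nat.le_floor h2; omega, h1⟩
  have h2 := Chebyshev.pi_le_log4_mul_div (x := x) (by linarith)
  have h3 : (F.card:ℝ) ≤ Nat.primeCounting ⌊x⌋₊ := by exact_mod_cast h1
  refine h3.trans (h2.trans ?_)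
  have hl : 0 < Real.log x := Real.log_pos (by linarith)
  have hs : 0 < √x := Real.sqrt_pos.2 (by linarith)
  have hlog4 : Real.log 4 ≤ 2 := by
    have : (4:ℝ) = 2^2 := by norm_num
    rw [this, Real.log_pow]; have := Real.log_two_lt_d9; push_cast; linarith
  have e1 : Real.log √x = Real.log x / 2 := Real.log_sqrt (by linarith)
  have e2 : Real.log x ≤ 2 * √x := by
    have := Real.log_le_sub_one_of_pos hs
    linarith
  rw [e1, le_div_iff₀ hl, add_mul]
  have e3 : Real.log 4 * x / (Real.log x / 2) * Real.log x = 2 * (Real.log 4 * x) := by field_simp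
  rw [e3]
  have e4 : √x * Real.log x ≤ √x * (2 * √x) := by gcongr
  have e5 : √x * √x = x := Real.mul_self_sqrt (by linarith)
  nlinarith

/-- theta upper bound -/
lemma theta_upper (x : ℝ) (hx : 0 ≤ x) (F : Finset ℕ) (hF : ∀ p ∈ F, p.Prime ∧ (p:ℝ) ≤ x) :
    ∑ p ∈ F, Real.log p ≤ 2 * x := by
  have h1 := Chebyshev.theta_le_log4_mul_x hx
  have hlog4 : Real.log 4 ≤ 2 := by
    have : (4:ℝ) = 2^2 := by norm_num
    rw [this, Real.log_pow]; have := Real.log_two_lt_d9; push_cast; linarith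
  rw [Chebyshev.theta] at h1
  calc _ ≤ _ := sum_le_sum_of_subset_of_nonneg (t := (Ioc 0 ⌊x⌋₊).filter Nat.Prime) ?_ ?_
    _ ≤ _ := h1
    _ ≤ _ := by gcongr
  · intro p hp
    obtain ⟨h1, h2⟩ := hF p hp
    rw [mem_filter, mem_Ioc]
    exact ⟨⟨h1.pos, Nat.le_floor h2⟩, h1⟩
  · intro p _ _
    exact Real.log_natCast_nonneg p

end PNN

namespace PNN
open Finset

section comb
variable {α : Type*} [DecidableEq α]

lemma double_count (P : Finset α) (n : ℕ) (F : Finset α → α → ℝ) :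
    ∑ t ∈ powersetCard (n+1) P, ∑ p ∈ t, F (t.erase p) p =
    ∑ t ∈ powersetCard n P, ∑ p ∈ P \ t, F t p := by
  rw [sum_sigma', sum_sigma']
  refine sum_bij' (fun x _ => ⟨x.1.erase x.2, x.2⟩) (fun x _ => ⟨insert x.2 x.1, x.2⟩) ?_ ?_ ?_ ?_ ?_
  · rintro ⟨t, p⟩ h
    simp only [mem_sigma, mem_powersetCard, mem_sdiff, mem_erase] at h ⊢
    refine ⟨⟨(erase_subset _ _).trans h.1.1, ?_⟩, h.1.1 h.2, by simp⟩
    rw [card_erase_of_mem h.2, h.1.2]; rfl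
  · rintro ⟨t, p⟩ h
    simp only [mem_sigma, mem_powersetCard, mem_sdiff] at h ⊢
    refine ⟨⟨insert_subset h.2.1 h.1.1, ?_⟩, mem_insert_self _ _⟩
    rw [card_insert_of_notMem h.2.2, h.1.2]
  · rintro ⟨t, p⟩ h
    simp only [mem_sigma, mem_powersetCard] at h
    simp [insert_erase h.2]
  · rintro ⟨t, p⟩ h
    simp only [mem_sigma, mem_powersetCard, mem_sdiff] at h
    simp [erase_insert h.2.2]
  · rintro ⟨t, p⟩ h; rfl

lemma esymm_succ (P : Finset α) (x : α → ℝ) (n : ℕ) :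
    ((n:ℝ)+1) * ∑ t ∈ powersetCard (n+1) P, ∏ p ∈ t, x p =
    ∑ t ∈ powersetCard n P, (∏ p ∈ t, x p) * ∑ p ∈ P \ t, x p := by
  have h := double_count P n (fun t p => (∏ q ∈ t, x q) * x p)
  simp_rw [mul_sum]
  rw [← h]
  refine sum_congr rfl fun t ht => ?_
  rw [mem_powersetCard] at ht
  rw [sum_congr rfl (g := fun _ => ∏ q ∈ t, x q) (fun p hp => prod_erase_mul _ _ hp), sum_const, ht.2]
  simp

lemma esymm_le (P : Finset α) (x : α → ℝ) (hx : ∀ p ∈ P, 0 ≤ x p) (n : ℕ) :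
    ∑ t ∈ powersetCard n P, ∏ p ∈ t, x p ≤ (∑ p ∈ P, x p) ^ n / n.factorial := by
  induction n with
  | zero => simp
  | succ n ih =>
    have hS : 0 ≤ ∑ p ∈ P, x p := sum_nonneg hx
    have h1 : ((n:ℝ)+1) * ∑ t ∈ powersetCard (n+1) P, ∏ p ∈ t, x p ≤
        (∑ p ∈ P, x p) ^ n / n.factorial * ∑ p ∈ P, x p := by
      rw [esymm_succ]
      refine le_trans ?_ (mul_le_mul_of_nonneg_right ih hS)
      rw [sum_mul]
      refine sum_le_sum fun t ht => ?_
      rw [mem_powersetCard] at ht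
      refine mul_le_mul_of_nonneg_left ?_ (prod_nonneg fun p hp => hx p (ht.1 hp))
      exact sum_le_sum_of_subset_of_nonneg sdiff_subset fun p hp _ => hx p hp
    rw [Nat.factorial_succ, le_div_iff₀ (by positivity)]
    rw [div_mul_eq_mul_div, le_div_iff₀ (by positivity), ← pow_succ] at h1
    push_cast
    linarith

lemma esymm_nonneg (P : Finset α) (x : α → ℝ) (hx : ∀ p ∈ P, 0 ≤ x p) (n : ℕ) :
    0 ≤ ∑ t ∈ powersetCard n P, ∏ p ∈ t, x p :=
  sum_nonneg fun t ht => prod_nonneg fun p hp => hx p ((mem_powersetCard.1 ht).1 hp)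

lemma esymm_lower (P : Finset α) (x : α → ℝ) (hx : ∀ p ∈ P, 0 ≤ x p) (n : ℕ) :
    (∑ p ∈ P, x p)^n * ((∑ p ∈ P, x p)^2 - n*(n-1)/2 * ∑ p ∈ P, x p ^ 2) ≤
    (∑ p ∈ P, x p)^2 * (n.factorial * ∑ t ∈ powersetCard n P, ∏ p ∈ t, x p) := by
  set S := ∑ p ∈ P, x p with hSdef
  set Q := ∑ p ∈ P, x p ^ 2 with hQ
  have hS : 0 ≤ S := sum_nonneg hx
  have hQ0 : 0 ≤ Q := sum_nonneg fun p _ => sq_nonneg _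
  induction n with
  | zero => simp
  | succ n ih =>
    have h1 : (n.factorial:ℝ) * (((n:ℝ)+1) * ∑ t ∈ powersetCard (n+1) P, ∏ p ∈ t, x p) ≥
        S * (n.factorial * ∑ t ∈ powersetCard n P, ∏ p ∈ t, x p)
        - n.factorial * ∑ t ∈ powersetCard n P, (∏ p ∈ t, x p) * ∑ p ∈ t, x p := by
      rw [esymm_succ]
      apply le_of_eq
      have : ∀ t ∈ powersetCard n P, (∏ p ∈ t, x p) * ∑ p ∈ P \ t, x p =
          S * (∏ p ∈ t, x p) - (∏ p ∈ t, x p) * ∑ p ∈ t, x p := by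
        intro t ht
        rw [mem_powersetCard] at ht
        have := sum_sdiff (f := x) ht.1
        rw [hSdef, ← this]; ring
      rw [sum_congr rfl this, sum_sub_distrib, ← mul_sum]; ring
    have h2 : (n.factorial:ℝ) * ∑ t ∈ powersetCard n P, (∏ p ∈ t, x p) * ∑ p ∈ t, x p ≤
        n * S^(n-1) * Q := by
      cases n with
      | zero => simp
      | succ m =>
        have h3 := double_count P m (fun t p => (∏ q ∈ t, x q) * x p ^ 2)
        have h4 : ∑ t ∈ powersetCard (m+1) P, (∏ p ∈ t, x p) * ∑ p ∈ t, x p =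
            ∑ t ∈ powersetCard (m+1) P, ∑ p ∈ t, (∏ q ∈ t.erase p, x q) * x p ^ 2 := by
          refine sum_congr rfl fun t ht => ?_
          rw [mul_sum]
          refine sum_congr rfl fun p hp => ?_
          rw [← prod_erase_mul _ _ hp]; ring
        rw [h4, h3]
        have h5 : ∑ t ∈ powersetCard m P, ∑ p ∈ P \ t, (∏ q ∈ t, x q) * x p ^ 2 ≤
            S^m/m.factorial * Q := by
          refine le_trans ?_ (mul_le_mul_of_nonneg_right (esymm_le P x hx m) hQ0)
          rw [sum_mul]
          refine sum_le_sum fun t ht => ?_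
          rw [mem_powersetCard] at ht
          rw [← mul_sum]
          refine mul_le_mul_of_nonneg_left ?_ (prod_nonneg fun p hp => hx p (ht.1 hp))
          exact sum_le_sum_of_subset_of_nonneg sdiff_subset fun p hp _ => sq_nonneg _
        calc _ ≤ ((m+1).factorial:ℝ) * (S^m/m.factorial * Q) := by gcongr
          _ = _ := by
            rw [Nat.factorial_succ]; push_cast
            have : (m.factorial:ℝ) ≠ 0 := by positivity
            field_simp
    have h6 : S^2 * (n * S^(n-1) * Q) = n * S^(n+1) * Q := by
      cases n with
      | zero => simp
      | succ m => simp; ring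
    have h7 := mul_le_mul_of_nonneg_left ih hS
    have h8 := mul_le_mul_of_nonneg_left h2 (sq_nonneg S)
    have h9 := mul_le_mul_of_nonneg_left h1 (sq_nonneg S)
    rw [h6] at h8
    rw [Nat.factorial_succ]
    push_cast
    have e1 : S ^ (n+1) * (S^2 - ((n:ℝ)+1)*((n:ℝ)+1-1)/2 * Q) =
      S * (S^n * (S^2 - n*(n-1)/2*Q)) - n * S^(n+1) * Q := by ring
    rw [e1]
    calc _ ≤ _ := sub_le_sub h7 h8
      _ = S^2 * (S * ((n.factorial:ℝ) * ∑ t ∈ powersetCard n P, ∏ p ∈ t, x p)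
        - n.factorial * ∑ t ∈ powersetCard n P, (∏ p ∈ t, x p) * ∑ p ∈ t, x p) := by ring
      _ ≤ _ := h9
      _ = _ := by ring

lemma powerset_split (P Q : Finset α) (hQ : Q ⊆ P) (F : Finset α → Finset α → ℝ) :
    ∑ a ∈ P.powerset, F (a ∩ Q) (a \ Q) =
    ∑ b ∈ Q.powerset, ∑ c ∈ (P \ Q).powerset, F b c := by
  rw [← sum_product']
  refine sum_bij' (fun a _ => (a ∩ Q, a \ Q)) (fun x _ => x.1 ∪ x.2) ?_ ?_ ?_ ?_ ?_
  · intro a ha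
    rw [mem_powerset] at ha
    rw [mem_product, mem_powerset, mem_powerset]
    exact ⟨inter_subset_right, sdiff_subset_sdiff ha le_rfl⟩
  · rintro ⟨b, c⟩ h
    rw [mem_product, mem_powerset, mem_powerset] at h
    rw [mem_powerset]
    exact union_subset (h.1.trans hQ) (h.2.trans sdiff_subset)
  · intro a _
    simp only
    rw [union_comm, sdiff_union_inter]
  · rintro ⟨b, c⟩ h
    rw [mem_product, mem_powerset, mem_powerset] at h
    have hd : Disjoint c Q := disjoint_of_subset_left h.2 sdiff_disjoint
    have hb := h.1
    ext p
    · simp only [mem_inter, mem_union]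
      constructor
      · rintro ⟨h1 | h1, h2⟩
        · exact h1
        · exact absurd h2 (disjoint_left.1 hd h1)
      · intro h1; exact ⟨Or.inl h1, hb h1⟩
    · simp only [mem_sdiff, mem_union]
      constructor
      · rintro ⟨h1 | h1, h2⟩
        · exact absurd (hb h1) h2
        · exact h1
      · intro h1; exact ⟨Or.inr h1, disjoint_left.1 hd h1⟩
  · intro a _; rfl

/-- weighted sum over subsets -/
noncomputable def pw (f : α → ℝ) (Q : Finset α) (φ : Finset α → ℝ) : ℝ :=
  ∑ b ∈ Q.powerset, (∏ p ∈ b, f p) * φ b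

lemma prod_inter_sdiff (f : α → ℝ) (a Q : Finset α) :
    (∏ p ∈ a ∩ Q, f p) * ∏ p ∈ a \ Q, f p = ∏ p ∈ a, f p :=
  prod_inter_mul_prod_sdiff a Q f

lemma pw_one (f : α → ℝ) (Q : Finset α) : pw f Q (fun _ => 1) = ∏ p ∈ Q, (1 + f p) := by
  unfold pw
  simp [prod_one_add]

lemma pw_mono {f : α → ℝ} {Q : Finset α} (hf : ∀ p ∈ Q, 0 ≤ f p) {φ ψ : Finset α → ℝ}
    (h : ∀ b ⊆ Q, φ b ≤ ψ b) : pw f Q φ ≤ pw f Q ψ := by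
  refine sum_le_sum fun b hb => ?_
  rw [mem_powerset] at hb
  exact mul_le_mul_of_nonneg_left (h b hb) (prod_nonneg fun p hp => hf p (hb hp))

lemma pw_nonneg {f : α → ℝ} {Q : Finset α} (hf : ∀ p ∈ Q, 0 ≤ f p) {φ : Finset α → ℝ}
    (h : ∀ b ⊆ Q, 0 ≤ φ b) : 0 ≤ pw f Q φ := by
  refine sum_nonneg fun b hb => ?_
  rw [mem_powerset] at hb
  exact mul_nonneg (prod_nonneg fun p hp => hf p (hb hp)) (h b hb)

lemma pw_split (f : α → ℝ) (P Q : Finset α) (hQ : Q ⊆ P) (φ ψ : Finset α → ℝ) :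
    pw f P (fun a => φ (a ∩ Q) * ψ (a \ Q)) = pw f Q φ * pw f (P \ Q) ψ := by
  unfold pw
  have := powerset_split P Q hQ (fun b c => ((∏ p ∈ b, f p) * φ b) * ((∏ p ∈ c, f p) * ψ c))
  rw [sum_mul_sum, ← this]
  refine sum_congr rfl fun a _ => ?_
  rw [← prod_inter_sdiff f a Q]; ring

/-- product bound over disjoint blocks -/
lemma blocks_bound {ι : Type*} [DecidableEq ι] (f : α → ℝ) (J : Finset ι) (Q : ι → Finset α)
    (φ : ι → Finset α → ℝ) (c : ι → ℝ) (hφ : ∀ j ∈ J, ∀ b, 0 ≤ φ j b) (P : Finset α)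
    (hf : ∀ p ∈ P, 0 ≤ f p) (hQ : ∀ j ∈ J, Q j ⊆ P)
    (hd : ∀ i ∈ J, ∀ j ∈ J, i ≠ j → Disjoint (Q i) (Q j)) (hc : ∀ j ∈ J, 0 ≤ c j)
    (hb : ∀ j ∈ J, pw f (Q j) (φ j) ≤ c j * ∏ p ∈ Q j, (1 + f p)) :
    pw f P (fun a => ∏ j ∈ J, φ j (a ∩ Q j)) ≤ (∏ j ∈ J, c j) * ∏ p ∈ P, (1 + f p) := by
  induction J using Finset.induction_on generalizing P with
  | empty => simp [pw_one]
  | insert i J hi ih =>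
    have hQi := hQ i (mem_insert_self _ _)
    have h1 : pw f P (fun a => ∏ j ∈ insert i J, φ j (a ∩ Q j)) =
        pw f P (fun a => φ i (a ∩ Q i) * (fun b => ∏ j ∈ J, φ j (b ∩ Q j)) (a \ Q i)) := by
      unfold pw
      refine sum_congr rfl fun a ha => ?_
      show _ * (∏ j ∈ insert i J, φ j (a ∩ Q j)) = _ * (φ i (a ∩ Q i) * ∏ j ∈ J, φ j ((a \ Q i) ∩ Q j))
      rw [prod_insert hi]
      congr 2
      refine prod_congr rfl fun j hj => ?_
      have hdj := hd i (mem_insert_self _ _) j (mem_insert_of_mem hj) (by rintro rfl; exact hi hj)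
      congr 1
      ext p
      simp only [mem_inter, mem_sdiff]
      constructor
      · rintro ⟨h1, h2⟩; exact ⟨⟨h1, disjoint_right.1 hdj h2⟩, h2⟩
      · rintro ⟨⟨h1, _⟩, h2⟩; exact ⟨h1, h2⟩
    rw [h1, pw_split f P (Q i) hQi (φ i) (fun b => ∏ j ∈ J, φ j (b ∩ Q j)), prod_insert hi]
    have h3 : pw f (P \ Q i) (fun b => ∏ j ∈ J, φ j (b ∩ Q j)) ≤
        (∏ j ∈ J, c j) * ∏ p ∈ P \ Q i, (1 + f p) := by
      refine ih (fun j hj => hφ j (mem_insert_of_mem hj)) (P \ Q i)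
        (fun p hp => hf p (mem_sdiff.1 hp).1) ?_
        (fun a ha b hb => hd a (mem_insert_of_mem ha) b (mem_insert_of_mem hb))
        (fun j hj => hc j (mem_insert_of_mem hj)) (fun j hj => hb j (mem_insert_of_mem hj))
      intro j hj p hp
      have hdj := hd i (mem_insert_self _ _) j (mem_insert_of_mem hj) (by rintro rfl; exact hi hj)
      exact mem_sdiff.2 ⟨hQ j (mem_insert_of_mem hj) hp, disjoint_right.1 hdj hp⟩
    have h4 := hb i (mem_insert_self _ _)
    have h5 : 0 ≤ pw f (P \ Q i) (fun b => ∏ j ∈ J, φ j (b ∩ Q j)) :=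
      pw_nonneg (fun p hp => hf p (mem_sdiff.1 hp).1)
        (fun b _ => prod_nonneg fun j hj => hφ j (mem_insert_of_mem hj) _)
    have h6 : 0 ≤ c i * ∏ p ∈ Q i, (1 + f p) :=
      mul_nonneg (hc i (mem_insert_self _ _)) (prod_nonneg fun p hp => by
        have := hf p (hQi hp); linarith)
    calc _ ≤ (c i * ∏ p ∈ Q i, (1 + f p)) * ((∏ j ∈ J, c j) * ∏ p ∈ P \ Q i, (1 + f p)) :=
          mul_le_mul h4 h3 h5 h6
      _ = _ := by rw [← prod_sdiff hQi]; ring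

/-- fixed cardinality sum in terms of the small part -/
lemma card_split_bound (f : α → ℝ) (P Q : Finset α) (hQ : Q ⊆ P) (hf : ∀ p ∈ P, 0 ≤ f p)
    (R : ℕ) (φ : Finset α → ℝ) (hφ : ∀ b, 0 ≤ φ b) (T : ℝ) (hT : T = ∑ p ∈ P \ Q, f p) :
    ∑ t ∈ powersetCard R P, (∏ p ∈ t, f p) * φ (t ∩ Q) ≤
    pw f Q (fun b => if b.card ≤ R then φ b * (T ^ (R - b.card) / (R - b.card).factorial) else 0) := by
  have h0 : ∑ t ∈ powersetCard R P, (∏ p ∈ t, f p) * φ (t ∩ Q) =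
      ∑ a ∈ P.powerset, (fun b c => if b.card + c.card = R then
        ((∏ p ∈ b, f p) * φ b) * (∏ p ∈ c, f p) else 0) (a ∩ Q) (a \ Q) := by
    rw [powersetCard_eq_filter]
    rw [sum_filter]
    refine sum_congr rfl fun a _ => ?_
    simp only [card_inter_add_card_sdiff]
    split_ifs
    · rw [← prod_inter_sdiff f a Q]; ring
    · rfl
  rw [h0, powerset_split P Q hQ (fun b c => if b.card + c.card = R then
        ((∏ p ∈ b, f p) * φ b) * (∏ p ∈ c, f p) else 0)]
  unfold pw
  refine sum_le_sum fun b hb => ?_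
  rw [mem_powerset] at hb
  have hb0 : 0 ≤ ∏ p ∈ b, f p := prod_nonneg fun p hp => hf p (hQ (hb hp))
  beta_reduce
  split_ifs with h
  · have : ∑ c ∈ (P \ Q).powerset, (if b.card + c.card = R then
        ((∏ p ∈ b, f p) * φ b) * (∏ p ∈ c, f p) else 0) =
        ((∏ p ∈ b, f p) * φ b) * ∑ c ∈ powersetCard (R - b.card) (P \ Q), ∏ p ∈ c, f p := by
      rw [powersetCard_eq_filter, sum_filter, mul_sum]
      refine sum_congr rfl fun c _ => ?_
      by_cases hc : b.card + c.card = R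
      · rw [if_pos hc, if_pos (by omega)]
      · rw [if_neg hc, if_neg (by omega), mul_zero]
    rw [this, hT, ← mul_assoc]
    refine mul_le_mul_of_nonneg_left ?_ (mul_nonneg hb0 (hφ b))
    exact esymm_le _ _ (fun p hp => hf p (mem_sdiff.1 hp).1) _
  · rw [mul_zero]
    apply le_of_eq
    refine sum_eq_zero fun c _ => ?_
    rw [if_neg (by omega)]

end comb
end PNN

namespace PNN
open Finset

lemma stir_up (x : ℕ) (hx : 1 ≤ x) (y : ℝ) (hy : 0 ≤ y) :
    y ^ x / x.factorial ≤ Real.exp y / √x := by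
  have h1 := Stirling.le_factorial_stirling x
  have hx0 : (0:ℝ) < x := by exact_mod_cast hx
  have h2 : √(x:ℝ) ≤ √(2 * Real.pi * x) := by
    apply Real.sqrt_le_sqrt
    nlinarith [Real.pi_gt_three]
  have h3 : √(x:ℝ) * (x / Real.exp 1)^x ≤ x.factorial :=
    le_trans (by gcongr) h1
  have h4 : y ^ x ≤ (x / Real.exp 1)^x * Real.exp y := by
    have h5 : y ≤ x / Real.exp 1 * Real.exp (y/x) := by
      have := Real.add_one_le_exp (y/x - 1)
      rw [Real.exp_sub] at this
      have h6 : y = x * (y/x - 1 + 1) := by field_simp; ring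
      calc y = x * (y/x - 1 + 1) := h6
        _ ≤ x * (Real.exp (y/x) / Real.exp 1) := by gcongr
        _ = _ := by ring
    calc y ^ x ≤ (x / Real.exp 1 * Real.exp (y/x))^x := by gcongr
      _ = _ := by
        rw [mul_pow, ← Real.exp_nat_mul]; congr 2; field_simp
  have hsx : 0 < √(x:ℝ) := Real.sqrt_pos.2 hx0
  rw [div_le_div_iff₀ (by positivity) hsx]
  calc y^x * √x ≤ (x / Real.exp 1)^x * Real.exp y * √x := by gcongr
    _ = Real.exp y * (√x * (x / Real.exp 1)^x) := by ring
    _ ≤ _ := by gcongr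

lemma fact_up (n : ℕ) (hn : 1 ≤ n) :
    (n.factorial : ℝ) ≤ Real.exp 1 * √n * (n / Real.exp 1)^n := by
  have h := Stirling.stirlingSeq'_antitone (Nat.zero_le (n-1))
  simp only [Function.comp] at h
  rw [show (n-1).succ = n by omega, show Nat.succ 0 = 1 from rfl, Stirling.stirlingSeq_one] at h
  unfold Stirling.stirlingSeq at h
  have hn0 : (0:ℝ) < n := by exact_mod_cast hn
  rw [div_le_iff₀ (by positivity)] at h
  refine h.trans (le_of_eq ?_)
  rw [Real.sqrt_mul (by norm_num)]
  have : √(2:ℝ) ≠ 0 := by positivity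
  field_simp

lemma pow_div_fact_ge (R : ℕ) (hR : 1 ≤ R) (S : ℝ) (hS : 0 ≤ S) :
    (S/R)^R * Real.exp R / (Real.exp 1 * √R) ≤ S^R / R.factorial := by
  have h := fact_up R hR
  have hn0 : (0:ℝ) < R := by exact_mod_cast hR
  rw [div_le_div_iff₀ (by positivity) (by positivity)]
  calc (S/R)^R * Real.exp R * R.factorial
      ≤ (S/R)^R * Real.exp R * (Real.exp 1 * √R * (R / Real.exp 1)^R) := by gcongr
    _ = S^R * (Real.exp 1 * √R) := by
      rw [div_pow, div_pow, ← Real.exp_nat_mul, mul_one]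
      field_simp

/-- primes below N -/
noncomputable def PN (N : ℝ) : Finset ℕ := (range ⌈N⌉₊).filter PPr

lemma mem_PN {N : ℝ} {p : ℕ} : p ∈ PN N ↔ (p:ℝ) < N ∧ PPr p := by
  unfold PN; rw [mem_filter, mem_range, Nat.lt_ceil]

noncomputable def pr (t : Finset ℕ) : ℕ := ∏ p ∈ t, p

noncomputable def w (t : Finset ℕ) : ℝ := ∏ p ∈ t, (1:ℝ)/p

lemma w_eq (t : Finset ℕ) : w t = 1 / (pr t : ℝ) := by
  unfold w pr; push_cast; rw [prod_div_distrib]; simp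

lemma w_nonneg (t : Finset ℕ) : 0 ≤ w t := by rw [w_eq]; positivity

noncomputable def SS (N : ℝ) : ℝ := ∑ p ∈ PN N, (1:ℝ)/p

lemma SS_nonneg (N : ℝ) : 0 ≤ SS N := sum_nonneg fun p _ => by positivity

noncomputable def Dr (r : ℕ) (N X : ℝ) : Finset (Finset ℕ) :=
  (powersetCard r (PN N)).filter (fun t => (pr t : ℝ) < X)

lemma prime_of_mem {N : ℝ} {t : Finset ℕ} (ht : t ⊆ PN N) {p : ℕ} (hp : p ∈ t) : p.Prime :=
  (mem_PN.1 (ht hp)).2.1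

lemma pr_pos {N : ℝ} {t : Finset ℕ} (ht : t ⊆ PN N) : 0 < pr t :=
  prod_pos fun p hp => (prime_of_mem ht hp).pos

lemma pr_inj {N : ℝ} {s t : Finset ℕ} (hs : s ⊆ PN N) (ht : t ⊆ PN N) (h : pr s = pr t) : s = t := by
  have h1 := Nat.primeFactors_prod (s := s) (fun p hp => prime_of_mem hs hp)
  have h2 := Nat.primeFactors_prod (s := t) (fun p hp => prime_of_mem ht hp)
  unfold pr at h
  rw [h] at h1
  exact h1.symm.trans h2

lemma log_pr {N : ℝ} {t : Finset ℕ} (ht : t ⊆ PN N) : Real.log (pr t) = ∑ p ∈ t, Real.log p := by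
  unfold pr; push_cast
  exact Real.log_prod (fun p hp => by exact_mod_cast (prime_of_mem ht hp).ne_zero)

lemma pr_erase {t : Finset ℕ} {p : ℕ} (hp : p ∈ t) : pr (t.erase p) * p = pr t :=
  prod_erase_mul _ _ hp

/-- number of sets with small product -/
lemma card_small (N X : ℝ) (F : Finset (Finset ℕ)) (hF : ∀ t ∈ F, t ⊆ PN N) (hX : 0 ≤ X)
    (h : ∀ t ∈ F, (pr t : ℝ) ≤ X) : (F.card : ℝ) ≤ X := by
  have h1 : F.card ≤ (Ioc 0 ⌊X⌋₊).card := by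
    refine card_le_card_of_injOn pr ?_ ?_
    · intro t ht
      rw [coe_Ioc, Set.mem_Ioc]
      exact ⟨pr_pos (hF t ht), Nat.le_floor (h t ht)⟩
    · intro s hs t ht hst
      exact pr_inj (hF s hs) (hF t ht) hst
  rw [Nat.card_Ioc] at h1
  calc (F.card:ℝ) ≤ (⌊X⌋₊:ℝ) := by exact_mod_cast h1
    _ ≤ X := Nat.floor_le hX

lemma theta_sum (N X : ℝ) (t : Finset ℕ) (ht : t ⊆ PN N) (hX : 0 ≤ X) :
    ∑ p ∈ PN N \ t, (if (pr t : ℝ) * p < X then Real.log p else 0) ≤ 2 * X * w t := by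
  rw [← sum_filter]
  have hp := pr_pos ht
  have hp' : (0:ℝ) < pr t := by exact_mod_cast hp
  have := theta_upper (X / pr t) (by positivity) ((PN N \ t).filter (fun p : ℕ => (pr t : ℝ) * p < X)) ?_
  · refine this.trans (le_of_eq ?_)
    rw [w_eq]; ring
  · intro p h
    rw [mem_filter, mem_sdiff, mem_PN] at h
    refine ⟨h.1.1.2.1, ?_⟩
    rw [le_div_iff₀ hp']
    linarith [h.2]

/-- log trick -/
lemma log_trick (N X : ℝ) (F : Finset (Finset ℕ)) (hF : ∀ t ∈ F, t ⊆ PN N) (hX : 1 < X) :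
    (F.card : ℝ) ≤ √X + 2 / Real.log X * ∑ t ∈ F, ∑ p ∈ t, Real.log p := by
  have hlX : 0 < Real.log X := Real.log_pos hX
  have h0 : F.card = (F.filter (fun t => (pr t : ℝ) ≤ √X)).card +
      (F.filter (fun t => ¬ (pr t : ℝ) ≤ √X)).card := (card_filter_add_card_filter_not _).symm
  have h1 : ((F.filter (fun t => (pr t : ℝ) ≤ √X)).card : ℝ) ≤ √X :=
    card_small N _ _ (fun t ht => hF t (mem_filter.1 ht).1) (Real.sqrt_nonneg _)
      (fun t ht => (mem_filter.1 ht).2)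
  have hnn : ∀ t ∈ F, 0 ≤ ∑ p ∈ t, Real.log p := fun t ht =>
    sum_nonneg fun p _ => Real.log_natCast_nonneg p
  have h2 : ((F.filter (fun t => ¬ (pr t : ℝ) ≤ √X)).card : ℝ) ≤
      2 / Real.log X * ∑ t ∈ F, ∑ p ∈ t, Real.log p := by
    rw [mul_sum]
    calc _ = ∑ t ∈ F.filter (fun t => ¬ (pr t : ℝ) ≤ √X), (1:ℝ) := by simp
      _ ≤ ∑ t ∈ F.filter (fun t => ¬ (pr t : ℝ) ≤ √X), 2 / Real.log X * ∑ p ∈ t, Real.log p := by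
        refine sum_le_sum fun t ht => ?_
        rw [mem_filter, not_le] at ht
        rw [← log_pr (hF t ht.1)]
        have : Real.log √X ≤ Real.log (pr t) :=
          Real.log_le_log (Real.sqrt_pos.2 (by linarith)) ht.2.le
        rw [Real.log_sqrt (by linarith)] at this
        rw [div_mul_eq_mul_div, le_div_iff₀ hlX]
        linarith
      _ ≤ _ := by
        refine sum_le_sum_of_subset_of_nonneg (filter_subset _ _) fun t ht _ => ?_
        have := hnn t ht
        positivity
  rw [h0]; push_cast; linarith

/-- double counting for primes p with some property, and predicates inherited by erasing -/
lemma dc_bound (N X : ℝ) (n : ℕ) (F : Finset (Finset ℕ)) (hF : F ⊆ Dr (n+1) N X)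
    (A : Finset (Finset ℕ)) (hA : A ⊆ powersetCard n (PN N)) (T : ℕ → Prop) [DecidablePred T]
    (hT : ∀ t ∈ F, ∀ p ∈ t, T p → t.erase p ∈ A) (hX : 0 ≤ X) :
    ∑ t ∈ F, ∑ p ∈ t.filter T, Real.log p ≤ 2 * X * ∑ t ∈ A, w t := by
  classical
  have h := double_count (PN N) n (fun t p => if T p ∧ t ∈ A ∧ (pr t : ℝ) * p < X then Real.log p else 0)
  calc ∑ t ∈ F, ∑ p ∈ t.filter T, Real.log p
      ≤ ∑ t ∈ F, ∑ p ∈ t, (if T p ∧ t.erase p ∈ A ∧ (pr (t.erase p) : ℝ) * p < X then Real.log p else 0) := by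
        refine sum_le_sum fun t ht => ?_
        rw [sum_filter]
        refine sum_le_sum fun p hp => ?_
        by_cases hTp : T p
        · have h1 := hF ht
          unfold Dr at h1
          rw [mem_filter] at h1
          rw [if_pos hTp, if_pos ⟨hTp, hT t ht p hp hTp, by
            have := pr_erase hp
            rw [← Nat.cast_mul, this]; exact h1.2⟩]
        · rw [if_neg hTp, if_neg (by tauto)]
    _ ≤ ∑ t ∈ powersetCard (n+1) (PN N), ∑ p ∈ t, (if T p ∧ t.erase p ∈ A ∧ (pr (t.erase p) : ℝ) * p < X then Real.log p else 0) := by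
        refine sum_le_sum_of_subset_of_nonneg (hF.trans (filter_subset _ _)) fun t _ _ => ?_
        refine sum_nonneg fun p _ => ?_
        split_ifs
        · exact Real.log_natCast_nonneg p
        · rfl
    _ = _ := h
    _ ≤ ∑ t ∈ powersetCard n (PN N), if t ∈ A then 2 * X * w t else 0 := by
        refine sum_le_sum fun t ht => ?_
        rw [mem_powersetCard] at ht
        split_ifs with hA
        · refine le_trans ?_ (theta_sum N X t ht.1 hX)
          refine sum_le_sum fun p hp => ?_
          by_cases h3 : (pr t : ℝ) * p < X
          · rw [if_pos h3]; split_ifs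
            · rfl
            · exact Real.log_natCast_nonneg p
          · rw [if_neg h3, if_neg (by tauto)]
        · apply le_of_eq
          refine sum_eq_zero fun p _ => if_neg (by tauto)
    _ = _ := by
        rw [← sum_filter, mul_sum, filter_mem_eq_inter, inter_eq_right.2 hA]

/-- general upper bound for the count -/
lemma count_upper (N X : ℝ) (n : ℕ) (hX : 1 < X) :
    ((Dr (n+1) N X).card : ℝ) ≤ √X + 4 * (X / Real.log X) * (SS N ^ n / n.factorial) := by
  have h1 := log_trick N X (Dr (n+1) N X) (fun t ht => (mem_powersetCard.1 (mem_filter.1 ht).1).1) hX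
  have h2 := dc_bound N X n (Dr (n+1) N X) le_rfl (powersetCard n (PN N)) le_rfl (fun _ => True)
    (by
      intro t ht p hp _
      have h3 := mem_powersetCard.1 (mem_filter.1 ht).1
      rw [mem_powersetCard]
      exact ⟨(erase_subset _ _).trans h3.1, by rw [card_erase_of_mem hp, h3.2]; rfl⟩) (by linarith)
  simp only [filter_true] at h2
  have h3 := esymm_le (PN N) (fun p => (1:ℝ)/p) (fun p _ => by positivity) n
  have hl : 0 < Real.log X := Real.log_pos hX
  calc _ ≤ _ := h1
    _ ≤ √X + 2 / Real.log X * (2 * X * (SS N ^ n / n.factorial)) := by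
      gcongr
      refine h2.trans ?_
      gcongr
      exact h3
    _ = _ := by ring

end PNN

namespace PNN
open Finset Filter

lemma small_part : ∃ C : ℝ, 1 ≤ C ∧ ∀ N z : ℝ, 3 ≤ z → z^2 ≤ N → ∀ n : ℕ,
    ∑ t ∈ Dr (n+2) N N, ∑ p ∈ t.filter (fun p : ℕ => (p:ℝ) ≤ z), Real.log p ≤
      √N * z^2 + C * (N / Real.log N) * Real.log z * (SS N ^ n / n.factorial) := by
  obtain ⟨C, hC, h⟩ := sum_log_div
  refine ⟨8 * C, by linarith, fun N z hz hzN n => ?_⟩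
  classical
  have hN : 9 ≤ N := by nlinarith
  have hlz : 1 ≤ Real.log z := by
    rw [Real.le_log_iff_exp_le (by linarith)]
    linarith [Real.exp_one_lt_d9]
  have hlN : 0 < Real.log N := Real.log_pos (by linarith)
  have hlzN : 2 * Real.log z ≤ Real.log N := by
    rw [← Real.log_rpow (by linarith)]
    apply Real.log_le_log (by positivity)
    exact_mod_cast hzN
  have hdc := double_count (PN N) (n+1) (fun t p => if (p:ℝ) ≤ z ∧ (pr t : ℝ) * p < N then Real.log p else 0)
  have hX : ∀ p ∈ PN N, (p:ℝ) ≤ z → Real.log p * ((Dr (n+1) N (N/p)).card : ℝ) ≤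
      √N * z + 8 * (N / Real.log N) * (SS N ^ n / n.factorial) * (Real.log p / p) := by
    intro p hp hpz
    have hpp := (mem_PN.1 hp).2.1
    have hp1 : (1:ℝ) ≤ p := by exact_mod_cast hpp.one_lt.le
    have hp0 : (0:ℝ) < p := by linarith
    have hlp : 0 ≤ Real.log p := Real.log_nonneg hp1
    have hlp2 : Real.log p ≤ Real.log z := Real.log_le_log hp0 hpz
    have hlp3 : Real.log p ≤ z := by
      have := Real.log_le_sub_one_of_pos hp0; linarith
    have hNp : 1 < N / p := by rw [lt_div_iff₀ hp0]; nlinarith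
    have h1 := count_upper N (N/p) n hNp
    have h2 : Real.log (N/p) = Real.log N - Real.log p := Real.log_div (by linarith) (by linarith)
    have h3 : Real.log N / 2 ≤ Real.log (N/p) := by rw [h2]; linarith
    have hSn : 0 ≤ SS N ^ n / n.factorial := div_nonneg (pow_nonneg (SS_nonneg N) _) (by positivity)
    have h4 : √(N/p) ≤ √N := Real.sqrt_le_sqrt (div_le_self (by linarith) hp1)
    calc _ ≤ Real.log p * (√N + 4 * ((N/p) / (Real.log N / 2)) * (SS N ^ n / n.factorial)) := by
          refine mul_le_mul_of_nonneg_left (h1.trans ?_) hlp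
          gcongr
      _ = √N * Real.log p + 8 * (N / Real.log N) * (SS N ^ n / n.factorial) * (Real.log p / p) := by
          field_simp; ring
      _ ≤ _ := by gcongr
  have hsub : ∀ p ∈ (PN N).filter (fun p : ℕ => (p:ℝ) ≤ z), PPr p ∧ Real.log p ≤ Real.exp (Real.log (Real.log z)) := by
    intro p hp
    rw [mem_filter] at hp
    have hpp := (mem_PN.1 hp.1).2
    refine ⟨hpp, ?_⟩
    rw [Real.exp_log (by linarith)]
    exact Real.log_le_log (by exact_mod_cast hpp.1.pos) hp.2
  have hs := h (Real.log (Real.log z)) (Real.log_nonneg hlz) _ hsub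
  rw [Real.exp_log (by linarith)] at hs
  have hcard : (((PN N).filter (fun p : ℕ => (p:ℝ) ≤ z)).card : ℝ) ≤ z := by
    have h1 : ((PN N).filter (fun p : ℕ => (p:ℝ) ≤ z)).card ≤ (Ioc 0 ⌊z⌋₊).card := by
      refine card_le_card fun p hp => ?_
      rw [mem_filter] at hp
      rw [mem_Ioc]
      exact ⟨(mem_PN.1 hp.1).2.1.pos, Nat.le_floor hp.2⟩
    rw [Nat.card_Ioc] at h1
    calc _ ≤ (⌊z⌋₊:ℝ) := by exact_mod_cast h1
      _ ≤ z := Nat.floor_le (by linarith)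
  have hSn : 0 ≤ SS N ^ n / n.factorial := div_nonneg (pow_nonneg (SS_nonneg N) _) (by positivity)
  calc _ ≤ ∑ t ∈ powersetCard (n+2) (PN N), ∑ p ∈ t, (if (p:ℝ) ≤ z ∧ (pr (t.erase p) : ℝ) * p < N then Real.log p else 0) := by
        refine le_trans (le_of_eq ?_) (sum_le_sum_of_subset_of_nonneg (s := Dr (n+2) N N) (filter_subset _ _) fun t _ _ => ?_)
        rotate_left
        · refine sum_nonneg fun p _ => ?_
          split_ifs
          · exact Real.log_natCast_nonneg p
          · rfl
        refine sum_congr rfl fun t ht => ?_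
        rw [sum_filter]
        refine sum_congr rfl fun p hp => ?_
        unfold Dr at ht
        rw [mem_filter] at ht
        rw [← Nat.cast_mul, pr_erase hp]
        simp [ht.2]
    _ = _ := hdc
    _ ≤ ∑ t ∈ powersetCard (n+1) (PN N), ∑ p ∈ PN N, (if (p:ℝ) ≤ z ∧ (pr t : ℝ) * p < N then Real.log p else 0) := by
        refine sum_le_sum fun t ht => sum_le_sum_of_subset_of_nonneg sdiff_subset fun p _ _ => ?_
        split_ifs
        · exact Real.log_natCast_nonneg p
        · rfl
    _ = ∑ p ∈ (PN N).filter (fun p : ℕ => (p:ℝ) ≤ z), Real.log p * ((Dr (n+1) N (N/p)).card : ℝ) := by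
        rw [sum_comm, sum_filter]
        refine sum_congr rfl fun p hp => ?_
        have hp0 : (0:ℝ) < p := by exact_mod_cast (mem_PN.1 hp).2.1.pos
        by_cases hpz : (p:ℝ) ≤ z
        · simp only [hpz, true_and, if_true]
          rw [← sum_filter, sum_const, nsmul_eq_mul, mul_comm]
          congr 2
          unfold Dr
          congr 1
          ext t
          rw [mem_filter, mem_filter, lt_div_iff₀ hp0]
        · simp [hpz]
    _ ≤ ∑ p ∈ (PN N).filter (fun p : ℕ => (p:ℝ) ≤ z),
        (√N * z + 8 * (N / Real.log N) * (SS N ^ n / n.factorial) * (Real.log p / p)) := by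
        refine sum_le_sum fun p hp => ?_
        rw [mem_filter] at hp
        exact hX p hp.1 hp.2
    _ = (((PN N).filter (fun p : ℕ => (p:ℝ) ≤ z)).card : ℝ) * (√N * z) + 8 * (N / Real.log N) * (SS N ^ n / n.factorial) *
        ∑ p ∈ (PN N).filter (fun p : ℕ => (p:ℝ) ≤ z), Real.log p / p := by
        rw [sum_add_distrib, sum_const, nsmul_eq_mul, mul_sum]
    _ ≤ z * (√N * z) + 8 * (N / Real.log N) * (SS N ^ n / n.factorial) * (C * Real.log z) := by
        gcongr
    _ = _ := by ring

noncomputable def xx (N : ℝ) : ℝ := Real.log (Real.log N)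

lemma tendsto_xx : Tendsto xx atTop atTop := Real.tendsto_log_atTop.comp Real.tendsto_log_atTop

lemma SS_approx : ∃ M : ℝ, 1 ≤ M ∧ ∀ N : ℝ, 2 ≤ N → |SS N - xx N / 2| ≤ M := by
  obtain ⟨M, hM, h⟩ := mertens_two
  refine ⟨M + 1, by linarith, fun N hN => ?_⟩
  have h1 := h N hN
  have hsub : PN N ⊆ (Ioc 0 ⌊N⌋₊).filter PPr := by
    intro p hp
    rw [mem_PN] at hp
    rw [mem_filter, mem_Ioc]
    exact ⟨⟨hp.2.1.pos, Nat.le_floor hp.1.le⟩, hp.2⟩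
  have h2 := sum_sdiff (f := fun p : ℕ => (1:ℝ)/p) hsub
  have h3 : ∑ p ∈ ((Ioc 0 ⌊N⌋₊).filter PPr) \ PN N, (1:ℝ)/p ≤ 1 := by
    calc _ ≤ ∑ p ∈ ({⌊N⌋₊} : Finset ℕ), (1:ℝ)/p := by
          refine sum_le_sum_of_subset_of_nonneg ?_ fun p _ _ => by positivity
          intro p hp
          rw [Finset.mem_sdiff, mem_filter, mem_Ioc, mem_PN] at hp
          rw [mem_singleton]
          have hNp : N ≤ p := by
            by_contra hc
            exact hp.2 ⟨not_le.1 hc, hp.1.2⟩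
          refine le_antisymm hp.1.1.2 ?_
          have := Nat.floor_le_floor hNp
          simpa using this
      _ ≤ 1 := by
          rw [sum_singleton]
          have : (1:ℝ) ≤ (⌊N⌋₊:ℝ) := by
            have : 1 ≤ ⌊N⌋₊ := Nat.le_floor (by push_cast; linarith)
            exact_mod_cast this
          rw [div_le_one (by linarith)]; exact this
  have h4 : 0 ≤ ∑ p ∈ ((Ioc 0 ⌊N⌋₊).filter PPr) \ PN N, (1:ℝ)/p := sum_nonneg fun p _ => by positivity
  unfold xx SS
  rw [abs_le] at h1 ⊢
  constructor <;> linarith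

def Hyp (N : ℝ) (r : ℕ) : Prop := |(r:ℝ) - 1/2 * xx N| < xx N ^ ((2:ℝ)/3)

/-- facts valid in our range -/
structure Reg (N : ℝ) (R : ℕ) : Prop where
  N2 : 16 ≤ N
  hx : 16 ≤ xx N
  hSR : |(R:ℝ) - SS N| ≤ 2 * xx N ^ ((2:ℝ)/3)
  S1 : 2/5 * xx N ≤ SS N
  S2 : SS N ≤ 3/5 * xx N
  R1 : 2/5 * xx N ≤ R
  R2 : (R:ℝ) ≤ 3/5 * xx N
  RS : |(R:ℝ) - xx N / 2| ≤ 2 * xx N ^ ((2:ℝ)/3)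

lemma ev_rpow (a b ε : ℝ) (hab : a < b) (hε : 0 < ε) : ∀ᶠ x : ℝ in atTop, x ^ a ≤ ε * x ^ b := by
  filter_upwards [(tendsto_rpow_atTop (sub_pos.2 hab)).eventually_ge_atTop (1/ε), eventually_gt_atTop 0]
    with x hx hx0
  rw [Real.rpow_sub hx0, div_le_div_iff₀ hε (by positivity)] at hx
  linarith

lemma ev_log (b ε : ℝ) (hb : 0 < b) (hε : 0 < ε) : ∀ᶠ x : ℝ in atTop, Real.log x ≤ ε * x ^ b := by
  have := (isLittleO_log_rpow_atTop hb).bound hε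
  filter_upwards [this, eventually_gt_atTop 0] with x hx hx0
  rw [Real.norm_of_nonneg (Real.rpow_nonneg hx0.le b)] at hx
  exact (le_abs_self _).trans hx

lemma regime : ∀ᶠ N in atTop, ∀ R : ℕ, Hyp N (R+1) → Reg N R := by
  obtain ⟨M, hM, h⟩ := SS_approx
  have h1 : ∀ᶠ x : ℝ in atTop, (M+1) ≤ x ^ ((2:ℝ)/3) :=
    (tendsto_rpow_atTop (by norm_num)).eventually_ge_atTop _
  have h2 : ∀ᶠ x : ℝ in atTop, x ^ ((2:ℝ)/3) ≤ 1/20 * x := by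
    simpa using ev_rpow ((2:ℝ)/3) 1 (1/20) (by norm_num) (by norm_num)
  filter_upwards [tendsto_xx.eventually h1, tendsto_xx.eventually h2, eventually_ge_atTop 16,
    tendsto_xx.eventually_ge_atTop 16] with N a b c d R hR
  have h3 := h N (by linarith)
  unfold Hyp at hR
  push_cast at hR
  rw [abs_le] at h3
  rw [abs_lt] at hR
  constructor
  · exact c
  · exact d
  · rw [abs_le]; constructor <;> linarith
  · linarith
  · linarith
  · linarith
  · linarith
  · rw [abs_le]; constructor <;> linarith
end PNN

namespace PNN
open Finset Filter

lemma Reg.Rpos {N : ℝ} {R : ℕ} (h : Reg N R) : 1 ≤ R := by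
  have h1 := h.R1; have h2 := h.hx
  by_contra hc
  have : R = 0 := by omega
  subst this; norm_num at h1; linarith

lemma Reg.Spos {N : ℝ} {R : ℕ} (h : Reg N R) : 0 < SS N := by
  linarith [h.S1, h.hx]

lemma Reg.exp_xx {N : ℝ} {R : ℕ} (h : Reg N R) : Real.exp (xx N) = Real.log N :=
  Real.exp_log (Real.log_pos (by linarith [h.N2]))

lemma Reg.logpos {N : ℝ} {R : ℕ} (h : Reg N R) : 0 < Real.log N := Real.log_pos (by linarith [h.N2])

lemma Reg.poisson_lower {N : ℝ} {R : ℕ} (h : Reg N R) :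
    1 / Real.log N ≤ SS N ^ R / R.factorial := by
  have hR : (0:ℝ) < R := by exact_mod_cast h.Rpos
  have hS := h.Spos
  have h1 : Real.exp (-1) ≤ SS N / R := by
    rw [le_div_iff₀ hR]
    have e : Real.exp (-1) ≤ 2/3 := by
      rw [Real.exp_neg, inv_le_comm₀ (Real.exp_pos 1) (by norm_num)]
      linarith [Real.exp_one_gt_d9]
    have := h.S1; have := h.R2; have := h.hx
    nlinarith
  have h2 : (R.factorial:ℝ) ≤ (R:ℝ)^R := by exact_mod_cast Nat.factorial_le_pow R
  calc 1 / Real.log N = Real.exp (-(xx N)) := by rw [Real.exp_neg, h.exp_xx, one_div]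
    _ ≤ Real.exp (-(R:ℝ)) := by
      apply Real.exp_le_exp.2
      linarith [h.R2, h.hx]
    _ = Real.exp (-1) ^ R := by rw [← Real.exp_nat_mul]; congr 1; ring
    _ ≤ (SS N / R)^R := by gcongr
    _ = SS N ^ R / (R:ℝ)^R := by rw [div_pow]
    _ ≤ _ := by gcongr

lemma Reg.shift {N : ℝ} {R : ℕ} (h : Reg N (R+1)) :
    SS N ^ R / R.factorial ≤ 3/2 * (SS N ^ (R+1) / (R+1).factorial) := by
  have hS := h.Spos
  rw [Nat.factorial_succ, pow_succ]
  push_cast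
  have : 3/2 * (SS N ^ R * SS N / (((R:ℝ)+1) * R.factorial)) =
    SS N ^ R / R.factorial * (3/2 * SS N / ((R:ℝ)+1)) := by field_simp
  rw [this]
  apply le_mul_of_one_le_right (by positivity)
  rw [le_div_iff₀ (by positivity)]
  have h1 := h.R2; have := h.S1
  push_cast at h1; linarith

lemma ev_neg : ∀ᶠ N : ℝ in atTop, √N + √N * (Real.exp (√(Real.log N)))^2 ≤ N / Real.log N ^ 3 := by
  have h1 : ∀ᶠ l : ℝ in atTop, 2 * l^3 ≤ Real.exp (l/4) := by
    have := Real.tendsto_pow_mul_exp_neg_atTop_nhds_zero 3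
    have h2 := (this.comp (tendsto_id.atTop_div_const (show (0:ℝ) < 4 by norm_num))).eventually_le_const
      (show (0:ℝ) < 1/128 by norm_num)
    filter_upwards [h2] with l hl
    simp only [Function.comp, id, Real.exp_neg] at hl
    rw [← div_eq_mul_inv, div_le_iff₀ (Real.exp_pos _)] at hl
    have e : (l/4)^3 = l^3/64 := by ring
    rw [e] at hl; linarith
  filter_upwards [Real.tendsto_log_atTop.eventually h1, Real.tendsto_log_atTop.eventually_ge_atTop 64,
    eventually_gt_atTop 1] with N h hl hN
  set l := Real.log N with hldef
  have hNl : N = Real.exp l := (Real.exp_log (by linarith)).symm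
  have h2 : √N = Real.exp (l/2) := by
    rw [hNl, Real.exp_half]
  have h3 : √l ≤ l/8 := by
    rw [Real.sqrt_le_left (by linarith)]; nlinarith
  have h4 : √N * (Real.exp √l)^2 ≤ Real.exp (3*l/4) := by
    rw [h2, ← Real.exp_nat_mul, ← Real.exp_add]
    apply Real.exp_le_exp.2; push_cast; linarith
  have h5 : √N ≤ Real.exp (3*l/4) := by
    rw [h2]; apply Real.exp_le_exp.2; linarith
  rw [le_div_iff₀ (by positivity)]
  calc _ ≤ (Real.exp (3*l/4) + Real.exp (3*l/4)) * l^3 := by gcongr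
    _ = Real.exp (3*l/4) * (2*l^3) := by ring
    _ ≤ Real.exp (3*l/4) * Real.exp (l/4) := by gcongr
    _ = N := by rw [← Real.exp_add, hNl]; congr 1; ring

lemma ub23 : ∃ C : ℝ, 1 ≤ C ∧ ∀ᶠ N in atTop, ∀ R : ℕ, Reg N R →
    ∀ F ⊆ Dr (R+1) N N, ∀ A ⊆ powersetCard R (PN N),
    (∀ t ∈ F, ∀ p ∈ t, xx N / 2 < lam p → t.erase p ∈ A) →
    (F.card : ℝ) ≤ C * (N / Real.log N) * (∑ t ∈ A, w t + SS N ^ R / R.factorial / √(Real.log N)) := by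
  obtain ⟨C, hC, h⟩ := small_part
  refine ⟨4 + 3 * C, by linarith, ?_⟩
  filter_upwards [ev_neg, Real.tendsto_log_atTop.eventually_ge_atTop 16] with N hev hl16 R hReg F hF A hA hT
  have hR := hReg.Rpos
  obtain ⟨n, rfl⟩ : ∃ n, R = n+1 := ⟨R-1, by omega⟩
  have hN := hReg.N2
  have hl := hReg.logpos
  set l := Real.log N with hldef
  set z := Real.exp √l with hz
  have hsl : 4 ≤ √l := by
    apply Real.le_sqrt_of_sq_le; linarith
  have hz3 : 3 ≤ z := by
    have := Real.add_one_le_exp (√l); linarith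
  have hlz : Real.log z = √l := Real.log_exp _
  have hzN : z^2 ≤ N := by
    rw [hz, ← Real.exp_nat_mul, ← Real.le_log_iff_exp_le (by linarith)]
    have := Real.mul_self_sqrt hl.le
    push_cast; nlinarith
  have h1 := log_trick N N F (fun t ht => (mem_powersetCard.1 (mem_filter.1 (hF ht)).1).1) (by linarith)
  have h2 := dc_bound N N (n+1) F hF A hA (fun p : ℕ => ¬ ((p:ℝ) ≤ z)) (by
    intro t ht p hp hpz
    apply hT t ht p hp
    rw [not_le] at hpz
    have a1 : √l < Real.log p := by
      rw [Real.lt_log_iff_exp_lt (by linarith)]; exact hpz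
    unfold lam xx
    rw [← hldef]
    have a2 : Real.log (√l) = Real.log l / 2 := Real.log_sqrt hl.le
    rw [← a2]
    exact Real.log_lt_log (by linarith) a1) (by linarith)
  have h3 := h N z hz3 hzN n
  have h4 : ∑ t ∈ F, ∑ p ∈ t.filter (fun p : ℕ => (p:ℝ) ≤ z), Real.log p ≤
      ∑ t ∈ Dr (n+2) N N, ∑ p ∈ t.filter (fun p : ℕ => (p:ℝ) ≤ z), Real.log p :=
    sum_le_sum_of_subset_of_nonneg hF fun t _ _ => sum_nonneg fun p _ => Real.log_natCast_nonneg p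
  have h5 : ∑ t ∈ F, ∑ p ∈ t, Real.log p = ∑ t ∈ F, ∑ p ∈ t.filter (fun p : ℕ => (p:ℝ) ≤ z), Real.log p +
      ∑ t ∈ F, ∑ p ∈ t.filter (fun p : ℕ => ¬ ((p:ℝ) ≤ z)), Real.log p := by
    rw [← sum_add_distrib]
    exact sum_congr rfl fun t _ => (sum_filter_add_sum_filter_not _ _ _).symm
  have h6 := hReg.shift
  have h7 := hReg.poisson_lower
  have hS := hReg.Spos
  set Q := SS N ^ (n+1) / (n+1).factorial with hQ
  set Q' := SS N ^ n / n.factorial with hQ'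
  have hQ'0 : 0 ≤ Q' := by positivity
  have hQ0 : 0 ≤ Q := by positivity
  have hW : 0 ≤ ∑ t ∈ A, w t := sum_nonneg fun t _ => w_nonneg t
  rw [hlz] at h3
  have e1 : 2 / l * (√N * z^2 + C * (N/l) * √l * Q' + 2 * N * ∑ t ∈ A, w t) ≤
      √N * z^2 + 3 * C * (N/l) * (Q/√l) + 4 * (N/l) * ∑ t ∈ A, w t := by
    have a1 : 2 / l ≤ 1 := by rw [div_le_one hl]; linarith
    have a2 : √l / l = 1/√l := by
      rw [div_eq_div_iff (by positivity) (by positivity), Real.mul_self_sqrt hl.le, one_mul]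
    calc _ = 2/l * (√N * z^2) + 2 * C * (N/l) * (√l/l) * Q' + 4 * (N/l) * ∑ t ∈ A, w t := by
          field_simp; ring
      _ ≤ 1 * (√N * z^2) + 2 * C * (N/l) * (√l/l) * (3/2 * Q) + 4 * (N/l) * ∑ t ∈ A, w t := by
          gcongr
      _ = _ := by rw [a2]; ring
  have e2 : √N + √N * z^2 ≤ (N/l) * (Q/√l) := by
    refine hev.trans ?_
    have a1 : √l ≤ l := by
      rw [Real.sqrt_le_left hl.le]; nlinarith
    calc N / l^3 = (N/l) * ((1/l)/l) := by field_simp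
      _ ≤ (N/l) * (Q/√l) := by gcongr
  have e3 : (F.card:ℝ) ≤ √N + 2 / l * (√N * z^2 + C * (N/l) * √l * Q' + 2 * N * ∑ t ∈ A, w t) := by
    refine h1.trans ?_
    rw [h5]
    gcongr
    exact h4.trans h3
  have e4 : 0 ≤ (N/l) * (Q/√l) := by positivity
  have e5 : 0 ≤ (N/l) * ∑ t ∈ A, w t := by positivity
  have e6 : (4 + 3 * C) * (N/l) * (∑ t ∈ A, w t + Q/√l) =
    4 * (N/l) * (∑ t ∈ A, w t) + 3 * C * (N/l) * (Q/√l) + 3 * C * ((N/l) * ∑ t ∈ A, w t) + 4 * ((N/l) * (Q/√l)) := by ring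
  rw [e6]
  nlinarith [mul_nonneg (show 0 ≤ 3 * C by linarith) e5]

end PNN

namespace PNN
open Finset Filter

lemma exp_le_one_sub (u : ℝ) (h0 : 0 ≤ u) (h1 : u ≤ 1/2) : Real.exp (-(2*u)) ≤ 1 - u := by
  rw [Real.exp_neg, inv_le_comm₀ (Real.exp_pos _) (by linarith)]
  have := Real.add_one_le_exp (2*u)
  refine le_trans ?_ this
  rw [inv_le_comm₀ (by linarith) (by linarith), inv_le_iff_one_le_mul₀ (by linarith)]
  nlinarith

lemma sum_sq_le (F : Finset ℕ) (hF : ∀ p ∈ F, p.Prime) : ∑ p ∈ F, ((1:ℝ)/p)^2 ≤ 1 := by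
  have h : ∀ n : ℕ, ∑ p ∈ Ioc 1 (n+1), ((1:ℝ)/p)^2 ≤ 1 - 1/(n+1) := by
    intro n
    induction n with
    | zero => simp
    | succ n ih =>
      rw [sum_Ioc_succ_top (by omega)]
      push_cast
      have e : ((1:ℝ)/(n+1+1))^2 ≤ 1/(n+1) - 1/(n+1+1) := by
        rw [div_sub_div _ _ (by positivity) (by positivity), div_pow, div_le_div_iff₀ (by positivity) (by positivity)]
        nlinarith
      linarith
  have h1 : F ⊆ Ioc 1 (F.sup id + 1) := by
    intro p hp
    rw [mem_Ioc]
    have : id p ≤ F.sup id := le_sup hp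
    exact ⟨(hF p hp).one_lt, by simp at this; omega⟩
  calc _ ≤ _ := sum_le_sum_of_subset_of_nonneg h1 fun p _ _ => by positivity
    _ ≤ _ := h _
    _ ≤ 1 := by
      have : (0:ℝ) ≤ 1/(((F.sup id : ℕ):ℝ)+1) := by positivity
      linarith

/-- sum over sets with small product -/
lemma small_prod_sum (P : Finset ℕ) (hP : ∀ p ∈ P, PPr p) (n : ℕ) (B L S : ℝ)
    (hL : ∑ p ∈ P, Real.log p / p ≤ L) (hB : 1 < B) (hS : S = ∑ p ∈ P, (1:ℝ)/p) :
    ∑ t ∈ (powersetCard (n+1) P).filter (fun t => B < (pr t : ℝ)), w t ≤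
      L / Real.log B * (S ^ n / n.factorial) := by
  have hlB : 0 < Real.log B := Real.log_pos hB
  have hdc := double_count P n (fun t p => w t * (Real.log p / p))
  have h1 : ∑ t ∈ (powersetCard (n+1) P).filter (fun t => B < (pr t : ℝ)), w t * Real.log B ≤
      ∑ t ∈ powersetCard (n+1) P, ∑ p ∈ t, w (t.erase p) * (Real.log p / p) := by
    have e : ∀ t ∈ powersetCard (n+1) P, ∑ p ∈ t, w (t.erase p) * (Real.log p / p) =
        w t * Real.log (pr t) := by
      intro t ht
      rw [mem_powersetCard] at ht
      have : Real.log (pr t) = ∑ p ∈ t, Real.log p := by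
        unfold pr; push_cast
        exact Real.log_prod (fun p hp => by exact_mod_cast (hP p (ht.1 hp)).1.ne_zero)
      rw [this, mul_sum]
      refine sum_congr rfl fun p hp => ?_
      have : w (t.erase p) * ((1:ℝ)/p) = w t := prod_erase_mul _ _ hp
      rw [← this]; ring
    rw [sum_congr rfl e]
    calc _ ≤ ∑ t ∈ (powersetCard (n+1) P).filter (fun t => B < (pr t : ℝ)), w t * Real.log (pr t) := by
          refine sum_le_sum fun t ht => ?_
          rw [mem_filter] at ht
          exact mul_le_mul_of_nonneg_left (Real.log_le_log (by linarith) ht.2.le) (w_nonneg t)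
      _ ≤ _ := sum_le_sum_of_subset_of_nonneg (filter_subset _ _) fun t _ _ =>
          mul_nonneg (w_nonneg t) (Real.log_natCast_nonneg _)
  rw [hdc, ← sum_mul] at h1
  have hlogn : ∀ p : ℕ, 0 ≤ Real.log p / p := fun p => div_nonneg (Real.log_natCast_nonneg p) (by positivity)
  have hL0 : 0 ≤ L := le_trans (sum_nonneg fun p _ => hlogn p) hL
  have h2 : ∑ t ∈ powersetCard n P, ∑ p ∈ P \ t, w t * (Real.log p / p) ≤ (S ^ n / n.factorial) * L := by
    calc _ ≤ ∑ t ∈ powersetCard n P, w t * L := by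
          refine sum_le_sum fun t _ => ?_
          rw [← mul_sum]
          refine mul_le_mul_of_nonneg_left (le_trans ?_ hL) (w_nonneg t)
          exact sum_le_sum_of_subset_of_nonneg sdiff_subset fun p _ _ => hlogn p
      _ = (∑ t ∈ powersetCard n P, w t) * L := by rw [sum_mul]
      _ ≤ _ := by
          refine mul_le_mul_of_nonneg_right ?_ hL0
          rw [hS]
          exact esymm_le P _ (fun p _ => by positivity) n
  rw [div_mul_eq_mul_div, le_div_iff₀ hlB]
  linarith

lemma lower_inj (N B K : ℝ) (R : ℕ) (P : Finset ℕ) (hP : ∀ p ∈ P, PPr p ∧ (p:ℝ) ≤ N / 2) (hK : 1 < K) (hB : 1 < B)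
    (h : ∀ X ≥ K, X/(K*Real.log X) ≤ ((Ioc 0 ⌊X⌋₊).filter (fun p => PPr p ∧ X/K < p)).card)
    (hN : 2 * B ^ 2 * K ≤ N) (hN2 : 2 * B * K ≤ N) (hlN : 0 < Real.log N) :
    N / (2 * K * Real.log N) * ∑ t ∈ (powersetCard R P).filter (fun t => ¬ (B < (pr t : ℝ))), w t ≤
      ((Dr (R+1) N N).card : ℝ) := by
  classical
  set A := (powersetCard R P).filter (fun t => ¬ (B < (pr t : ℝ))) with hA
  let G : Finset ℕ → Finset ℕ := fun t => (Ioc 0 ⌊N/(2 * pr t)⌋₊).filter (fun p => PPr p ∧ N/(2*pr t)/K < p)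
  have hNpos : 0 < N := by nlinarith
  have hposA : ∀ t ∈ A, (1:ℝ) ≤ pr t := by
    intro t ht
    rw [hA, mem_filter, mem_powersetCard] at ht
    have : 0 < pr t := prod_pos fun p hp => (hP p (ht.1.1 hp)).1.1.pos
    exact_mod_cast this
  have hleA : ∀ t ∈ A, (pr t : ℝ) ≤ B := by
    intro t ht
    rw [hA, mem_filter] at ht
    exact not_lt.1 ht.2
  have hmemB : ∀ t ∈ A, ∀ p ∈ t, (p:ℝ) ≤ B := by
    intro t ht p hp
    refine le_trans ?_ (hleA t ht)
    have hpos := hposA t ht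
    have : p ∣ pr t := dvd_prod_of_mem _ hp
    exact_mod_cast Nat.le_of_dvd (by exact_mod_cast hpos) this
  have hG : ∀ t ∈ A, ∀ p ∈ G t, PPr p ∧ B < p ∧ (p:ℝ) * pr t ≤ N/2 := by
    intro t ht p hp
    have h1 := hposA t ht
    have h2 := hleA t ht
    simp only [G, mem_filter, mem_Ioc] at hp
    refine ⟨hp.2.1, ?_, ?_⟩
    · refine lt_of_le_of_lt ?_ hp.2.2
      rw [div_div, le_div_iff₀ (by positivity)]
      have : B * (2 * ↑(pr t) * K) ≤ B * (2 * B * K) := by gcongr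
      nlinarith
    · have : (p:ℝ) ≤ N/(2*pr t) := (Nat.le_floor_iff (by positivity)).1 hp.1.2
      rw [le_div_iff₀ (by positivity)] at this
      linarith
  have hcard : (A.sigma G).card ≤ (Dr (R+1) N N).card := by
    refine card_le_card_of_injOn (fun x => insert x.2 x.1) ?_ ?_
    · rintro ⟨t, p⟩ hx
      rw [coe_sigma, Set.mem_sigma_iff] at hx
      obtain ⟨ht, hp⟩ := hx
      rw [mem_coe] at ht hp
      have g := hG t ht p hp
      have hpt : p ∉ t := fun hc => absurd (hmemB t ht p hc) (not_le.2 g.2.1)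
      have ht' := ht
      rw [hA, mem_filter, mem_powersetCard] at ht'
      rw [mem_coe]
      unfold Dr
      rw [mem_filter, mem_powersetCard]
      refine ⟨⟨?_, by rw [card_insert_of_notMem hpt, ht'.1.2]⟩, ?_⟩
      · refine insert_subset ?_ ?_
        · rw [mem_PN]
          refine ⟨?_, g.1⟩
          have := hposA t ht
          have : (p:ℝ) ≤ p * pr t := le_mul_of_one_le_right (by positivity) this
          linarith
        · intro q hq
          rw [mem_PN]
          have := hP q (ht'.1.1 hq)
          exact ⟨by linarith, this.1⟩
      · show ((pr (insert p t) : ℕ):ℝ) < N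
        have : pr (insert p t) = p * pr t := prod_insert hpt
        rw [this]; push_cast; linarith
    · rintro ⟨t, p⟩ hx ⟨s, q⟩ hy hxy
      rw [coe_sigma, Set.mem_sigma_iff] at hx hy
      obtain ⟨ht, hp⟩ := hx
      obtain ⟨hs, hq⟩ := hy
      rw [mem_coe] at ht hp hs hq
      simp only at ht hp hs hq hxy
      have g1 := hG t ht p hp
      have g2 := hG s hs q hq
      have hpt : p ∉ t := fun hc => absurd (hmemB t ht p hc) (not_le.2 g1.2.1)
      have hqs : q ∉ s := fun hc => absurd (hmemB s hs q hc) (not_le.2 g2.2.1)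
      have hpq : p = q := by
        have : p ∈ insert q s := by rw [← hxy]; exact mem_insert_self _ _
        rw [mem_insert] at this
        rcases this with h1 | h1
        · exact h1
        · exact absurd (hmemB s hs p h1) (not_le.2 g1.2.1)
      subst hpq
      have : t = s := by
        rw [← erase_insert hpt, ← erase_insert hqs, hxy]
      subst this; rfl
  rw [card_sigma] at hcard
  calc _ = ∑ t ∈ A, N / (2 * K * Real.log N) * w t := by rw [mul_sum]
    _ ≤ ∑ t ∈ A, ((G t).card : ℝ) := by
      refine sum_le_sum fun t ht => ?_
      have h1 := hposA t ht
      have h2 := hleA t ht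
      have hXK : K ≤ N / (2 * pr t) := by
        rw [le_div_iff₀ (by positivity)]
        have : K * (2 * ↑(pr t)) ≤ K * (2 * B) := by gcongr
        nlinarith
      refine le_trans ?_ (h _ hXK)
      have hX1 : 1 < N / (2 * pr t) := by linarith
      have hlX : 0 < Real.log (N / (2 * pr t)) := Real.log_pos hX1
      have hlX2 : Real.log (N / (2 * pr t)) ≤ Real.log N := by
        apply Real.log_le_log (by linarith)
        apply div_le_self hNpos.le; linarith
      rw [w_eq]
      calc N / (2 * K * Real.log N) * (1 / pr t) = N/(2*pr t) / (K * Real.log N) := by field_simp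
        _ ≤ _ := by gcongr
    _ ≤ _ := by exact_mod_cast hcard

end PNN

namespace PNN
open Finset Filter

set_option maxHeartbeats 2000000 in
lemma lower_bound : ∃ c : ℝ, 0 < c ∧ ∀ᶠ N in atTop, ∀ R : ℕ, Reg N R →
    c * (N / Real.log N * (SS N ^ R / R.factorial)) ≤ ((Dr (R+1) N N).card : ℝ) := by
  obtain ⟨M, hM, hmert⟩ := mertens_two
  obtain ⟨M', hM', hSS⟩ := SS_approx
  obtain ⟨C, hC, hsld⟩ := sum_log_div
  obtain ⟨K, hK, hpc⟩ := prime_count_lower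
  set V : ℝ := 64 * C with hV
  have hV1 : 1 < V := by linarith
  set D : ℝ := M + M' + Real.log V with hD
  have hlV : 0 < Real.log V := Real.log_pos hV1
  refine ⟨1 / (2*K) * (1/8 * Real.exp (-(3*D))), by positivity, ?_⟩
  have hev : ∀ᶠ x : ℝ in atTop, x ^ ((2:ℝ)/3) ≤ 1/100 * x := by
    simpa using ev_rpow ((2:ℝ)/3) 1 (1/100) (by norm_num) (by norm_num)
  filter_upwards [tendsto_xx.eventually hev, tendsto_xx.eventually_ge_atTop (100 * D),
    Real.tendsto_log_atTop.eventually_ge_atTop (100 * V), Real.tendsto_log_atTop.eventually_ge_atTop (4 * (2 * K))]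
    with N hx23 hxD hlV2 hlK R hReg
  have hN := hReg.N2
  have hl := hReg.logpos
  set l := Real.log N with hldef
  have hNl : N = Real.exp l := (Real.exp_log (by linarith)).symm
  set y := Real.exp (l/V) with hy
  have hlV3 : 100 ≤ l / V := by rw [le_div_iff₀ (by linarith)]; exact hlV2
  have hy2 : 2 ≤ y := by have := Real.add_one_le_exp (l/V); linarith
  set P := (Ioc 0 ⌊y⌋₊).filter PPr with hPdef
  have hPy : ∀ p ∈ P, PPr p ∧ (p:ℝ) ≤ y := by
    intro p hp
    rw [hPdef, mem_filter, mem_Ioc] at hp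
    exact ⟨hp.2, (Nat.le_floor_iff (by linarith)).1 hp.1.2⟩
  have hyN : y ≤ N / 2 := by
    have h2 : (2:ℝ) ≤ Real.exp 1 := by linarith [Real.exp_one_gt_d9]
    have h3 : y * Real.exp 1 ≤ N := by
      rw [hNl, hy, ← Real.exp_add]
      apply Real.exp_le_exp.2
      have : l / V ≤ l / 64 := by
        apply div_le_div_of_nonneg_left hl.le (by norm_num); linarith
      nlinarith
    have : 0 < y := by positivity
    nlinarith
  set Sy := ∑ p ∈ P, (1:ℝ)/p with hSy
  have hm := hmert y hy2
  have hlly : Real.log (Real.log y) = xx N - Real.log V := by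
    rw [hy, Real.log_exp, Real.log_div hl.ne' (by linarith)]; rfl
  rw [hlly, ← hSy, abs_le] at hm
  have hs := hSS N (by linarith)
  rw [abs_le] at hs
  have hSyS : SS N - D ≤ Sy := by linarith
  have hSyle : Sy ≤ SS N := by
    refine sum_le_sum_of_subset_of_nonneg ?_ fun p _ _ => by positivity
    intro p hp
    have := hPy p hp
    rw [mem_PN]; exact ⟨by linarith, this.1⟩
  have hSpos := hReg.Spos
  have hS1 := hReg.S1
  have hR2 := hReg.R2
  have hR1 := hReg.R1
  have hx := hReg.hx
  have hDpos : 0 < D := by linarith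
  have hSypos : 0 < Sy := by linarith
  have hSR := hReg.hSR
  rw [abs_le] at hSR
  have hRS : (R:ℝ) ≤ 11/10 * Sy := by linarith
  have hRpos : (0:ℝ) < R := by linarith
  have hQ := sum_sq_le P (fun p hp => (hPy p hp).1.1)
  have hE := esymm_lower P (fun p => (1:ℝ)/p) (fun p _ => by positivity) R
  rw [← hSy] at hE
  set E := ∑ t ∈ powersetCard R P, ∏ p ∈ t, (1:ℝ)/p with hEdef
  have hfac : (0:ℝ) < R.factorial := by positivity
  have hE2 : 1/4 * (Sy^R / R.factorial) ≤ E := by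
    have h1 : 1/4 * Sy^2 ≤ Sy^2 - R*(R-1)/2 * ∑ p ∈ P, ((1:ℝ)/p)^2 := by
      have h2 : (R:ℝ)*(R-1)/2 * ∑ p ∈ P, ((1:ℝ)/p)^2 ≤ (R:ℝ)*R/2 * 1 := by
        have : (1:ℝ) ≤ R := by exact_mod_cast hReg.Rpos
        have : (0:ℝ) ≤ ∑ p ∈ P, ((1:ℝ)/p)^2 := sum_nonneg fun p _ => by positivity
        gcongr
        linarith
      nlinarith
    have h3 : Sy^R * (1/4 * Sy^2) ≤ Sy^2 * (R.factorial * E) := le_trans (by gcongr) hE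
    have h4 : Sy^2 * (1/4 * Sy^R) ≤ Sy^2 * (R.factorial * E) := by linarith
    have h5 := le_of_mul_le_mul_left h4 (by positivity)
    rw [mul_div_assoc', div_le_iff₀ hfac]; linarith
  obtain ⟨n, rfl⟩ : ∃ n, R = n+1 := ⟨R-1, by have := hReg.Rpos; omega⟩
  set B := Real.exp (l/4) with hB
  have hB1 : 1 < B := by rw [hB]; exact Real.one_lt_exp_iff.2 (by positivity)
  have hLs := hsld (Real.log (l/V)) (Real.log_nonneg (by linarith)) P (fun p hp => by
    refine ⟨(hPy p hp).1, ?_⟩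
    rw [Real.exp_log (by linarith), ← Real.log_exp (l/V)]
    exact Real.log_le_log (by exact_mod_cast (hPy p hp).1.1.pos) (hPy p hp).2)
  rw [Real.exp_log (by linarith)] at hLs
  have hlarge := small_prod_sum P (fun p hp => (hPy p hp).1) n B (C * (l/V)) Sy hLs hB1 rfl
  rw [hB, Real.log_exp, ← hB] at hlarge
  have hlarge2 : C * (l/V) / (l/4) * (Sy^n / n.factorial) ≤ 1/8 * (Sy^(n+1) / (n+1).factorial) := by
    rw [hV, Nat.factorial_succ]
    push_cast at hRS ⊢
    have e1 : C * (l/(64*C)) / (l/4) = 1/16 := by field_simp; norm_num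
    rw [e1]
    have e2 : 1/8 * (Sy^(n+1) / (((n:ℝ)+1) * n.factorial)) = (1/8 * (Sy / (n+1))) * (Sy^n / n.factorial) := by
      field_simp
      ring
    rw [e2]
    gcongr
    rw [mul_div_assoc', le_div_iff₀ (by positivity)]
    linarith
  have hsplit : E = ∑ t ∈ (powersetCard (n+1) P).filter (fun t => B < (pr t : ℝ)), w t +
      ∑ t ∈ (powersetCard (n+1) P).filter (fun t => ¬ (B < (pr t : ℝ))), w t :=
    (sum_filter_add_sum_filter_not _ _ _).symm
  have hBB : 2 * B^2 * K ≤ N := by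
    rw [hNl, hB, ← Real.exp_nat_mul]
    have h1 : Real.exp l = Real.exp ((2:ℕ) * (l/4)) * Real.exp (l/2) := by
      rw [← Real.exp_add]; congr 1; push_cast; ring
    rw [h1]
    have h2 := Real.add_one_le_exp (l/2)
    have h3 : 2 * K ≤ Real.exp (l/2) := by linarith
    have := Real.exp_pos ((2:ℕ) * (l/4))
    nlinarith
  have hinj := lower_inj N B K (n+1) P (fun p hp => ⟨(hPy p hp).1, (hPy p hp).2.trans hyN⟩) hK hB1 hpc hBB
    (le_trans (by nlinarith [mul_pos (sub_pos.2 hB1) (show 0 < B * K by positivity)]) hBB) hl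
  refine le_trans ?_ hinj
  have hsm : 1/8 * (Sy^(n+1) / (n+1).factorial) ≤
      ∑ t ∈ (powersetCard (n+1) P).filter (fun t => ¬ (B < (pr t : ℝ))), w t := by linarith
  have hpow : Real.exp (-(3*D)) * SS N ^ (n+1) ≤ Sy ^ (n+1) := by
    have h1 : Real.exp (-(2*(D/SS N))) ≤ 1 - D/SS N := by
      apply exp_le_one_sub _ (by positivity)
      rw [div_le_iff₀ hSpos]; linarith
    have h2 : SS N * Real.exp (-(2*(D/SS N))) ≤ Sy := by
      calc _ ≤ SS N * (1 - D/SS N) := by gcongr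
        _ = SS N - D := by field_simp
        _ ≤ Sy := hSyS
    calc Real.exp (-(3*D)) * SS N ^ (n+1) ≤ Real.exp (-(2*(D/SS N)))^(n+1) * SS N ^ (n+1) := by
          gcongr
          rw [← Real.exp_nat_mul]
          apply Real.exp_le_exp.2
          have : ((n+1:ℕ):ℝ) * (D / SS N) ≤ 3/2 * D := by
            rw [mul_div_assoc', div_le_iff₀ hSpos]
            nlinarith
          linarith
      _ = (SS N * Real.exp (-(2*(D/SS N))))^(n+1) := by rw [mul_pow]; ring
      _ ≤ _ := by gcongr
  calc _ = N / (2*K*l) * (1/8 * (Real.exp (-(3*D)) * SS N ^ (n+1) / (n+1).factorial)) := by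
        field_simp
    _ ≤ N / (2*K*l) * (1/8 * (Sy ^ (n+1) / (n+1).factorial)) := by gcongr
    _ ≤ _ := by gcongr
end PNN

namespace PNN
open Finset Filter

lemma sum_biUnion_le' {ι α : Type*} [DecidableEq α] [DecidableEq ι] (J : Finset ι) (W : ι → Finset α) (f : α → ℝ)
    (hf : ∀ a, 0 ≤ f a) : ∑ p ∈ J.biUnion W, f p ≤ ∑ j ∈ J, ∑ p ∈ W j, f p := by
  induction J using Finset.induction_on with
  | empty => simp
  | insert i J hi ih =>
    rw [biUnion_insert, sum_insert hi]
    have h1 := sum_union_inter (f := f) (s₁ := W i) (s₂ := J.biUnion W)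
    have h2 : 0 ≤ ∑ p ∈ W i ∩ J.biUnion W, f p := sum_nonneg fun p _ => hf p
    linarith

lemma log_pos_of_PPr {p : ℕ} (h : PPr p) : 0 < Real.log p :=
  Real.log_pos (by exact_mod_cast h.1.one_lt)

lemma exp_lam {p : ℕ} (h : PPr p) : Real.exp (lam p) = Real.log p := Real.exp_log (log_pos_of_PPr h)

/-- primes with lam in the window -/
noncomputable def Win (u v : ℝ) : Finset ℕ :=
  (range (⌈Real.exp (Real.exp v)⌉₊+1)).filter (fun p => PPr p ∧ u < lam p ∧ lam p ≤ v)

lemma le_of_lam_le {p : ℕ} (h : PPr p) {v : ℝ} (hv : lam p ≤ v) : (p:ℝ) ≤ Real.exp (Real.exp v) := by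
  rw [← Real.log_le_iff_le_exp (by exact_mod_cast h.1.pos), ← exp_lam h]
  exact Real.exp_le_exp.2 hv

lemma mem_Win {u v : ℝ} {p : ℕ} : p ∈ Win u v ↔ PPr p ∧ u < lam p ∧ lam p ≤ v := by
  unfold Win
  rw [mem_filter, mem_range]
  constructor
  · exact fun h => h.2
  · intro h
    refine ⟨?_, h⟩
    have h1 := le_of_lam_le h.1 h.2.2
    have h2 := Nat.le_ceil (Real.exp (Real.exp v))
    have : (p:ℝ) ≤ (⌈Real.exp (Real.exp v)⌉₊ : ℝ) := h1.trans h2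
    have : p ≤ ⌈Real.exp (Real.exp v)⌉₊ := by exact_mod_cast this
    omega

noncomputable def Beg (v : ℝ) : Finset ℕ :=
  (range (⌈Real.exp (Real.exp v)⌉₊+1)).filter (fun p => PPr p ∧ lam p ≤ v)

lemma mem_Beg {v : ℝ} {p : ℕ} : p ∈ Beg v ↔ PPr p ∧ lam p ≤ v := by
  unfold Beg
  rw [mem_filter, mem_range]
  constructor
  · exact fun h => h.2
  · intro h
    refine ⟨?_, h⟩
    have h1 := le_of_lam_le h.1 h.2
    have h2 := Nat.le_ceil (Real.exp (Real.exp v))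
    have : (p:ℝ) ≤ (⌈Real.exp (Real.exp v)⌉₊ : ℝ) := h1.trans h2
    have : p ≤ ⌈Real.exp (Real.exp v)⌉₊ := by exact_mod_cast this
    omega

lemma tail_sum : ∃ C : ℝ, 1 ≤ C ∧ ∀ u : ℝ, 0 ≤ u → ∀ F : Finset ℕ, (∀ p ∈ F, PPr p ∧ u < lam p) →
    ∑ p ∈ F, 1 / ((p:ℝ) * Real.log p) ≤ C * Real.exp (-u) := by
  obtain ⟨M, hM, h⟩ := mertens_window
  refine ⟨2 * (M + 1), by linarith, fun u hu F hF => ?_⟩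
  classical
  obtain ⟨J, hJ⟩ : ∃ J : ℕ, ∀ p ∈ F, lam p ≤ u + J := by
    obtain ⟨B, hB⟩ := (F.image lam).exists_le
    obtain ⟨J, hJ⟩ := exists_nat_ge (B - u)
    exact ⟨J, fun p hp => by have := hB _ (mem_image_of_mem lam hp); linarith⟩
  have hsub : F ⊆ (range J).biUnion (fun j => Win (u+j) (u+j+1)) := by
    intro p hp
    rw [mem_biUnion]
    have h1 := hF p hp
    have h2 := hJ p hp
    have h3 : 0 < ⌈lam p - u⌉₊ := Nat.ceil_pos.2 (by linarith)
    refine ⟨⌈lam p - u⌉₊ - 1, ?_, ?_⟩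
    · rw [mem_range]
      have : ⌈lam p - u⌉₊ ≤ J := Nat.ceil_le.2 (by linarith)
      omega
    · rw [mem_Win]
      have h4 := Nat.le_ceil (lam p - u)
      have h5 := Nat.ceil_lt_add_one (show 0 ≤ lam p - u by linarith)
      have h6 : ((⌈lam p - u⌉₊ - 1 : ℕ) : ℝ) = (⌈lam p - u⌉₊:ℝ) - 1 := by
        rw [Nat.cast_sub h3]; simp
      rw [h6]
      exact ⟨h1.1, by linarith, by linarith⟩
  have hnn : ∀ p : ℕ, 0 ≤ 1 / ((p:ℝ) * Real.log p) := fun p =>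
    div_nonneg zero_le_one (mul_nonneg (by positivity) (Real.log_natCast_nonneg p))
  have hwin : ∀ j : ℕ, ∑ p ∈ Win (u+j) (u+j+1), 1 / ((p:ℝ) * Real.log p) ≤
      (M+1) * Real.exp (-u) * (1/2)^j := by
    intro j
    have h1 := h (u+j) (u+j+1) (by positivity) (by linarith) _ (fun p => mem_Win)
    rw [abs_le] at h1
    have e1 : Real.exp (-(u+j)) ≤ Real.exp (-u) * (1/2)^j := by
      rw [neg_add, Real.exp_add]
      gcongr
      have : Real.exp (-(j:ℝ)) = Real.exp (-1)^j := by rw [← Real.exp_nat_mul]; congr 1; ring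
      rw [this]
      gcongr
      rw [Real.exp_neg, inv_le_comm₀ (Real.exp_pos 1) (by norm_num)]
      linarith [Real.exp_one_gt_d9]
    calc _ ≤ ∑ p ∈ Win (u+j) (u+j+1), (1:ℝ)/p * Real.exp (-(u+j)) := by
          refine sum_le_sum fun p hp => ?_
          rw [mem_Win] at hp
          have hl := log_pos_of_PPr hp.1
          rw [one_div, mul_inv, ← one_div]
          gcongr
          rw [Real.exp_neg]
          apply inv_anti₀ (Real.exp_pos _)
          rw [← exp_lam hp.1]
          exact Real.exp_le_exp.2 hp.2.1.le
      _ = (∑ p ∈ Win (u+j) (u+j+1), (1:ℝ)/p) * Real.exp (-(u+j)) := by rw [sum_mul]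
      _ ≤ (M+1) * Real.exp (-(u+j)) := by
          gcongr
          linarith
      _ ≤ (M+1) * (Real.exp (-u) * (1/2)^j) := by gcongr
      _ = _ := by ring
  calc _ ≤ ∑ p ∈ (range J).biUnion (fun j => Win (u+j) (u+j+1)), 1 / ((p:ℝ) * Real.log p) :=
        sum_le_sum_of_subset_of_nonneg hsub fun p _ _ => hnn p
    _ ≤ ∑ j ∈ range J, ∑ p ∈ Win (u+j) (u+j+1), 1 / ((p:ℝ) * Real.log p) :=
        sum_biUnion_le' _ _ _ hnn
    _ ≤ ∑ j ∈ range J, (M+1) * Real.exp (-u) * (1/2)^j := sum_le_sum fun j _ => hwin j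
    _ = (M+1) * Real.exp (-u) * ∑ j ∈ range J, (1/2:ℝ)^j := by rw [mul_sum]
    _ ≤ (M+1) * Real.exp (-u) * 2 := by
        gcongr
        exact sum_geometric_two_le J
    _ = _ := by ring

/-- sum over close pairs -/
lemma pair_sum : ∃ C : ℝ, 1 ≤ C ∧ ∀ N u : ℝ, 0 ≤ u →
    ∑ p ∈ (PN N).filter (fun p => u < lam p), ∑ q ∈ (PN N).filter (fun q => p < q ∧ q ≤ 2 * p), (1:ℝ)/(p*q) ≤ C * Real.exp (-u) := by
  obtain ⟨C, hC, h⟩ := tail_sum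
  refine ⟨16 * C, by linarith, fun N u hu => ?_⟩
  have h1 := h u hu ((PN N).filter (fun p => u < lam p)) (fun p hp => by
    rw [mem_filter, mem_PN] at hp; exact ⟨hp.1.2, hp.2⟩)
  calc _ ≤ ∑ p ∈ (PN N).filter (fun p => u < lam p), 16 * (1 / ((p:ℝ) * Real.log p)) := by
        refine sum_le_sum fun p hp => ?_
        rw [mem_filter, mem_PN] at hp
        have hp2 : (2:ℝ) ≤ p := by exact_mod_cast hp.1.2.1.two_le
        have hl := log_pos_of_PPr hp.1.2
        have h2 := pi_upper (2*p) (by linarith) ((PN N).filter (fun q => p < q ∧ q ≤ 2 * p)) (fun q hq => by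
          rw [mem_filter, mem_PN] at hq
          exact ⟨hq.1.2.1, by exact_mod_cast hq.2.2⟩)
        have hl2 : Real.log p ≤ Real.log (2*p) := Real.log_le_log (by linarith) (by linarith)
        calc _ ≤ ∑ q ∈ (PN N).filter (fun q => p < q ∧ q ≤ 2 * p), (1:ℝ)/(p*p) := by
              refine sum_le_sum fun q hq => ?_
              rw [mem_filter] at hq
              have : (p:ℝ) ≤ q := by exact_mod_cast hq.2.1.le
              gcongr
          _ = (((PN N).filter (fun q => p < q ∧ q ≤ 2 * p)).card : ℝ) * (1/(p*p)) := by
              rw [sum_const, nsmul_eq_mul]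
          _ ≤ (8 * (2*p) / Real.log p) * (1/(p*p)) := by
              gcongr
              refine h2.trans ?_
              gcongr
          _ = _ := by field_simp; norm_num
    _ = 16 * ∑ p ∈ (PN N).filter (fun p => u < lam p), (1 / ((p:ℝ) * Real.log p)) := by rw [mul_sum]
    _ ≤ _ := by linarith
end PNN

namespace PNN
open Finset Filter

lemma ev_cube : ∀ᶠ l : ℝ in atTop, 2 * l^3 ≤ Real.exp (l/4) := by
  have := Real.tendsto_pow_mul_exp_neg_atTop_nhds_zero 3
  have h2 := (this.comp (tendsto_id.atTop_div_const (show (0:ℝ) < 4 by norm_num))).eventually_le_const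
    (show (0:ℝ) < 1/128 by norm_num)
  filter_upwards [h2] with l hl
  simp only [Function.comp, id, Real.exp_neg] at hl
  rw [← div_eq_mul_inv, div_le_iff₀ (Real.exp_pos _)] at hl
  have e : (l/4)^3 = l^3/64 := by ring
  rw [e] at hl; linarith

lemma Reg.shift2 {N : ℝ} {R : ℕ} (h : Reg N (R+2)) :
    SS N ^ R / R.factorial ≤ 9/4 * (SS N ^ (R+2) / (R+2).factorial) := by
  have hS := h.Spos
  rw [Nat.factorial_succ, Nat.factorial_succ, pow_add]
  push_cast
  have : 9/4 * (SS N ^ R * SS N ^ 2 / (((R:ℝ)+1+1) * (((R:ℝ)+1) * R.factorial))) =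
    SS N ^ R / R.factorial * (9/4 * SS N ^ 2 / (((R:ℝ)+1+1) * ((R:ℝ)+1))) := by field_simp
  rw [this]
  apply le_mul_of_one_le_right (by positivity)
  rw [le_div_iff₀ (by positivity)]
  have h1 := h.R2; have := h.S1
  push_cast at h1
  have h3 : (R:ℝ) + 2 ≤ 3/2 * SS N := by linarith
  have h4 : (0:ℝ) ≤ R := by positivity
  nlinarith

/-- fibre over a set m, large pairs -/
lemma pairs_large (N u : ℝ) (m : Finset ℕ) (hm : m ⊆ PN N) (hl : 32 ≤ Real.log N) (hN : 0 < N) :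
    ((((PN N) ×ˢ (PN N)).filter (fun x : ℕ × ℕ => (x.1 < x.2 ∧ x.2 ≤ 2 * x.1 ∧ u < lam x.1) ∧
      (pr m : ℝ) * (x.1 * x.2) < N ∧ Real.exp (Real.log N / 8) < (x.1:ℝ) * x.2)).card : ℝ) ≤
      32768 * (N / Real.log N ^ 2) * w m := by
  set l := Real.log N with hldef
  set U := ((PN N) ×ˢ (PN N)).filter (fun x : ℕ × ℕ => (x.1 < x.2 ∧ x.2 ≤ 2 * x.1 ∧ u < lam x.1) ∧
      (pr m : ℝ) * (x.1 * x.2) < N ∧ Real.exp (l / 8) < (x.1:ℝ) * x.2) with hU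
  have hpr : (0:ℝ) < pr m := by exact_mod_cast pr_pos hm
  rcases U.eq_empty_or_nonempty with he | ⟨x0, hx0⟩
  · rw [he]; simp only [card_empty, Nat.cast_zero]
    exact mul_nonneg (by positivity) (w_nonneg m)
  rw [hU, mem_filter] at hx0
  set y := √(N / pr m) with hy
  have hy2 : y^2 = N / pr m := Real.sq_sqrt (by positivity)
  have hlow : Real.exp (l/8) < N / pr m := by
    rw [lt_div_iff₀ hpr]
    have := hx0.2.2.1; have h2 := hx0.2.2.2
    nlinarith
  have hy16 : Real.exp (l/16) ≤ y := by
    apply Real.le_sqrt_of_sq_le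
    rw [← Real.exp_nat_mul]
    refine le_trans (le_of_eq ?_) hlow.le
    congr 1; push_cast; ring
  have hypos : 0 < y := lt_of_lt_of_le (Real.exp_pos _) hy16
  have hy2' : 2 ≤ y := by
    have := Real.add_one_le_exp (l/16)
    linarith
  have hly : l/16 ≤ Real.log y := by
    rw [Real.le_log_iff_exp_le hypos]; exact hy16
  have hly2 : l/16 ≤ Real.log (2*y) := hly.trans (Real.log_le_log hypos (by linarith))
  have h1 := pi_upper y hy2' ((PN N).filter (fun p : ℕ => (p:ℝ) ≤ y)) (fun p hp => by
    rw [mem_filter, mem_PN] at hp; exact ⟨hp.1.2.1, hp.2⟩)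
  have h2 := pi_upper (2*y) (by linarith) ((PN N).filter (fun p : ℕ => (p:ℝ) ≤ 2*y)) (fun p hp => by
    rw [mem_filter, mem_PN] at hp; exact ⟨hp.1.2.1, hp.2⟩)
  have hsub : U ⊆ ((PN N).filter (fun p : ℕ => (p:ℝ) ≤ y)) ×ˢ ((PN N).filter (fun p : ℕ => (p:ℝ) ≤ 2*y)) := by
    intro x hx
    rw [hU, mem_filter, mem_product] at hx
    obtain ⟨⟨a1, a2⟩, ⟨a3, a4, _⟩, a5, _⟩ := hx
    have a3' : (x.1:ℝ) ≤ x.2 := by exact_mod_cast a3.le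
    have a4' : (x.2:ℝ) ≤ 2 * x.1 := by exact_mod_cast a4
    have b1 : (x.1:ℝ) ≤ y := by
      apply Real.le_sqrt_of_sq_le
      rw [le_div_iff₀ hpr]
      have : (x.1:ℝ)^2 ≤ x.1 * x.2 := by
        rw [sq]; gcongr
      nlinarith
    rw [mem_product, mem_filter, mem_filter]
    exact ⟨⟨a1, b1⟩, a2, by linarith⟩
  have h3 : (U.card : ℝ) ≤ (((PN N).filter (fun p : ℕ => (p:ℝ) ≤ y)).card : ℝ) *
      (((PN N).filter (fun p : ℕ => (p:ℝ) ≤ 2*y)).card : ℝ) := by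
    have := card_le_card hsub
    rw [card_product] at this
    exact_mod_cast this
  have hl0 : 0 < l := by linarith
  calc (U.card:ℝ) ≤ _ := h3
    _ ≤ (8 * y / (l/16)) * (8 * (2*y) / (l/16)) := by
      gcongr
      · exact h1.trans (by gcongr)
      · exact h2.trans (by gcongr)
    _ = 32768 * (y^2 / l^2) := by field_simp; norm_num
    _ = _ := by rw [hy2, w_eq]; field_simp

set_option maxHeartbeats 1000000 in
lemma bad1_count : ∃ C : ℝ, 1 ≤ C ∧ ∀ᶠ N in atTop, ∀ R : ℕ, Reg N R → ∀ u : ℝ, 0 ≤ u →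
    ∀ F ⊆ Dr (R+1) N N, (∀ t ∈ F, ∃ p ∈ t, ∃ q ∈ t, p < q ∧ q ≤ 2 * p ∧ u < lam p) →
    (F.card : ℝ) ≤ C * (N / Real.log N * (SS N ^ R / R.factorial)) * (Real.exp (-u) + 1 / Real.log N) := by
  obtain ⟨C, hC, hpair⟩ := pair_sum
  refine ⟨18 * C + 50000, by linarith, ?_⟩
  filter_upwards [Real.tendsto_log_atTop.eventually ev_cube, Real.tendsto_log_atTop.eventually_ge_atTop 32]
    with N hcube hl32 R hReg u hu F hF hbad
  classical
  have hN := hReg.N2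
  obtain ⟨n, rfl⟩ : ∃ n, R = n+2 := ⟨R-2, by
    have h1 := hReg.R1; have h2 := hReg.hx
    have : (2:ℝ) < R := by linarith
    have : 2 < R := by exact_mod_cast this
    omega⟩
  have hsh1 := Reg.shift (R := n+1) hReg
  have hsh2 := hReg.shift2
  have hpl := hReg.poisson_lower
  have hS := hReg.Spos
  set l := Real.log N with hldef
  have hl : 0 < l := by linarith
  have hNl : N = Real.exp l := (Real.exp_log (by linarith)).symm
  set B := Real.exp (l/8) with hB
  set Q := SS N ^ (n+2) / (n+2).factorial with hQ
  set Pairs := ((PN N) ×ˢ (PN N)).filter (fun x : ℕ × ℕ => x.1 < x.2 ∧ x.2 ≤ 2 * x.1 ∧ u < lam x.1) with hPairs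
  set U := (Pairs ×ˢ powersetCard (n+1) (PN N)).filter (fun y => (pr y.2 : ℝ) * (y.1.1 * y.1.2) < N) with hU
  have hFU : F ⊆ U.image (fun y => insert y.1.1 (insert y.1.2 y.2)) := by
    intro t ht
    obtain ⟨p, hp, q, hq, hpq, hq2, hup⟩ := hbad t ht
    have ht' := hF ht
    unfold Dr at ht'
    rw [mem_filter, mem_powersetCard] at ht'
    have hqe : q ∈ t.erase p := mem_erase.2 ⟨hpq.ne', hq⟩
    rw [mem_image]
    refine ⟨((p, q), (t.erase p).erase q), ?_, ?_⟩
    · rw [hU, mem_filter, mem_product, hPairs, mem_filter, mem_product, mem_powersetCard]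
      refine ⟨⟨⟨⟨ht'.1.1 hp, ht'.1.1 hq⟩, hpq, hq2, hup⟩,
        ((erase_subset _ _).trans (erase_subset _ _)).trans ht'.1.1, ?_⟩, ?_⟩
      · rw [card_erase_of_mem hqe, card_erase_of_mem hp, ht'.1.2]; omega
      · have e1 := pr_erase hqe
        have e2 := pr_erase hp
        have e3 : pr ((t.erase p).erase q) * (p * q) = pr t := by
          rw [← e2, ← e1]; ring
        show (pr ((t.erase p).erase q) : ℝ) * ((p:ℝ) * q) < N
        have e4 : (pr ((t.erase p).erase q) : ℝ) * ((p:ℝ) * q) = pr t := by exact_mod_cast e3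
        rw [e4]; exact ht'.2
    · show insert p (insert q ((t.erase p).erase q)) = t
      rw [insert_erase hqe, insert_erase hp]
  have hcard : (F.card:ℝ) ≤ U.card := by exact_mod_cast (card_le_card hFU).trans card_image_le
  have hsplit : (U.card : ℝ) = (U.filter (fun y => (y.1.1:ℝ) * y.1.2 ≤ B)).card +
      (U.filter (fun y => ¬ ((y.1.1:ℝ) * y.1.2 ≤ B))).card := by
    exact_mod_cast (card_filter_add_card_filter_not _).symm
  -- case a
  have hsmall : ((U.filter (fun y => (y.1.1:ℝ) * y.1.2 ≤ B)).card : ℝ) ≤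
      √N * B^2 + 8 * (N/l) * (SS N ^ n / n.factorial) * (C * Real.exp (-u)) := by
    have h1 : ((U.filter (fun y => (y.1.1:ℝ) * y.1.2 ≤ B)).card : ℝ) =
        ∑ x ∈ Pairs.filter (fun x => (x.1:ℝ) * x.2 ≤ B), ((Dr (n+1) N (N / (x.1 * x.2))).card : ℝ) := by
      rw [hU, filter_filter, card_filter, sum_product]
      conv_rhs => rw [sum_filter]
      push_cast
      refine sum_congr rfl fun x hx => ?_
      rw [hPairs, mem_filter, mem_product] at hx
      have p1 := (mem_PN.1 hx.1.1).2.1.pos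
      have p2 := (mem_PN.1 hx.1.2).2.1.pos
      have p3 : (0:ℝ) < x.1 * x.2 := by positivity
      split_ifs with h2
      · unfold Dr
        rw [card_filter]
        push_cast
        refine sum_congr rfl fun m _ => ?_
        simp only [h2, and_true, lt_div_iff₀ p3]
      · simp [h2]
    rw [h1]
    have h2 : ∀ x ∈ Pairs.filter (fun x => (x.1:ℝ) * x.2 ≤ B), ((Dr (n+1) N (N / (x.1 * x.2))).card : ℝ) ≤
        √N + 8 * (N/l) * (SS N ^ n / n.factorial) * (1 / (x.1 * x.2)) := by
      intro x hx
      rw [mem_filter, hPairs, mem_filter, mem_product] at hx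
      have p1 : (1:ℝ) ≤ x.1 := by exact_mod_cast (mem_PN.1 hx.1.1.1).2.1.pos
      have p2 : (1:ℝ) ≤ x.2 := by exact_mod_cast (mem_PN.1 hx.1.1.2).2.1.pos
      have p3 : (1:ℝ) ≤ x.1 * x.2 := by nlinarith
      have p0 : (0:ℝ) < x.1 * x.2 := by linarith
      have hX : Real.exp (l/2) ≤ N / (x.1 * x.2) := by
        rw [le_div_iff₀ p0]
        calc _ ≤ Real.exp (l/2) * B := by gcongr; exact hx.2
          _ ≤ N := by rw [hNl, hB, ← Real.exp_add]; apply Real.exp_le_exp.2; linarith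
      have hX1 : 1 < N / (x.1 * x.2) := lt_of_lt_of_le (Real.one_lt_exp_iff.2 (by positivity)) hX
      have hlX : l/2 ≤ Real.log (N / (x.1 * x.2)) := by
        rw [Real.le_log_iff_exp_le (by linarith)]; exact hX
      refine (count_upper N _ n hX1).trans ?_
      have a1 : √(N / (x.1 * x.2)) ≤ √N := Real.sqrt_le_sqrt (div_le_self (by linarith) p3)
      calc _ ≤ √N + 4 * ((N / (x.1*x.2)) / (l/2)) * (SS N ^ n / n.factorial) := by gcongr
        _ = _ := by field_simp; ring
    have h3 : ((Pairs.filter (fun x => (x.1:ℝ) * x.2 ≤ B)).card : ℝ) ≤ B^2 := by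
      have h4 : Pairs.filter (fun x => (x.1:ℝ) * x.2 ≤ B) ⊆ (Ioc 0 ⌊B⌋₊) ×ˢ (Ioc 0 ⌊B⌋₊) := by
        intro x hx
        rw [mem_filter, hPairs, mem_filter, mem_product] at hx
        have p1 : (1:ℝ) ≤ x.1 := by exact_mod_cast (mem_PN.1 hx.1.1.1).2.1.pos
        have p2 : (1:ℝ) ≤ x.2 := by exact_mod_cast (mem_PN.1 hx.1.1.2).2.1.pos
        rw [mem_product, mem_Ioc, mem_Ioc]
        refine ⟨⟨(mem_PN.1 hx.1.1.1).2.1.pos, Nat.le_floor ?_⟩, (mem_PN.1 hx.1.1.2).2.1.pos, Nat.le_floor ?_⟩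
        · nlinarith [hx.2]
        · nlinarith [hx.2]
      have h5 := card_le_card h4
      rw [card_product, Nat.card_Ioc] at h5
      have h6 : (⌊B⌋₊:ℝ) ≤ B := Nat.floor_le (Real.exp_pos _).le
      calc _ ≤ (⌊B⌋₊:ℝ) * ⌊B⌋₊ := by exact_mod_cast h5
        _ ≤ B * B := by gcongr
        _ = _ := by ring
    have h4 : ∑ x ∈ Pairs.filter (fun x => (x.1:ℝ) * x.2 ≤ B), (1:ℝ) / (x.1 * x.2) ≤ C * Real.exp (-u) := by
      refine le_trans ?_ (hpair N u hu)
      calc _ ≤ ∑ x ∈ Pairs, (1:ℝ) / (x.1 * x.2) :=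
            sum_le_sum_of_subset_of_nonneg (filter_subset _ _) fun x _ _ => by positivity
        _ = _ := by
            rw [hPairs, sum_filter, sum_product, sum_filter]
            refine sum_congr rfl fun p hp => ?_
            split_ifs with h5
            · rw [sum_filter]
              refine sum_congr rfl fun q hq => ?_
              simp only [h5, and_true]
            · refine sum_eq_zero fun q _ => if_neg (by tauto)
    calc _ ≤ _ := sum_le_sum h2
      _ = ((Pairs.filter (fun x => (x.1:ℝ) * x.2 ≤ B)).card : ℝ) * √N + 8 * (N/l) * (SS N ^ n / n.factorial) *
          ∑ x ∈ Pairs.filter (fun x => (x.1:ℝ) * x.2 ≤ B), (1:ℝ) / (x.1 * x.2) := by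
          rw [sum_add_distrib, sum_const, nsmul_eq_mul, mul_sum]
      _ ≤ B^2 * √N + 8 * (N/l) * (SS N ^ n / n.factorial) * (C * Real.exp (-u)) := by gcongr
      _ = _ := by ring
  have hlarge : ((U.filter (fun y => ¬ ((y.1.1:ℝ) * y.1.2 ≤ B))).card : ℝ) ≤
      32768 * (N / l^2) * (SS N ^ (n+1) / (n+1).factorial) := by
    have h1 : ((U.filter (fun y => ¬ ((y.1.1:ℝ) * y.1.2 ≤ B))).card : ℝ) =
        ∑ m ∈ powersetCard (n+1) (PN N), ((((PN N) ×ˢ (PN N)).filter (fun x : ℕ × ℕ => (x.1 < x.2 ∧ x.2 ≤ 2 * x.1 ∧ u < lam x.1) ∧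
      (pr m : ℝ) * (x.1 * x.2) < N ∧ B < (x.1:ℝ) * x.2)).card : ℝ) := by
      rw [hU, filter_filter, card_filter, sum_product_right]
      push_cast
      refine sum_congr rfl fun m _ => ?_
      rw [hPairs, sum_filter, card_filter]
      push_cast
      refine sum_congr rfl fun x _ => ?_
      simp only [not_le, ite_and]
    rw [h1]
    calc _ ≤ ∑ m ∈ powersetCard (n+1) (PN N), 32768 * (N / l^2) * w m := by
          refine sum_le_sum fun m hm => ?_
          exact pairs_large N u m (mem_powersetCard.1 hm).1 hl32 (by linarith)
      _ = 32768 * (N / l^2) * ∑ m ∈ powersetCard (n+1) (PN N), w m := by rw [mul_sum]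
      _ ≤ _ := by
          gcongr
          exact esymm_le (PN N) _ (fun p _ => by positivity) (n+1)
  have hneg : √N * B^2 ≤ (N/l) * Q * (1/l) := by
    have h1 : √N * B^2 = Real.exp (3*l/4) := by
      have : √N = Real.exp (l/2) := by rw [hNl, Real.exp_half]
      rw [this, hB, ← Real.exp_nat_mul, ← Real.exp_add]; congr 1; push_cast; ring
    have h2 : Real.exp (3*l/4) * l^3 ≤ N := by
      have : N = Real.exp (3*l/4) * Real.exp (l/4) := by rw [← Real.exp_add, hNl]; congr 1; ring
      rw [this]; gcongr
      have : 0 ≤ l^3 := by positivity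
      linarith
    calc _ = Real.exp (3*l/4) := h1
      _ ≤ N / l^3 := by rw [le_div_iff₀ (by positivity)]; exact h2
      _ = (N/l) * (1/l) * (1/l) := by field_simp
      _ ≤ _ := by gcongr
  have hQ0 : 0 ≤ Q := by positivity
  have e0 : 0 < Real.exp (-u) := Real.exp_pos _
  have hA0 : 0 ≤ N/l * Q := by positivity
  have k1 : 8 * (N/l) * (SS N ^ n / n.factorial) * (C * Real.exp (-u)) ≤ 18 * C * (N/l*Q) * Real.exp (-u) := by
    calc _ ≤ 8 * (N/l) * (9/4 * Q) * (C * Real.exp (-u)) := by gcongr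
      _ = _ := by ring
  have k2 : 32768 * (N / l^2) * (SS N ^ (n+1) / (n+1).factorial) ≤ 49152 * (N/l*Q) * (1/l) := by
    calc _ ≤ 32768 * (N / l^2) * (3/2 * Q) := by gcongr
      _ = _ := by field_simp; ring
  have e3 : (0:ℝ) ≤ (N/l*Q) * Real.exp (-u) := by positivity
  have e4 : (0:ℝ) ≤ (N/l*Q) * (1/l) := by positivity
  have e5 : (18 * C + 50000) * (N/l*Q) * (Real.exp (-u) + 1/l) = 18 * C * (N/l*Q) * Real.exp (-u) +
    50000 * ((N/l*Q) * Real.exp (-u)) + 18 * C * ((N/l*Q) * (1/l)) + 50000 * ((N/l*Q) * (1/l)) := by ring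
  rw [e5]
  have e6 : 0 ≤ 18 * C * ((N/l*Q) * (1/l)) := by positivity
  linarith
end PNN

namespace PNN
open Finset Filter

/-- Chernoff generating function -/
lemma chern {N : ℝ} {R : ℕ} (h : Reg N R) (B : Finset ℕ) (hB : B ⊆ PN N) (τ : ℝ) (hτ : 0 < τ) :
    ∑ t ∈ powersetCard R (PN N), w t * τ ^ (t ∩ B).card ≤
      SS N ^ R / R.factorial * Real.exp ((τ - 1) * (R / SS N) * ∑ p ∈ B, (1:ℝ)/p) := by
  have hS := h.Spos
  have h0 := esymm_le (PN N) (fun p => (1:ℝ)/p * (if p ∈ B then τ else 1)) (fun p _ => by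
    split_ifs <;> positivity) R
  have h1 : ∑ p ∈ PN N, (1:ℝ)/p * (if p ∈ B then τ else 1) = SS N + (τ-1) * ∑ p ∈ B, (1:ℝ)/p := by
    unfold SS
    have e : ∑ p ∈ B, (1:ℝ)/p = ∑ p ∈ PN N, if p ∈ B then (1:ℝ)/p else 0 := by
      rw [← sum_filter]; congr 1; ext p; simp; exact fun hp => hB hp
    rw [e, mul_sum, ← sum_add_distrib]
    refine sum_congr rfl fun p _ => ?_
    split_ifs <;> ring
  have h2 : ∀ t ∈ powersetCard R (PN N), w t * τ ^ (t ∩ B).card =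
      ∏ p ∈ t, ((1:ℝ)/p * (if p ∈ B then τ else 1)) := by
    intro t _
    rw [prod_mul_distrib, ← prod_filter, prod_const, filter_mem_eq_inter]; rfl
  rw [sum_congr rfl h2]
  refine h0.trans ?_
  rw [h1]
  set s := ∑ p ∈ B, (1:ℝ)/p
  have hpos : 0 ≤ SS N + (τ-1) * s := by
    rw [← h1]; exact sum_nonneg fun p _ => by split_ifs <;> positivity
  have h3 : SS N + (τ-1)*s ≤ SS N * Real.exp ((τ-1) * s / SS N) := by
    have := Real.add_one_le_exp ((τ-1) * s / SS N)
    calc _ = SS N * ((τ-1) * s / SS N + 1) := by field_simp; ring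
      _ ≤ _ := by gcongr
  calc (SS N + (τ-1)*s)^R / R.factorial ≤ (SS N * Real.exp ((τ-1) * s / SS N))^R / R.factorial := by gcongr
    _ = _ := by
      rw [mul_pow, ← Real.exp_nat_mul]
      have : (R:ℝ) * ((τ - 1) * s / SS N) = (τ - 1) * (R / SS N) * s := by ring
      rw [this]; ring

lemma chern_up {N : ℝ} {R : ℕ} (h : Reg N R) (B : Finset ℕ) (hB : B ⊆ PN N) (τ : ℝ) (hτ : 1 ≤ τ) (i : ℕ)
    (A : Finset (Finset ℕ)) (hA : A ⊆ powersetCard R (PN N)) (hAi : ∀ t ∈ A, i ≤ (t ∩ B).card) :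
    ∑ t ∈ A, w t ≤
      SS N ^ R / R.factorial * Real.exp ((τ - 1) * (R / SS N) * (∑ p ∈ B, (1:ℝ)/p) - i * Real.log τ) := by
  have h1 := chern h B hB τ (by linarith)
  have h2 : (∑ t ∈ A, w t) * τ^i ≤ ∑ t ∈ powersetCard R (PN N), w t * τ ^ (t ∩ B).card := by
    rw [sum_mul]
    refine (sum_le_sum fun t ht => ?_).trans (sum_le_sum_of_subset_of_nonneg hA fun t _ _ =>
      mul_nonneg (w_nonneg t) (by positivity))
    exact mul_le_mul_of_nonneg_left (pow_le_pow_right₀ hτ (hAi t ht)) (w_nonneg t)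
  have h3 : τ^i = Real.exp (i * Real.log τ) := by
    rw [Real.exp_nat_mul, Real.exp_log (by linarith)]
  rw [h3] at h2
  rw [Real.exp_sub, ← mul_div_assoc, le_div_iff₀ (Real.exp_pos _)]
  exact h2.trans h1

lemma chern_low {N : ℝ} {R : ℕ} (h : Reg N R) (B : Finset ℕ) (hB : B ⊆ PN N) (τ : ℝ) (h0 : 0 < τ) (hτ : τ ≤ 1) (i : ℕ)
    (A : Finset (Finset ℕ)) (hA : A ⊆ powersetCard R (PN N)) (hAi : ∀ t ∈ A, (t ∩ B).card ≤ i) :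
    ∑ t ∈ A, w t ≤
      SS N ^ R / R.factorial * Real.exp ((τ - 1) * (R / SS N) * (∑ p ∈ B, (1:ℝ)/p) - i * Real.log τ) := by
  have h1 := chern h B hB τ h0
  have h2 : (∑ t ∈ A, w t) * τ^i ≤ ∑ t ∈ powersetCard R (PN N), w t * τ ^ (t ∩ B).card := by
    rw [sum_mul]
    refine (sum_le_sum fun t ht => ?_).trans (sum_le_sum_of_subset_of_nonneg hA fun t _ _ =>
      mul_nonneg (w_nonneg t) (by positivity))
    exact mul_le_mul_of_nonneg_left (pow_le_pow_of_le_one h0.le hτ (hAi t ht)) (w_nonneg t)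
  have h3 : τ^i = Real.exp (i * Real.log τ) := by
    rw [Real.exp_nat_mul, Real.exp_log (by linarith)]
  rw [h3] at h2
  rw [Real.exp_sub, ← mul_div_assoc, le_div_iff₀ (Real.exp_pos _)]
  exact h2.trans h1

/-- deviation -/
noncomputable def dev (C : ℝ) (i : ℕ) : ℝ := C ^ ((1:ℝ)/5) * (max (i:ℝ) C) ^ ((4:ℝ)/5)

noncomputable def eta (C y : ℝ) : ℝ := (C / y) ^ ((1:ℝ)/5)

lemma eta_pos {C y : ℝ} (hC : 0 < C) (hy : C ≤ y) : 0 < eta C y := by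
  unfold eta; have : 0 < y := by linarith
  positivity

lemma eta_le {C y : ℝ} (hC : 0 < C) (hy : C ≤ y) : eta C y ≤ 1 := by
  unfold eta
  have : 0 < y := by linarith
  exact Real.rpow_le_one (by positivity) (by rw [div_le_one this]; exact hy) (by norm_num)

lemma dev_eq {C : ℝ} (hC : 0 < C) (i : ℕ) : dev C i = max (i:ℝ) C * eta C (max (i:ℝ) C) := by
  unfold dev eta
  set y := max (i:ℝ) C
  have hy : 0 < y := lt_of_lt_of_le hC (le_max_right _ _)
  rw [Real.div_rpow hC.le hy.le]
  have : y = y ^ ((4:ℝ)/5) * y ^ ((1:ℝ)/5) := by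
    rw [← Real.rpow_add hy]; norm_num
  have h2 : 0 < y ^ ((1:ℝ)/5) := by positivity
  rw [eq_comm, mul_div_assoc', div_eq_iff h2.ne']
  nth_rw 1 [this]; ring

lemma eta_sq {C y : ℝ} (hC : 1 ≤ C) (hy : C ≤ y) (i : ℕ) (hi : (i:ℝ) ≤ y) :
    C/2 + (i:ℝ)^((3:ℝ)/5)/2 ≤ y * eta C y ^ 2 := by
  have hy0 : 0 < y := by linarith
  have h1 : y * eta C y ^ 2 = C^((2:ℝ)/5) * y^((3:ℝ)/5) := by
    unfold eta
    rw [← Real.rpow_natCast, ← Real.rpow_mul (by positivity), Real.div_rpow (by linarith) hy0.le]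
    have : y = y ^ ((3:ℝ)/5) * y ^ ((2:ℝ)/5) := by
      rw [← Real.rpow_add hy0]; norm_num
    have h2 : 0 < y ^ ((2:ℝ)/5) := by positivity
    norm_num
    rw [mul_div_assoc', div_eq_iff h2.ne']
    nth_rw 1 [this]; ring
  rw [h1]
  have h2 : C ≤ C^((2:ℝ)/5) * y^((3:ℝ)/5) := by
    calc C = C^((2:ℝ)/5) * C^((3:ℝ)/5) := by rw [← Real.rpow_add (by linarith)]; norm_num
      _ ≤ _ := by gcongr
  have h3 : (i:ℝ)^((3:ℝ)/5) ≤ C^((2:ℝ)/5) * y^((3:ℝ)/5) := by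
    calc (i:ℝ)^((3:ℝ)/5) ≤ 1 * y^((3:ℝ)/5) := by rw [one_mul]; gcongr
      _ ≤ _ := by gcongr; exact Real.one_le_rpow hC (by norm_num)
  linarith

lemma summ_exp : Summable (fun i : ℕ => Real.exp (-((i:ℝ)^((3:ℝ)/5)/20))) := by
  have h1 : ∀ᶠ i : ℕ in atTop, Real.exp (-((i:ℝ)^((3:ℝ)/5)/20)) ≤ 1 / (i:ℝ)^2 := by
    have h2 := Real.tendsto_pow_mul_exp_neg_atTop_nhds_zero 4
    have h3 : Tendsto (fun i : ℕ => (i:ℝ)^((3:ℝ)/5)/20) atTop atTop :=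
      ((tendsto_rpow_atTop (by norm_num)).comp tendsto_natCast_atTop_atTop).atTop_div_const (by norm_num)
    have h4 := (h2.comp h3).eventually_le_const (show (0:ℝ) < 1/20^4 by norm_num)
    filter_upwards [h4, eventually_ge_atTop 1] with i hi h1i
    have hi1 : (1:ℝ) ≤ i := by exact_mod_cast h1i
    simp only [Function.comp, div_pow] at hi
    have h5 : (i:ℝ)^2 ≤ ((i:ℝ)^((3:ℝ)/5))^4 := by
      rw [← Real.rpow_natCast, ← Real.rpow_natCast, ← Real.rpow_mul (by positivity)]
      apply Real.rpow_le_rpow_of_exponent_le hi1; norm_num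
    rw [le_div_iff₀ (by positivity)]
    have e := Real.exp_pos (-((i:ℝ)^((3:ℝ)/5)/20))
    nlinarith
  have h2 : Summable (fun i : ℕ => 1/(i:ℝ)^2) := Real.summable_one_div_nat_pow.2 (by norm_num)
  refine h2.of_norm_bounded_eventually_nat ?_
  filter_upwards [h1] with i hi
  rwa [Real.norm_eq_abs, abs_of_pos (Real.exp_pos _)]

lemma low_exp {η ρ i M s : ℝ} (h0 : 0 < η) (h1 : η ≤ 1) (hρ0 : 0 ≤ ρ) (hρ : ρ ≤ 1 + η/8) (hi : 0 ≤ i) (hM : 0 ≤ M)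
    (hs : s ≤ i * (1 - η) + M) :
    (1 + η - 1) * ρ * s - i * Real.log (1 + η) ≤ - (i * η^2/10) + 2 * M := by
  have hl : η - η^2/2 ≤ Real.log (1+η) := by
    have := Real.le_log_one_add_of_nonneg h0.le
    refine le_trans ?_ this
    rw [le_div_iff₀ (by linarith)]
    nlinarith [pow_pos h0 3, pow_pos h0 2]
  have a1 : (1 + η - 1) * ρ * s ≤ η * ρ * (i * (1-η)) + 2 * M := by
    have : η * ρ * s ≤ η * ρ * (i * (1 - η) + M) := by gcongr
    have : η * ρ ≤ 2 := by nlinarith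
    have : η * ρ * M ≤ 2 * M := by gcongr
    have e : (1 + η - 1) * ρ * s = η * ρ * s := by ring
    rw [e]; linarith
  have a2 : η * ρ * (i * (1-η)) ≤ η * (1+η/8) * (i * (1-η)) := by
    have : 0 ≤ i * (1-η) := mul_nonneg hi (by linarith)
    gcongr
  have a3 : i * (η - η^2/2) ≤ i * Real.log (1+η) := by gcongr
  have a4 : η * (1+η/8) * (i * (1-η)) = i * η - 7/8 * (i * η^2) - i*η^3/8 := by ring
  have a5 : 0 ≤ i * η^3 := by positivity
  have a6 : 0 ≤ i * η^2 := by positivity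
  have a7 : i * (η - η^2/2) = i * η - i*η^2/2 := by ring
  linarith

lemma high_exp {η ρ i y M s : ℝ} (h0 : 0 < η) (h1 : η ≤ 1) (hρ : 1 - η/8 ≤ ρ) (hρ2 : ρ ≤ 2) (hi : 0 ≤ i) (hiy : i ≤ y) (hM : 0 ≤ M)
    (hs : i + y * η - M ≤ s) :
    (1 - η/4 - 1) * ρ * s - i * Real.log (1 - η/4) ≤ - (y * η^2/10) + 2 * M := by
  set x := η/4 with hx
  have hx0 : 0 < x := by positivity
  have hl : - (x + 4/3*x^2) ≤ Real.log (1-x) := by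
    have := Real.one_sub_inv_le_log_of_pos (show 0 < 1 - x by linarith)
    refine le_trans ?_ this
    rw [neg_le_sub_iff_le_add, inv_le_iff_one_le_mul₀ (by linarith)]
    nlinarith [mul_nonneg (sq_nonneg x) (show 0 ≤ 1/4 - x by linarith)]
  have hρ0 : 0 ≤ ρ := by linarith
  have e : (1 - x - 1) * ρ * s = - (x * ρ * s) := by ring
  rw [e]
  have a1 : x * ρ * (i + y * η) - 2 * M ≤ x * ρ * s := by
    have b1 : x * ρ * (i + y * η - M) ≤ x * ρ * s := by gcongr
    have : x * ρ ≤ 2 := by nlinarith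
    have : x * ρ * M ≤ 2 * M := by gcongr
    linarith
  have a2 : x * (1 - η/8) * (i + y * η) ≤ x * ρ * (i + y*η) := by
    have : 0 ≤ i + y * η := by have := hi.trans hiy; positivity
    gcongr
  have a3 : i * -(x+4/3*x^2) ≤ i * Real.log (1-x) := by gcongr
  have a4 : x * (1-η/8) * (i + y * η) - i * (x + 4/3*x^2) = y * η^2/4 - y * η^3 / 32 - i * η^2 * (1/32+1/12) := by
    rw [hx]; ring
  have a5 : i * η^2 ≤ y * η^2 := by gcongr
  have a6 : y * η^3 ≤ y * η^2 := by
    have := hi.trans hiy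
    gcongr y * ?_
    exact pow_le_pow_of_le_one h0.le h1 (by norm_num)
  have a7 : 0 ≤ y * η^2 := by have := hi.trans hiy; positivity
  linarith

end PNN

namespace PNN
open Finset Filter

noncomputable def CC (N : ℝ) : ℝ := √(Real.log (xx N))

/-- counting function -/
noncomputable def cnt (t : Finset ℕ) (v : ℝ) : ℕ := (t.filter (fun p => lam p ≤ v)).card

def Low (C : ℝ) (i : ℕ) (t : Finset ℕ) : Prop := i ≤ cnt t (2 * (i - dev C i))
def High (C : ℝ) (i : ℕ) (t : Finset ℕ) : Prop := cnt t (2 * (i + dev C i) - 1) < i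

def Bad2 (C : ℝ) (R : ℕ) (t : Finset ℕ) : Prop := ∃ i : ℕ, 1 ≤ i ∧ 3 * i ≤ R ∧ (Low C i t ∨ High C i t)

/-- good range for x and C -/
structure RegC (x C : ℝ) : Prop where
  C2 : 2 ≤ C
  Cx : C ≤ x / 100000
  x1 : 1 ≤ x
  del : 5 * x^(-(1:ℝ)/3) ≤ x^(-(1:ℝ)/5)/8
  half : 6 * x^((2:ℝ)/3) ≤ x / 10

lemma tendsto_CC : Tendsto CC atTop atTop := 
  Real.tendsto_sqrt_atTop.comp (Real.tendsto_log_atTop.comp tendsto_xx)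

lemma ev_RegC : ∀ᶠ N in atTop, RegC (xx N) (CC N) := by
  have h1 := tendsto_CC.eventually_ge_atTop 2
  have h2 := tendsto_xx.eventually (ev_log 1 (1/100000) (by norm_num) (by norm_num))
  have h3 := tendsto_xx.eventually (ev_rpow (-(1:ℝ)/3) (-(1:ℝ)/5) (1/40) (by norm_num) (by norm_num))
  have h4 := tendsto_xx.eventually (ev_rpow ((2:ℝ)/3) 1 (1/60) (by norm_num) (by norm_num))
  have h5 := tendsto_xx.eventually_ge_atTop 1
  filter_upwards [h1, h2, h3, h4, h5] with N h1 h2 h3 h4 h5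
  rw [Real.rpow_one] at h2 h4
  refine ⟨h1, ?_, h5, by linarith, by linarith⟩
  have h6 : CC N ^ 2 = Real.log (xx N) := by
    unfold CC
    apply Real.sq_sqrt
    apply Real.log_nonneg h5
  nlinarith

lemma Reg.rho {N : ℝ} {R : ℕ} (h : Reg N R) : |(R:ℝ) / SS N - 1| ≤ 5 * xx N ^(-(1:ℝ)/3) := by
  have hS := h.Spos
  have hx : 0 < xx N := by linarith [h.hx]
  have e : (R:ℝ) / SS N - 1 = (R - SS N) / SS N := by field_simp
  rw [e, abs_div, abs_of_pos hS, div_le_iff₀ hS]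
  have e2 : xx N ^ ((2:ℝ)/3) = xx N ^ (-(1:ℝ)/3) * xx N := by
    nth_rw 3 [← Real.rpow_one (xx N)]
    rw [← Real.rpow_add hx]; norm_num
  have := h.hSR; have h2 := h.S1
  rw [e2] at this
  have h3 : 0 < xx N ^ (-(1:ℝ)/3) := by positivity
  nlinarith

lemma Beg_sub {N v : ℝ} (hN : 16 ≤ N) (hv : v < xx N) : Beg v ⊆ PN N := by
  intro p hp
  rw [mem_Beg] at hp
  rw [mem_PN]
  refine ⟨?_, hp.1⟩
  have h1 := log_pos_of_PPr hp.1
  have h2 : lam p < xx N := by linarith [hp.2]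
  unfold lam xx at h2
  have h3 : 0 < Real.log N := Real.log_pos (by linarith)
  rw [Real.log_lt_log_iff h1 h3] at h2
  have : (0:ℝ) < p := by exact_mod_cast hp.1.1.pos
  rwa [Real.log_lt_log_iff this (by linarith)] at h2

lemma cnt_eq {N v : ℝ} {t : Finset ℕ} (ht : t ⊆ PN N) : cnt t v = (t ∩ Beg v).card := by
  unfold cnt; congr 1; ext p
  rw [mem_filter, mem_inter, mem_Beg]
  exact ⟨fun h => ⟨h.1, (mem_PN.1 (ht h.1)).2, h.2⟩, fun h => ⟨h.1, h.2.2⟩⟩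

lemma lam_two : -1 < lam 2 := by
  unfold lam
  rw [Real.lt_log_iff_exp_lt (by norm_num; exact Real.log_pos (by norm_num))]
  have h1 := Real.log_two_gt_d9
  have : Real.exp (-1) < 1/2 := by
    rw [Real.exp_neg, inv_lt_comm₀ (Real.exp_pos 1) (by norm_num)]
    have := Real.exp_one_gt_d9; norm_num; linarith
  push_cast; linarith

lemma two_of_lam {p : ℕ} (hp : PPr p) (h : lam p ≤ 0) : p = 2 := by
  have h1 := le_of_lam_le hp h
  rw [Real.exp_zero] at h1
  have : (p:ℝ) < 3 := lt_of_le_of_lt h1 Real.exp_one_lt_three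
  have h3 : p < 3 := by exact_mod_cast this
  have := hp.1.two_le
  omega

lemma not_low {C : ℝ} (hC : 2 ≤ C) {i : ℕ} (h1 : 1 ≤ i) (hi : (i:ℝ) ≤ C) {t : Finset ℕ} (ht : ∀ p ∈ t, PPr p) :
    ¬ Low C i t := by
  intro h
  have hd : dev C i = C := by
    unfold dev; rw [max_eq_right hi, ← Real.rpow_add (by linarith)]; norm_num
  unfold Low at h
  rw [hd] at h
  have hsub : (t.filter (fun p => lam p ≤ 2 * (i - C))) ⊆ {2} := by
    intro p hp
    rw [mem_filter] at hp
    rw [mem_singleton]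
    exact two_of_lam (ht p hp.1) (hp.2.trans (by linarith))
  have hc := card_le_card hsub
  rw [card_singleton] at hc
  have : i = 1 := by unfold cnt at h; omega
  subst this
  unfold cnt at h
  obtain ⟨p, hp⟩ := card_pos.1 h
  have h2 := hsub hp
  rw [mem_singleton] at h2
  subst h2
  rw [mem_filter] at hp
  have := lam_two
  push_cast at hp
  linarith [hp.2]

set_option maxHeartbeats 1000000 in
lemma bad2_weight : ∃ K : ℝ, 1 ≤ K ∧ ∀ᶠ N in atTop, ∀ R : ℕ, Reg N R → 
    ∀ A ⊆ powersetCard R (PN N), (∀ t ∈ A, Bad2 (CC N) R t) →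
    ∑ t ∈ A, w t ≤ K * (SS N ^ R / R.factorial) * Real.exp (-(CC N / 20)) := by
  obtain ⟨M, hM, hms⟩ := mertens_start
  set Z := ∑' i : ℕ, Real.exp (-((i:ℝ)^((3:ℝ)/5)/20)) with hZ
  have hZ1 : 1 ≤ Z := by
    have := summ_exp.le_tsum 0 (fun i _ => (Real.exp_pos _).le)
    refine le_trans ?_ this
    simp only [Nat.cast_zero]
    rw [Real.zero_rpow (by norm_num)]; norm_num
  have hE1 : 1 ≤ Real.exp (2 * (M+1)) := Real.one_le_exp (by linarith)
  refine ⟨2 * Real.exp (2*(M+1)) * Z, by nlinarith, ?_⟩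
  filter_upwards [ev_RegC] with N hc R hReg A hA hbad
  classical
  set C := CC N
  set x := xx N with hx
  have hN := hReg.N2
  have hC := hc.C2
  have hS := hReg.Spos
  set Q := SS N ^ R / R.factorial with hQ
  have hQ0 : 0 ≤ Q := by positivity
  have hrho := hReg.rho
  rw [abs_le] at hrho
  set ρ := (R:ℝ) / SS N with hρ
  have hρ0 : 0 ≤ ρ := by positivity
  -- pointwise
  have key : ∀ i ∈ Icc 1 (R/3), 
      (∑ t ∈ A.filter (Low C i), w t ≤ Q * Real.exp (2*(M+1)) * (Real.exp (-(C/20)) * Real.exp (-((i:ℝ)^((3:ℝ)/5)/20)))) ∧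
      (∑ t ∈ A.filter (High C i), w t ≤ Q * Real.exp (2*(M+1)) * (Real.exp (-(C/20)) * Real.exp (-((i:ℝ)^((3:ℝ)/5)/20)))) := by
    intro i hi
    rw [mem_Icc] at hi
    set y := max (i:ℝ) C with hy
    have hyC : C ≤ y := le_max_right _ _
    have hyi : (i:ℝ) ≤ y := le_max_left _ _
    have hC0 : 0 < C := by linarith
    have hi3 : (i:ℝ) * 3 ≤ R := by
      have : i * 3 ≤ R := by omega
      exact_mod_cast this
    have hiR : (i:ℝ) ≤ x/5 := by have := hReg.R2; linarith
    have hyx : y ≤ x := max_le (by linarith [hc.x1]) (by linarith [hc.x1, hc.Cx])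
    have hη0 := eta_pos hC0 hyC
    have hη1 := eta_le hC0 hyC
    have hη2 := eta_sq (by linarith) hyC i hyi
    have hdev := dev_eq hC0 i
    set η := eta C y with hη
    have hηx : x^(-(1:ℝ)/5) ≤ η := by
      rw [hη]; unfold eta
      have hx0 : 0 < x := by linarith [hc.x1]
      have : x^(-(1:ℝ)/5) = (1/x)^((1:ℝ)/5) := by
        rw [one_div, Real.inv_rpow hx0.le, ← Real.rpow_neg hx0.le]; norm_num
      rw [this]
      apply Real.rpow_le_rpow (by positivity) _ (by norm_num)
      gcongr
      linarith
    have hdel := hc.del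
    have hdevx : dev C i ≤ x/10 := by
      unfold dev
      have hx0 : 0 < x := by linarith [hc.x1]
      calc _ ≤ (x/100000)^((1:ℝ)/5) * x^((4:ℝ)/5) := by
            gcongr
            exact hc.Cx
        _ = x/10 := by
            rw [Real.div_rpow hx0.le (by norm_num), show (100000:ℝ) = 10^(5:ℝ) by norm_num, ← Real.rpow_mul (by norm_num)]
            rw [div_mul_eq_mul_div, ← Real.rpow_add hx0]; norm_num
    have fin : ∀ z : ℝ, z ≤ - (y * η^2/10) + 2 * (M+1) → Q * Real.exp z ≤ 
        Q * Real.exp (2*(M+1)) * (Real.exp (-(C/20)) * Real.exp (-((i:ℝ)^((3:ℝ)/5)/20))) := by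
      intro z hz
      rw [mul_assoc, ← Real.exp_add, ← Real.exp_add]
      gcongr
      linarith
    constructor
    · by_cases hiC : (i:ℝ) ≤ C
      · have : A.filter (Low C i) = ∅ := by
          rw [filter_eq_empty_iff]
          intro t ht
          exact not_low hC hi.1 hiC fun p hp => (mem_PN.1 ((mem_powersetCard.1 (hA ht)).1 hp)).2
        rw [this, sum_empty]; positivity
      · have hyi' : y = i := max_eq_left (by linarith)
        set v := 2 * ((i:ℝ) - dev C i) with hv
        have hv' : v = 2 * (i * (1 - η)) := by rw [hv, hdev, ← hy, hyi']; ring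
        have hv0 : 0 ≤ v := by rw [hv']; have : 0 ≤ 1 - η := by linarith
                               positivity
        have hs := hms v hv0 (Beg v) (fun p => mem_Beg)
        rw [abs_le] at hs
        have hvx : v < x := by
          have : 0 ≤ dev C i := by rw [hdev]; positivity
          have := hc.x1
          linarith
        refine (chern_up hReg (Beg v) (Beg_sub hN hvx) (1+η) (by linarith) i _ ((filter_subset _ _).trans hA) ?_).trans (fin _ ?_)
        · intro t ht
          rw [mem_filter] at ht
          rw [← cnt_eq (mem_powersetCard.1 (hA ht.1)).1]
          exact ht.2
        · rw [hyi']
          exact low_exp (M := M+1) hη0 hη1 hρ0 (by linarith) (by positivity) (by linarith) (by linarith [hs.2])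
    · set v := 2 * ((i:ℝ) + dev C i) - 1 with hv
      have hv0 : 0 ≤ v := by 
        have h1 : (1:ℝ) ≤ i := by exact_mod_cast hi.1
        have : 0 ≤ dev C i := by rw [hdev]; positivity
        linarith
      have hs := hms v hv0 (Beg v) (fun p => mem_Beg)
      rw [abs_le] at hs
      have hvx : v < x := by
        have := hc.x1
        linarith
      refine (chern_low hReg (Beg v) (Beg_sub hN hvx) (1-η/4) (by linarith) (by linarith) i _ ((filter_subset _ _).trans hA) ?_).trans (fin _ ?_)
      · intro t ht
        rw [mem_filter] at ht
        rw [← cnt_eq (mem_powersetCard.1 (hA ht.1)).1]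
        exact le_of_lt ht.2
      · exact high_exp (M := M+1) hη0 hη1 (by linarith) (by linarith) (by positivity) hyi (by linarith) (by linarith [hs.1])
  have hsub : A ⊆ (Icc 1 (R/3)).biUnion (fun i => A.filter (Low C i) ∪ A.filter (High C i)) := by
    intro t ht
    obtain ⟨i, h1, h2, h3⟩ := hbad t ht
    rw [mem_biUnion]
    refine ⟨i, mem_Icc.2 ⟨h1, by omega⟩, ?_⟩
    rw [mem_union, mem_filter, mem_filter]
    tauto
  calc ∑ t ∈ A, w t ≤ ∑ t ∈ (Icc 1 (R/3)).biUnion (fun i => A.filter (Low C i) ∪ A.filter (High C i)), w t :=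
        sum_le_sum_of_subset_of_nonneg hsub fun t _ _ => w_nonneg t
    _ ≤ ∑ i ∈ Icc 1 (R/3), ∑ t ∈ A.filter (Low C i) ∪ A.filter (High C i), w t :=
        sum_biUnion_le' _ _ _ (fun t => w_nonneg t)
    _ ≤ ∑ i ∈ Icc 1 (R/3), 2 * (Q * Real.exp (2*(M+1)) * (Real.exp (-(C/20)) * Real.exp (-((i:ℝ)^((3:ℝ)/5)/20)))) := by
        refine sum_le_sum fun i hi => ?_
        have h1 := sum_union_inter (s₁ := A.filter (Low C i)) (s₂ := A.filter (High C i)) (f := w)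
        have h2 : 0 ≤ ∑ t ∈ A.filter (Low C i) ∩ A.filter (High C i), w t := sum_nonneg fun t _ => w_nonneg t
        have := key i hi
        linarith [this.1, this.2]
    _ = 2 * Q * Real.exp (2*(M+1)) * Real.exp (-(C/20)) * ∑ i ∈ Icc 1 (R/3), Real.exp (-((i:ℝ)^((3:ℝ)/5)/20)) := by
        rw [mul_sum]; exact sum_congr rfl fun i _ => by ring
    _ ≤ 2 * Q * Real.exp (2*(M+1)) * Real.exp (-(C/20)) * Z := by
        gcongr
        exact summ_exp.sum_le_tsum _ fun i _ => (Real.exp_pos _).le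
    _ = _ := by ring

end PNN

namespace PNN
open Finset Filter

lemma transfer {N : ℝ} {R : ℕ} (h : Reg N R) (Q : Finset ℕ) (hQ : Q ⊆ PN N) (φ : Finset ℕ → ℝ)
    (hφ : ∀ b, 0 ≤ φ b) (hφ2 : ∀ b, φ b ≠ 0 → 2 * b.card ≤ R) (c : ℝ) (hc : 0 ≤ c)
    (hp : pw (fun p : ℕ => (R / SS N) * ((1:ℝ)/p)) Q φ ≤ c * ∏ p ∈ Q, (1 + (R / SS N) * ((1:ℝ)/p))) :
    ∑ t ∈ powersetCard R (PN N), w t * φ (t ∩ Q) ≤ 4 * c * (SS N ^ R / R.factorial) := by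
  have hS := h.Spos
  have hR := h.Rpos
  have hR0 : (0:ℝ) < R := by exact_mod_cast hR
  set ρ := (R:ℝ) / SS N with hρ
  have hρ0 : 0 < ρ := by positivity
  set f : ℕ → ℝ := fun p => ρ * ((1:ℝ)/p) with hf
  have hf0 : ∀ p, 0 ≤ f p := fun p => by positivity
  set T := ∑ p ∈ PN N \ Q, f p with hT
  have hT0 : 0 ≤ T := sum_nonneg fun p _ => hf0 p
  have h1 := card_split_bound f (PN N) Q hQ (fun p _ => hf0 p) R φ hφ T hT
  have h2 : ∑ t ∈ powersetCard R (PN N), (∏ p ∈ t, f p) * φ (t ∩ Q) =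
      ρ^R * ∑ t ∈ powersetCard R (PN N), w t * φ (t ∩ Q) := by
    rw [mul_sum]
    refine sum_congr rfl fun t ht => ?_
    rw [hf, prod_mul_distrib, prod_const, (mem_powersetCard.1 ht).2, mul_assoc]; rfl
  have h3 : pw f Q (fun b => if b.card ≤ R then φ b * (T ^ (R - b.card) / (R - b.card).factorial) else 0) ≤
      Real.exp T * √2 / √R * pw f Q φ := by
    have e : Real.exp T * √2 / √R * pw f Q φ = pw f Q (fun b => Real.exp T * √2 / √R * φ b) := by
      unfold pw; rw [mul_sum]; exact sum_congr rfl fun b _ => by ring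
    rw [e]
    apply pw_mono (fun p _ => hf0 p)
    intro b _
    by_cases hb : φ b = 0
    · rw [hb]; simp
    have hb2 := hφ2 b hb
    rw [if_pos (by omega), mul_comm]
    refine mul_le_mul_of_nonneg_right ?_ (hφ b)
    refine (stir_up (R - b.card) (by omega) T hT0).trans ?_
    have a1 : (R:ℝ)/2 ≤ ((R - b.card : ℕ):ℝ) := by
      rw [div_le_iff₀ (by norm_num)]
      have : R ≤ (R - b.card) * 2 := by omega
      exact_mod_cast this
    have a2 : √R / √2 ≤ √((R - b.card : ℕ):ℝ) := by
      rw [← Real.sqrt_div (by positivity)]; exact Real.sqrt_le_sqrt a1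
    calc Real.exp T / √((R - b.card : ℕ):ℝ) ≤ Real.exp T / (√R / √2) := by
          apply div_le_div_of_nonneg_left (Real.exp_pos _).le (by positivity) a2
      _ = _ := by field_simp
  have h4 : ∏ p ∈ Q, (1 + f p) ≤ Real.exp (∑ p ∈ Q, f p) := by
    rw [Real.exp_sum]
    refine prod_le_prod (fun p _ => by have := hf0 p; linarith) fun p _ => ?_
    rw [add_comm]; exact Real.add_one_le_exp _
  have h5 : T + ∑ p ∈ Q, f p = R := by
    rw [hT, sum_sdiff hQ, hf, ← mul_sum]
    show ρ * SS N = R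
    rw [hρ]; field_simp
  have h6 := pow_div_fact_ge R hR (SS N) hS.le
  have h7 : (SS N / R)^R = 1/ρ^R := by
    rw [hρ, div_pow, div_pow]; field_simp
  have h8 : √2 * Real.exp 1 ≤ 4 := by
    have := Real.exp_one_lt_d9
    have h9 : √2 ≤ 1.42 := by rw [Real.sqrt_le_left (by norm_num)]; norm_num
    nlinarith [Real.exp_pos 1, Real.sqrt_nonneg 2]
  have hρR : 0 < ρ^R := by positivity
  have h10 : ρ^R * ∑ t ∈ powersetCard R (PN N), w t * φ (t ∩ Q) ≤ c * (√2 / √R * Real.exp R) := by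
    rw [← h2]
    refine h1.trans (h3.trans ?_)
    calc _ ≤ Real.exp T * √2 / √R * (c * Real.exp (∑ p ∈ Q, f p)) := by
          gcongr
          exact hp.trans (by gcongr)
      _ = c * (√2 / √R * (Real.exp T * Real.exp (∑ p ∈ Q, f p))) := by ring
      _ = _ := by rw [← Real.exp_add, h5]
  rw [h7] at h6
  calc _ = 1/ρ^R * (ρ^R * ∑ t ∈ powersetCard R (PN N), w t * φ (t ∩ Q)) := by field_simp
    _ ≤ 1/ρ^R * (c * (√2 / √R * Real.exp R)) := by gcongr
    _ = c * (√2 * Real.exp 1) * (1/ρ^R * Real.exp R / (Real.exp 1 * √R)) := by field_simp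
    _ ≤ c * 4 * (SS N ^ R / R.factorial) := by gcongr
    _ = _ := by ring

section pwl
variable {α : Type*} [DecidableEq α]

lemma pw_split' (f : α → ℝ) (P Q : Finset α) (hQ : Q ⊆ P) (χ φ ψ : Finset α → ℝ)
    (h : ∀ a ⊆ P, χ a = φ (a ∩ Q) * ψ (a \ Q)) :
    pw f P χ = pw f Q φ * pw f (P \ Q) ψ := by
  rw [← pw_split f P Q hQ]
  unfold pw
  refine sum_congr rfl fun a ha => ?_
  rw [h a (mem_powerset.1 ha)]

lemma pw_avoid (f : α → ℝ) (Q W : Finset α) (hW : W ⊆ Q) :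
    pw f Q (fun a => if a ∩ W = ∅ then 1 else 0) = ∏ p ∈ Q \ W, (1 + f p) := by
  rw [pw_split' f Q W hW _ (fun a => if a = ∅ then 1 else 0) (fun _ => 1) (fun a _ => by simp), pw_one]
  have : pw f W (fun a => if a = ∅ then 1 else 0) = 1 := by
    unfold pw
    rw [sum_eq_single ∅]
    · simp
    · intro b _ hb; simp [hb]
    · intro h; simp at h
  rw [this, one_mul]

lemma prod_one_add_pos (f : α → ℝ) (hf : ∀ p, 0 ≤ f p) (Q : Finset α) : 1 ≤ ∏ p ∈ Q, (1 + f p) := by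
  have := prod_le_prod (s := Q) (f := fun _ => (1:ℝ)) (g := fun p => 1 + f p) (fun _ _ => zero_le_one)
    (fun p _ => by have := hf p; linarith)
  simpa using this

lemma one_add_sum_le (f : α → ℝ) (hf : ∀ p, 0 ≤ f p) (Q : Finset α) :
    1 + ∑ p ∈ Q, f p ≤ ∏ p ∈ Q, (1 + f p) := by
  induction Q using Finset.induction_on with
  | empty => simp
  | insert a s ha ih =>
    rw [sum_insert ha, prod_insert ha]
    have h1 := hf a
    have h2 : 0 ≤ ∑ p ∈ s, f p := sum_nonneg fun p _ => hf p
    nlinarith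

lemma pw_mean (f : α → ℝ) (hf : ∀ p, 0 ≤ f p) (Q : Finset α) (g : α → ℝ) (hg : ∀ p, 0 ≤ g p) :
    pw f Q (fun a => ∑ p ∈ a, g p) ≤ (∑ p ∈ Q, g p * f p) * ∏ p ∈ Q, (1 + f p) := by
  have h1 : pw f Q (fun a => ∑ p ∈ a, g p) = ∑ p ∈ Q, g p * pw f Q (fun a => if p ∈ a then 1 else 0) := by
    unfold pw
    simp_rw [mul_sum]
    rw [sum_comm]
    refine sum_congr rfl fun a ha => ?_
    have ha := mem_powerset.1 ha
    have e : ∀ F : α → ℝ, ∑ p ∈ a, F p = ∑ p ∈ Q, if p ∈ a then F p else 0 := fun F => by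
      rw [← sum_filter, filter_mem_eq_inter, inter_eq_right.2 ha]
    rw [e]
    refine sum_congr rfl fun p hp => ?_
    split_ifs with h
    · ring
    · ring
  rw [h1, sum_mul]
  refine sum_le_sum fun p hp => ?_
  rw [mul_assoc]
  refine mul_le_mul_of_nonneg_left ?_ (hg p)
  have hpQ : ({p} : Finset α) ⊆ Q := singleton_subset_iff.2 hp
  rw [pw_split' f Q {p} hpQ _ (fun a => if p ∈ a then 1 else 0) (fun _ => 1) (fun a _ => by simp), pw_one]
  have h2 : pw f {p} (fun a => if p ∈ a then 1 else 0) = f p := by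
    unfold pw
    rw [show ({p} : Finset α).powerset = {∅, {p}} from rfl]
    rw [sum_pair (by simp)]; simp
  rw [h2]
  refine mul_le_mul_of_nonneg_left ?_ (hf p)
  rw [← prod_sdiff hpQ]
  have := prod_one_add_pos f hf {p}
  have h3 := prod_one_add_pos f hf (Q \ {p})
  nlinarith

lemma pw_event (f : α → ℝ) (hf : ∀ p, 0 ≤ f p) (Q B W Gp : Finset α) (hB : B ⊆ Q) (hW : W ⊆ B) (hG : Gp ⊆ Q)
    (hBG : Disjoint B Gp) (g : α → ℝ) (hg : ∀ p, 0 ≤ g p) (κ : ℝ) (hκ : 0 < κ) (hW1 : 1 ≤ ∑ p ∈ W, f p)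
    (hgs : ∑ p ∈ B, g p * f p ≤ κ/4) (E : Finset α → Prop) [DecidablePred E]
    (hE : ∀ a ⊆ Q, E a ↔ ((a ∩ W).Nonempty ∧ a ∩ Gp = ∅ ∧ ∑ p ∈ a ∩ B, g p ≤ κ)) :
    1/4 * Real.exp (-∑ p ∈ Gp, f p) * ∏ p ∈ Q, (1 + f p) ≤ pw f Q (fun a => if E a then 1 else 0) := by
  classical
  have hGQ : Gp ⊆ Q \ B := fun p hp => Finset.mem_sdiff.2 ⟨hG hp, disjoint_right.1 hBG hp⟩
  rw [pw_split' f Q B hB _ (fun c => if (c ∩ W).Nonempty ∧ ∑ p ∈ c, g p ≤ κ then 1 else 0)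
    (fun d => if d ∩ Gp = ∅ then 1 else 0) ?_, pw_avoid f _ _ hGQ]
  swap
  · intro a ha
    have e1 : (a ∩ B) ∩ W = a ∩ W := by rw [inter_assoc, inter_eq_right.2 hW]
    have e2 : (a \ B) ∩ Gp = a ∩ Gp := by
      ext p; simp only [mem_inter, Finset.mem_sdiff]
      exact ⟨fun h => ⟨h.1.1, h.2⟩, fun h => ⟨⟨h.1, disjoint_right.1 hBG h.2⟩, h.2⟩⟩
    simp only [hE a ha, e1, e2]
    by_cases h1 : (a ∩ W).Nonempty <;> by_cases h2 : a ∩ Gp = ∅ <;> by_cases h3 : ∑ p ∈ a ∩ B, g p ≤ κ <;> simp [h1, h2, h3]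
  set PB := ∏ p ∈ B, (1 + f p) with hPB
  have hPB1 : 1 ≤ PB := prod_one_add_pos f hf B
  have h1 : 1/4 * PB ≤ pw f B (fun c => if (c ∩ W).Nonempty ∧ ∑ p ∈ c, g p ≤ κ then 1 else 0) := by
    have h2 : pw f B (fun c => 1 - (if c ∩ W = ∅ then 1 else 0) - (1/κ) * ∑ p ∈ c, g p) ≤
        pw f B (fun c => if (c ∩ W).Nonempty ∧ ∑ p ∈ c, g p ≤ κ then 1 else 0) := by
      apply pw_mono (fun p _ => hf p)
      intro c _
      have hs : 0 ≤ ∑ p ∈ c, g p := sum_nonneg fun p _ => hg p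
      have hs' : 0 ≤ 1/κ * ∑ p ∈ c, g p := by positivity
      by_cases h3 : c ∩ W = ∅
      · simp only [h3, if_true, Finset.not_nonempty_empty, false_and, if_false]; linarith
      · have h3' : (c ∩ W).Nonempty := nonempty_iff_ne_empty.2 h3
        by_cases h4 : ∑ p ∈ c, g p ≤ κ
        · simp only [h3, h3', h4, and_self, if_true, if_false]; linarith
        · simp only [h3, h3', h4, and_false, if_false]
          have : 1 ≤ 1/κ * ∑ p ∈ c, g p := by
            rw [one_div, ← div_eq_inv_mul, le_div_iff₀ hκ]; linarith
          linarith
    have h5 : pw f B (fun c => 1 - (if c ∩ W = ∅ then 1 else 0) - (1/κ) * ∑ p ∈ c, g p) =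
        pw f B (fun _ => 1) - pw f B (fun c => if c ∩ W = ∅ then 1 else 0) - 1/κ * pw f B (fun c => ∑ p ∈ c, g p) := by
      unfold pw
      rw [mul_sum, ← sum_sub_distrib, ← sum_sub_distrib]
      exact sum_congr rfl fun c _ => by ring
    rw [h5, pw_one, pw_avoid f _ _ hW] at h2
    have h6 := pw_mean f hf B g hg
    have h7 : 1/κ * pw f B (fun c => ∑ p ∈ c, g p) ≤ 1/4 * PB := by
      calc _ ≤ 1/κ * (κ/4 * PB) := by
            gcongr
            exact h6.trans (by gcongr)
        _ = _ := by field_simp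
    have h8 : 2 * ∏ p ∈ B \ W, (1 + f p) ≤ PB := by
      rw [hPB, ← prod_sdiff hW, mul_comm]
      have a1 := prod_one_add_pos f hf (B \ W)
      have a2 : 1 + ∑ p ∈ W, f p ≤ ∏ p ∈ W, (1 + f p) := by
        exact one_add_sum_le f hf W
      gcongr
      linarith
    linarith
  have h9 : Real.exp (-∑ p ∈ Gp, f p) * ∏ p ∈ Q \ B, (1 + f p) ≤ ∏ p ∈ (Q \ B) \ Gp, (1 + f p) := by
    rw [← prod_sdiff hGQ, Real.exp_neg, ← div_eq_inv_mul, div_le_iff₀ (Real.exp_pos _)]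
    have a1 := prod_one_add_pos f hf ((Q \ B) \ Gp)
    gcongr
    rw [Real.exp_sum]
    refine prod_le_prod (fun p _ => by have := hf p; linarith) fun p _ => ?_
    rw [add_comm]; exact Real.add_one_le_exp _
  rw [← prod_sdiff hB]
  have a1 := prod_one_add_pos f hf (Q \ B)
  calc _ = (1/4 * PB) * (Real.exp (-∑ p ∈ Gp, f p) * ∏ p ∈ Q \ B, (1 + f p)) := by ring
    _ ≤ _ := by
      apply mul_le_mul h1 h9 (by positivity) (le_trans (by positivity) h1)

lemma pw_disj {ι : Type*} (f : α → ℝ) (Q : Finset α) (K : Finset ι) (E : ι → Finset α → Prop)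
    [∀ k, DecidablePred (E k)] (e : ℝ) (P : ℝ) (hP : P = ∏ p ∈ Q, (1 + f p)) (hf : ∀ p, 0 ≤ f p)
    (hE : ∀ k ∈ K, e * P ≤ pw f Q (fun a => if E k a then 1 else 0))
    (hd : ∀ a, ∀ k ∈ K, ∀ k' ∈ K, E k a → E k' a → k = k') (F : Finset α → Prop) [DecidablePred F]
    (hF : ∀ a ⊆ Q, F a → ∀ k ∈ K, ¬ E k a) :
    pw f Q (fun a => if F a then 1 else 0) ≤ Real.exp (-(K.card * e)) * P := by
  have h1 : pw f Q (fun a => if F a then 1 else 0) + ∑ k ∈ K, pw f Q (fun a => if E k a then 1 else 0) ≤ P := by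
    rw [hP, ← pw_one]
    unfold pw
    rw [sum_comm, ← sum_add_distrib]
    refine sum_le_sum fun a ha => ?_
    rw [← mul_sum, ← mul_add]
    refine mul_le_mul_of_nonneg_left ?_ (prod_nonneg fun p _ => hf p)
    beta_reduce
    by_cases hFa : F a
    · rw [if_pos hFa, sum_eq_zero fun k hk => if_neg (hF a (mem_powerset.1 ha) hFa k hk)]; norm_num
    · rw [if_neg hFa, zero_add, ← sum_filter, sum_const, nsmul_eq_mul, mul_one]
      have : (K.filter (fun k => E k a)).card ≤ 1 := by
        rw [card_le_one]
        intro k hk k' hk'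
        rw [mem_filter] at hk hk'
        exact hd a k hk.1 k' hk'.1 hk.2 hk'.2
      exact_mod_cast this
  have h2 : K.card * (e * P) ≤ ∑ k ∈ K, pw f Q (fun a => if E k a then 1 else 0) := by
    rw [← nsmul_eq_mul]; exact card_nsmul_le_sum _ _ _ hE
  have h3 : 1 ≤ P := hP ▸ prod_one_add_pos f hf Q
  have h4 := Real.add_one_le_exp (-(K.card * e))
  nlinarith
end pwl
end PNN

namespace PNN
open Finset Filter

/-- gap event at `u` inside the block starting at `U` -/
def EvU (U u G h κ : ℝ) (b : Finset ℕ) : Prop :=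
  (∃ p ∈ b, u - h < lam p ∧ lam p ≤ u) ∧ (∀ p ∈ b, u < lam p → u + G < lam p) ∧
    ∑ p ∈ b.filter (fun p => U < lam p ∧ lam p ≤ u), Real.log p ≤ κ * Real.exp u

/-- restricted version, only looking inside the window -/
def EvW (U u G h κ : ℝ) (b : Finset ℕ) : Prop :=
  (∃ p ∈ b, u - h < lam p ∧ lam p ≤ u) ∧ (∀ p ∈ b, ¬ (u < lam p ∧ lam p ≤ u + G)) ∧
    ∑ p ∈ b.filter (fun p => U < lam p ∧ lam p ≤ u), Real.log p ≤ κ * Real.exp u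

lemma EvW_imp {U u G h κ : ℝ} {b : Finset ℕ} (hE : EvW U u G h κ b) : EvU U u G h κ b :=
  ⟨hE.1, fun p hp hu => by by_contra hc; exact hE.2.1 p hp ⟨hu, not_lt.1 hc⟩, hE.2.2⟩

lemma EvW_restrict {U V u G h κ : ℝ} {b : Finset ℕ} (hb : ∀ p ∈ b, PPr p) (h1 : U ≤ u - h) (h2 : u + G ≤ V)
    (h3 : 0 ≤ G) : EvW U u G h κ (b ∩ Win U V) ↔ EvW U u G h κ b := by
  unfold EvW
  have e : (b ∩ Win U V).filter (fun p => U < lam p ∧ lam p ≤ u) = b.filter (fun p => U < lam p ∧ lam p ≤ u) := by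
    ext p; simp only [mem_filter, mem_inter, mem_Win]
    exact ⟨fun h => ⟨h.1.1, h.2⟩, fun h => ⟨⟨h.1, hb p h.1, h.2.1, by linarith [h.2.2]⟩, h.2⟩⟩
  rw [e]
  constructor
  · rintro ⟨⟨p, hp, hp2⟩, h5, h6⟩
    refine ⟨⟨p, (mem_inter.1 hp).1, hp2⟩, fun p hp hp2 => ?_, h6⟩
    by_cases hU : U < lam p
    · exact h5 p (mem_inter.2 ⟨hp, mem_Win.2 ⟨hb p hp, hU, by linarith [hp2.2]⟩⟩) hp2
    · have : 0 ≤ h ∨ h < 0 := le_or_gt 0 h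
      rcases this with h0 | h0
      · linarith [hp2.1]
      · obtain ⟨q, hq, hq2⟩ := (⟨p, hp, hp2⟩ : ∃ q ∈ b, u < lam q ∧ lam q ≤ u + G)
        rename_i q0 hq0
        linarith [hp2.1]
  · rintro ⟨⟨p, hp, hp2⟩, h5, h6⟩
    exact ⟨⟨p, mem_inter.2 ⟨hp, mem_Win.2 ⟨hb p hp, by linarith [hp2.1], by linarith [hp2.2]⟩⟩, hp2⟩,
      fun p hp => h5 p (mem_inter.1 hp).1, h6⟩

open Classical in
lemma block_fail : ∃ M Cs : ℝ, 1 ≤ M ∧ 1 ≤ Cs ∧ ∀ ρ : ℝ, 1/2 ≤ ρ → ρ ≤ 2 → ∀ U G : ℝ, 0 ≤ U → 0 ≤ G →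
    ∀ K : ℕ, (K:ℝ) * (2*M+4) ≤ G →
    pw (fun p : ℕ => ρ * ((1:ℝ)/p)) (Win U (U + 3*G)) (fun b => if (∀ k ∈ Icc 1 K,
      ¬ EvW U (U + G + k * (2*M+4)) G (2*M+4) (8*Cs) b) then 1 else 0) ≤
    Real.exp (-((K:ℝ) * (1/4 * Real.exp (-(ρ * (G/2 + M)))))) * ∏ p ∈ Win U (U + 3*G), (1 + ρ * ((1:ℝ)/p)) := by
  obtain ⟨M, hM, hmw⟩ := mertens_window
  obtain ⟨Cs, hCs, hsl⟩ := sum_log_div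
  refine ⟨M, Cs, hM, hCs, fun ρ h1 h2 U G hU hG K hK => ?_⟩
  set h := 2*M+4 with hh
  have hh0 : 0 < h := by linarith
  set f : ℕ → ℝ := fun p => ρ * ((1:ℝ)/p) with hf
  have hf0 : ∀ p, 0 ≤ f p := fun p => by positivity
  set Q := Win U (U+3*G) with hQ
  have key := pw_disj f Q (Icc 1 K) (fun k => EvW U (U + G + k * h) G h (8*Cs))
    (1/4 * Real.exp (-(ρ * (G/2 + M)))) _ rfl hf0 ?_ ?_
    (fun b => ∀ k ∈ Icc 1 K, ¬ EvW U (U + G + k * h) G h (8*Cs) b) (fun a _ ha => ha)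
  · rw [Nat.card_Icc, Nat.add_sub_cancel] at key
    exact key
  · intro k hk
    rw [mem_Icc] at hk
    have hk1 : (1:ℝ) ≤ k := by exact_mod_cast hk.1
    have hkK : (k:ℝ) ≤ K := by exact_mod_cast hk.2
    have hkh : h ≤ k * h := by nlinarith
    have hkh2 : k * h ≤ G := le_trans (by gcongr) hK
    set u := U + G + k * h with hu
    have hw1 := hmw (u - h) u (by linarith) (by linarith) (Win (u-h) u) (fun p => mem_Win)
    have hw2 := hmw u (u+G) (by linarith) (by linarith) (Win u (u+G)) (fun p => mem_Win)
    rw [abs_le] at hw1 hw2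
    have hexp := Real.exp_pos u
    refine le_trans ?_ (pw_event f hf0 Q (Win U u) (Win (u-h) u) (Win u (u+G)) ?_ ?_ ?_ ?_
      (fun p => Real.log p) (fun p => Real.log_natCast_nonneg p) (8*Cs*Real.exp u) (by positivity) ?_ ?_ _ ?_)
    · have : 1 ≤ ∏ p ∈ Q, (1 + f p) := prod_one_add_pos f hf0 Q
      gcongr
      rw [hf, ← mul_sum]
      gcongr
      linarith [hw2.2]
    · intro p hp; rw [mem_Win] at hp; rw [hQ, mem_Win]; exact ⟨hp.1, hp.2.1, by linarith [hp.2.2]⟩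
    · intro p hp; rw [mem_Win] at hp ⊢; exact ⟨hp.1, by linarith [hp.2.1], hp.2.2⟩
    · intro p hp; rw [mem_Win] at hp; rw [hQ, mem_Win]; exact ⟨hp.1, by linarith [hp.2.1], by linarith [hp.2.2]⟩
    · rw [disjoint_left]; intro p hp hp2; rw [mem_Win] at hp hp2; linarith [hp.2.2, hp2.2.1]
    · rw [hf, ← mul_sum]
      have : 2 ≤ ∑ p ∈ Win (u-h) u, (1:ℝ)/p := by linarith [hw1.1]
      nlinarith
    · have := hsl u (by linarith) (Win U u) (fun p hp => by
        rw [mem_Win] at hp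
        refine ⟨hp.1, ?_⟩
        rw [← exp_lam hp.1]; exact Real.exp_le_exp.2 hp.2.2)
      calc ∑ p ∈ Win U u, Real.log p * f p = ρ * ∑ p ∈ Win U u, Real.log p / p := by
            rw [mul_sum]; refine sum_congr rfl fun p _ => ?_
            rw [hf]; ring
        _ ≤ 2 * (Cs * Real.exp u) := by
            apply mul_le_mul h2 this _ (by norm_num)
            exact sum_nonneg fun p _ => div_nonneg (Real.log_natCast_nonneg p) (by positivity)
        _ = _ := by ring
    · intro a ha
      have haP : ∀ p ∈ a, PPr p := fun p hp => (mem_Win.1 (ha hp)).1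
      unfold EvW
      refine and_congr ?_ (and_congr ?_ ?_)
      · constructor
        · rintro ⟨p, hp, hp2⟩; exact ⟨p, mem_inter.2 ⟨hp, mem_Win.2 ⟨haP p hp, hp2⟩⟩⟩
        · rintro ⟨p, hp⟩; exact ⟨p, (mem_inter.1 hp).1, (mem_Win.1 (mem_inter.1 hp).2).2⟩
      · rw [eq_empty_iff_forall_notMem]
        constructor
        · intro h3 p hp; exact h3 p (mem_inter.1 hp).1 (mem_Win.1 (mem_inter.1 hp).2).2
        · intro h3 p hp hp2; exact h3 p (mem_inter.2 ⟨hp, mem_Win.2 ⟨haP p hp, hp2⟩⟩)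
      · have : a.filter (fun p => U < lam p ∧ lam p ≤ u) = a ∩ Win U u := by
          ext p; rw [mem_filter, mem_inter, mem_Win]
          exact ⟨fun h => ⟨h.1, haP p h.1, h.2⟩, fun h => ⟨h.1, h.2.2⟩⟩
        rw [this]
  · have aux : ∀ (a : Finset ℕ) (k k' : ℕ), k ∈ Icc 1 K → k' ∈ Icc 1 K → EvW U (U + G + k * h) G h (8*Cs) a →
        EvW U (U + G + k' * h) G h (8*Cs) a → ¬ k < k' := by
      intro a k k' hk hk' hE hE' hlt
      obtain ⟨p, hp, hp2⟩ := hE'.1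
      have h3 : (k:ℝ) + 1 ≤ k' := by exact_mod_cast hlt
      have h4 : (k:ℝ) * h + h ≤ k' * h := by nlinarith
      have h5 : (k':ℝ) ≤ K := by exact_mod_cast (mem_Icc.1 hk').2
      have h6 : (k':ℝ) * h ≤ G := le_trans (by gcongr) hK
      have h7 : (0:ℝ) ≤ k * h := by positivity
      exact hE.2.1 p hp ⟨by linarith [hp2.1], by linarith [hp2.2]⟩
    intro a k hk k' hk' hE hE'
    rcases lt_trichotomy k k' with h3 | h3 | h3
    · exact absurd h3 (aux a k k' hk hk' hE hE')
    · exact h3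
    · exact absurd h3 (aux a k' k hk' hk hE' hE)

lemma levels_exist : ∀ᶠ x : ℝ in atTop, ∃ Ls : Finset ℕ, Real.log x / 4 ≤ Ls.card ∧
    ∀ l ∈ Ls, 4 * √x ≤ (2:ℝ)^l ∧ (2:ℝ)^l ≤ x/16 := by
  filter_upwards [Real.tendsto_log_atTop.eventually_ge_atTop 40, eventually_ge_atTop 16] with x hx hx16
  set a := ⌈Real.logb 2 (4 * √x)⌉₊ with ha
  set b := ⌊Real.logb 2 (x/16)⌋₊ with hb
  have hx0 : 0 < x := by linarith
  have hs : 0 < √x := by positivity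
  have hl2 := Real.log_two_gt_d9
  have hl2' := Real.log_two_lt_d9
  have hl4 : Real.log 4 = 2 * Real.log 2 := by
    rw [show (4:ℝ) = 2^2 by norm_num, Real.log_pow]; norm_num
  have hl16 : Real.log 16 = 4 * Real.log 2 := by
    rw [show (16:ℝ) = 2^4 by norm_num, Real.log_pow]; norm_num
  have e1 : Real.logb 2 (4*√x) = 2 + Real.log x / (2 * Real.log 2) := by
    unfold Real.logb
    rw [Real.log_mul (by norm_num) hs.ne', Real.log_sqrt hx0.le, hl4]; field_simp
  have e2 : Real.logb 2 (x/16) = Real.log x / Real.log 2 - 4 := by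
    unfold Real.logb
    rw [Real.log_div hx0.ne' (by norm_num), hl16]; field_simp
  refine ⟨Icc a b, ?_, ?_⟩
  · rw [Nat.card_Icc]
    have h1 : (a:ℝ) < Real.logb 2 (4*√x) + 1 := Nat.ceil_lt_add_one (by rw [e1]; positivity)
    have h2 : Real.logb 2 (x/16) < b + 1 := Nat.lt_floor_add_one _
    have h3 : Real.log x / Real.log 2 = 2 * (Real.log x / (2 * Real.log 2)) := by field_simp
    have h4 : Real.log x / 4 + 7 ≤ Real.log x / (2 * Real.log 2) := by
      rw [le_div_iff₀ (by positivity)]; nlinarith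
    have h5 : (b:ℝ) + 1 ≤ ((b + 1 - a : ℕ):ℝ) + a := by
      exact_mod_cast (by omega : b + 1 ≤ b + 1 - a + a)
    rw [e1] at h1; rw [e2, h3] at h2
    linarith
  · intro l hl
    rw [mem_Icc] at hl
    have h1 : Real.logb 2 (4*√x) ≤ l := (Nat.le_ceil _).trans (by exact_mod_cast hl.1)
    have h2 : (l:ℝ) ≤ Real.logb 2 (x/16) := by
      have : (b:ℝ) ≤ Real.logb 2 (x/16) := Nat.floor_le (Real.logb_nonneg (by norm_num) (by linarith))
      exact le_trans (by exact_mod_cast hl.2) this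
    rw [Real.logb_le_iff_le_rpow (by norm_num) (by positivity), Real.rpow_natCast] at h1
    rw [Real.le_logb_iff_rpow_le (by norm_num) (by positivity), Real.rpow_natCast] at h2
    exact ⟨h1, h2⟩

end PNN

namespace PNN
open Finset Filter

/-- block length parameter at level `l` -/
noncomputable def GG (A x : ℝ) (l : ℕ) : ℝ := Real.log (A * 4^l * Real.log x)

/-- all gap events fail -/
def Bad3 (h κ A x : ℝ) (R : ℕ) (t : Finset ℕ) : Prop :=
  2 * cnt t (x/8) ≤ R ∧ ∀ l : ℕ, 4 * √x ≤ (2:ℝ)^l → (2:ℝ)^l ≤ x/16 → ∀ j : ℕ,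
    3 * GG A x l * (j+1) ≤ (2:ℝ)^l → ∀ k : ℕ, 1 ≤ k → k * h ≤ GG A x l →
    ¬ EvW (2^l + 3 * GG A x l * j) (2^l + 3 * GG A x l * j + GG A x l + k * h) (GG A x l) h κ t

/-- range of x for the level estimates -/
structure RegL (A h x : ℝ) : Prop where
  lx : 1 ≤ Real.log x
  x1 : 1 ≤ x
  G1 : Real.log A + 3 * Real.log x ≤ 2/5 * x^((1:ℝ)/3)
  hx : Real.exp (2*h) ≤ x

lemma ev_RegL (A h : ℝ) : ∀ᶠ x in atTop, RegL A h x := by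
  filter_upwards [Real.tendsto_log_atTop.eventually_ge_atTop 1, eventually_ge_atTop 1,
    eventually_ge_atTop (Real.exp (2*h)), ev_log (1/3) (1/30) (by norm_num) (by norm_num),
    Real.tendsto_log_atTop.eventually_ge_atTop (Real.log A)] with x h1 h2 h3 h4 h5
  refine ⟨h1, h2, ?_, h3⟩
  have : 0 ≤ x^((1:ℝ)/3) := by positivity
  linarith

lemma G_bounds {A h x : ℝ} (hA : 1 ≤ A) (hR : RegL A h x) {l : ℕ} (h1 : 4 * √x ≤ (2:ℝ)^l) (h2 : (2:ℝ)^l ≤ x/16) :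
    2 * h ≤ GG A x l ∧ 6 * GG A x l ≤ 2^l ∧ 5 * x^(-(1:ℝ)/3) * GG A x l ≤ 2 ∧ 0 < GG A x l ∧
      Real.exp (GG A x l) = A * (2^l)^2 * Real.log x := by
  have hx0 : 0 < x := by linarith [hR.x1]
  have hl := hR.lx
  have e4 : (4:ℝ)^l = (2^l)^2 := by rw [← pow_mul, mul_comm, pow_mul]; norm_num
  have hs : √x * √x = x := Real.mul_self_sqrt hx0.le
  have hs0 := Real.sqrt_nonneg x
  have b1 : 16 * x ≤ ((2:ℝ)^l)^2 := by nlinarith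
  have b2 : ((2:ℝ)^l)^2 ≤ x^2 := by
    have : (0:ℝ) ≤ 2^l := by positivity
    gcongr; linarith
  have hpos : 0 < A * (2^l)^2 * Real.log x := by positivity
  have c1 : 16 * x ≤ A * (2^l)^2 * Real.log x := by
    have a1 : 16 * x ≤ A * ((2:ℝ)^l)^2 := by nlinarith
    nlinarith
  have G0 : GG A x l = Real.log (A * (2^l)^2 * Real.log x) := by unfold GG; rw [e4]
  have g1 : 2*h ≤ GG A x l := by
    rw [G0, Real.le_log_iff_exp_le hpos]; linarith [hR.hx]
  have g2 : GG A x l ≤ 2/5 * x^((1:ℝ)/3) := by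
    refine le_trans ?_ hR.G1
    rw [G0]
    have hlx : Real.log x ≤ x := (Real.log_le_sub_one_of_pos hx0).trans (by linarith)
    calc _ ≤ Real.log (A * x^2 * x) := by
          apply Real.log_le_log hpos; gcongr
      _ = _ := by
          rw [mul_assoc, Real.log_mul (by positivity) (by positivity), ← pow_succ, Real.log_pow]; norm_num
  have g0 : 0 < GG A x l := by
    rw [G0]; apply Real.log_pos; linarith [hR.x1]
  refine ⟨g1, ?_, ?_, g0, ?_⟩
  · have : x^((1:ℝ)/3) ≤ √x := by
      rw [Real.sqrt_eq_rpow]; exact Real.rpow_le_rpow_of_exponent_le hR.x1 (by norm_num)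
    linarith
  · have e : x^(-(1:ℝ)/3) * x^((1:ℝ)/3) = 1 := by rw [← Real.rpow_add hx0]; norm_num
    have : 0 < x^(-(1:ℝ)/3) := by positivity
    calc _ ≤ 5 * x^(-(1:ℝ)/3) * (2/5 * x^((1:ℝ)/3)) := by gcongr
      _ = 2 * (x^(-(1:ℝ)/3) * x^((1:ℝ)/3)) := by ring
      _ = 2 := by rw [e]; norm_num
  · rw [G0, Real.exp_log hpos]

lemma level_sum {A h x M ρ : ℝ} (hA : 1 ≤ A) (hM : 0 ≤ M) (hh : 1 ≤ h) (hR : RegL A h x) (hρ0 : 0 ≤ ρ) (hρ2 : ρ ≤ 2)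
    (hρ : ρ ≤ 1 + 5 * x^(-(1:ℝ)/3)) {l : ℕ} (h1 : 4 * √x ≤ (2:ℝ)^l) (h2 : (2:ℝ)^l ≤ x/16) :
    Real.exp (-(1+2*M)) / (48 * h * √A) / √(Real.log x) ≤
      (⌊(2:ℝ)^l / (3 * GG A x l)⌋₊ : ℝ) * ((⌊GG A x l / h⌋₊ : ℝ) * (1/4 * Real.exp (-(ρ * (GG A x l/2 + M))))) := by
  obtain ⟨g1, g2, g3, g0, g4⟩ := G_bounds hA hR h1 h2
  set G := GG A x l
  set V := (2:ℝ)^l with hV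
  have hV0 : 0 < V := by positivity
  have hl : 0 < Real.log x := by linarith [hR.lx]
  have a1 : V / (6 * G) ≤ (⌊V / (3 * G)⌋₊ : ℝ) := by
    have := Nat.lt_floor_add_one (V / (3*G))
    have e : V / (3 * G) = 2 * (V / (6*G)) := by field_simp; norm_num
    have : 1 ≤ V / (6*G) := by rw [le_div_iff₀ (by positivity)]; linarith
    linarith
  have a2 : G / (2*h) ≤ (⌊G / h⌋₊ : ℝ) := by
    have := Nat.lt_floor_add_one (G / h)
    have e : G / h = 2 * (G / (2*h)) := by field_simp
    have : 1 ≤ G / (2*h) := by rw [le_div_iff₀ (by positivity)]; linarith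
    linarith
  have a3 : Real.exp (-(1+2*M)) * Real.exp (-(G/2)) ≤ Real.exp (-(ρ * (G/2+M))) := by
    rw [← Real.exp_add]; apply Real.exp_le_exp.2
    have b1 : ρ * (G/2) ≤ (1 + 5 * x^(-(1:ℝ)/3)) * (G/2) := by gcongr
    have b2 : ρ * M ≤ 2 * M := by gcongr
    nlinarith
  have a4 : Real.exp (-(G/2)) = 1 / (√A * V * √(Real.log x)) := by
    rw [Real.exp_neg, Real.exp_half, g4, Real.sqrt_mul (by positivity), Real.sqrt_mul (by positivity),
      Real.sqrt_sq hV0.le, one_div]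
  rw [a4] at a3
  calc _ = V / (6*G) * (G/(2*h) * (1/4 * (Real.exp (-(1+2*M)) * (1 / (√A * V * √(Real.log x)))))) := by
        field_simp; norm_num
    _ ≤ _ := by gcongr

open Classical in
set_option maxHeartbeats 1000000 in
lemma bad3_weight : ∃ h κ : ℝ, 1 ≤ h ∧ 1 ≤ κ ∧ ∀ A : ℝ, 1 ≤ A → ∃ c : ℝ, 0 < c ∧ ∀ᶠ N in atTop, ∀ R : ℕ, Reg N R →
    ∀ T ⊆ powersetCard R (PN N), (∀ t ∈ T, Bad3 h κ A (xx N) R t) →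
    ∑ t ∈ T, w t ≤ 4 * Real.exp (-(c * CC N)) * (SS N ^ R / R.factorial) := by
  obtain ⟨M, Cs, hM, hCs, hblock⟩ := block_fail
  refine ⟨2*M+4, 8*Cs, by linarith, by linarith, fun A hA => ?_⟩
  set h := 2*M+4 with hh
  set κ := 8*Cs with hκ
  have hh1 : 1 ≤ h := by linarith
  set c1 := Real.exp (-(1+2*M)) / (48 * h * √A) with hc1
  have hc10 : 0 < c1 := by have : 0 < √A := by positivity
                           positivity
  refine ⟨c1/4, by positivity, ?_⟩
  filter_upwards [tendsto_xx.eventually (ev_RegL A h), tendsto_xx.eventually levels_exist, ev_RegC] with N hL hlev hc R hReg T hT hbad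
  obtain ⟨Ls, hLs, hLs2⟩ := hlev
  set x := xx N with hx
  have hx16 := hReg.hx
  have hrho := hReg.rho
  rw [abs_le] at hrho
  set ρ := (R:ℝ) / SS N with hρ
  have hdel : 5 * x^(-(1:ℝ)/3) ≤ 1/2 := by
    have h1 := hc.del
    have h2 : x^(-(1:ℝ)/5) ≤ 1 := Real.rpow_le_one_of_one_le_of_nonpos hc.x1 (by norm_num)
    linarith
  have hρ1 : 1/2 ≤ ρ := by linarith [hrho.1]
  have hρ2 : ρ ≤ 2 := by linarith [hrho.2]
  set G := GG A x with hG
  set m : ℕ → ℕ := fun l => ⌊(2:ℝ)^l / (3 * G l)⌋₊ with hm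
  set Kf : ℕ → ℕ := fun l => ⌊G l / h⌋₊ with hKf
  set J : Finset (Σ _ : ℕ, ℕ) := Ls.sigma (fun l => range (m l)) with hJ
  set Ub : (Σ _ : ℕ, ℕ) → ℝ := fun s => 2^s.1 + 3 * G s.1 * s.2 with hUb
  set Qb : (Σ _ : ℕ, ℕ) → Finset ℕ := fun s => Win (Ub s) (Ub s + 3 * G s.1) with hQb
  set φb : (Σ _ : ℕ, ℕ) → Finset ℕ → ℝ := fun s b => if (∀ k ∈ Icc 1 (Kf s.1),
      ¬ EvW (Ub s) (Ub s + G s.1 + k * h) (G s.1) h κ b) then 1 else 0 with hφb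
  set cb : (Σ _ : ℕ, ℕ) → ℝ := fun s => Real.exp (-((Kf s.1:ℝ) * (1/4 * Real.exp (-(ρ * (G s.1/2 + M)))))) with hcb
  set f : ℕ → ℝ := fun p => ρ * ((1:ℝ)/p) with hf
  have hf0 : ∀ p, 0 ≤ f p := fun p => by positivity
  set Q := Beg (x/8) with hQ
  have hQN : Q ⊆ PN N := Beg_sub hReg.N2 (by linarith)
  -- facts on J
  have hJf : ∀ s ∈ J, s.1 ∈ Ls ∧ 3 * G s.1 * (s.2 + 1) ≤ 2^s.1 ∧ 0 < G s.1 := by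
    intro s hs
    rw [hJ, mem_sigma, mem_range] at hs
    obtain ⟨g1, g2, g3, g0, g4⟩ := G_bounds hA hL (hLs2 s.1 hs.1).1 (hLs2 s.1 hs.1).2
    refine ⟨hs.1, ?_, g0⟩
    have h1 : (s.2:ℝ) + 1 ≤ (2:ℝ)^s.1 / (3 * G s.1) := by
      have h2 : ((s.2 + 1 : ℕ):ℝ) ≤ m s.1 := by exact_mod_cast hs.2
      have h3 : (m s.1 : ℝ) ≤ (2:ℝ)^s.1 / (3 * G s.1) := Nat.floor_le (by
        have : 0 < G s.1 := g0
        positivity)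
      push_cast at h2; linarith
    rw [le_div_iff₀ (by have : 0 < G s.1 := g0
                        positivity)] at h1
    linarith
  have hUpos : ∀ s ∈ J, (2:ℝ)^s.1 ≤ Ub s ∧ Ub s + 3 * G s.1 ≤ 2^(s.1+1) := by
    intro s hs
    obtain ⟨a1, a2, a3⟩ := hJf s hs
    have e : Ub s = 2^s.1 + 3 * G s.1 * s.2 := rfl
    have : 0 ≤ 3 * G s.1 * s.2 := by positivity
    rw [pow_succ]
    constructor
    · linarith
    · rw [e]; linarith
  have hblk : ∀ s ∈ J, pw f (Qb s) (φb s) ≤ cb s * ∏ p ∈ Qb s, (1 + f p) := by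
    intro s hs
    obtain ⟨a1, a2, a3⟩ := hJf s hs
    have hU := (hUpos s hs).1
    have h2 : (0:ℝ) ≤ 2^s.1 := by positivity
    refine hblock ρ hρ1 hρ2 (Ub s) (G s.1) (by linarith) a3.le (Kf s.1) ?_
    have : (Kf s.1 : ℝ) ≤ G s.1 / h := Nat.floor_le (by positivity)
    rwa [le_div_iff₀ (by linarith)] at this
  have hdisj : ∀ s ∈ J, ∀ s' ∈ J, s ≠ s' → Disjoint (Qb s) (Qb s') := by
    have aux : ∀ s ∈ J, ∀ s' ∈ J, (s.1 < s'.1 ∨ (s.1 = s'.1 ∧ s.2 < s'.2)) → Disjoint (Qb s) (Qb s') := by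
      intro s hs s' hs' hlt
      have h1 : Ub s + 3 * G s.1 ≤ Ub s' := by
        rcases hlt with h2 | ⟨h2, h3⟩
        · have h4 : (2:ℝ)^(s.1+1) ≤ 2^s'.1 := pow_le_pow_right₀ (by norm_num) h2
          linarith [(hUpos s hs).2, (hUpos s' hs').1]
        · have h4 : (s.2:ℝ) + 1 ≤ s'.2 := by exact_mod_cast h3
          show 2^s.1 + 3 * G s.1 * s.2 + 3 * G s.1 ≤ 2^s'.1 + 3 * G s'.1 * s'.2
          rw [← h2]
          have := (hJf s hs).2.2
          nlinarith
      rw [disjoint_left]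
      intro p hp hp'
      have := (mem_Win.1 hp).2.2
      have := (mem_Win.1 hp').2.1
      linarith
    intro s hs s' hs' hne
    rcases lt_trichotomy s.1 s'.1 with h1 | h1 | h1
    · exact aux s hs s' hs' (Or.inl h1)
    · rcases lt_trichotomy s.2 s'.2 with h2 | h2 | h2
      · exact aux s hs s' hs' (Or.inr ⟨h1, h2⟩)
      · exact absurd (Sigma.ext h1 (heq_of_eq h2)) hne
      · exact (aux s' hs' s hs (Or.inr ⟨h1.symm, h2⟩)).symm
    · exact (aux s' hs' s hs (Or.inl h1)).symm
  have hQbQ : ∀ s ∈ J, Qb s ⊆ Q := by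
    intro s hs p hp
    have h1 := mem_Win.1 hp
    rw [hQ, mem_Beg]
    refine ⟨h1.1, ?_⟩
    have h2 := (hUpos s hs).2
    have h3 := (hLs2 s.1 (hJf s hs).1).2
    rw [pow_succ] at h2
    linarith [h1.2.2]
  have hφ0 : ∀ s b, 0 ≤ φb s b := fun s b => by
    show 0 ≤ ite _ _ _
    split_ifs <;> norm_num
  have hpw := blocks_bound f J Qb φb cb (fun s _ b => hφ0 s b) Q (fun p _ => hf0 p) hQbQ hdisj
    (fun s _ => (Real.exp_pos _).le) hblk
  set φ : Finset ℕ → ℝ := fun b => if 2 * b.card ≤ R then ∏ s ∈ J, φb s (b ∩ Qb s) else 0 with hφ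
  have hφnn : ∀ b, 0 ≤ φ b := fun b => by
    show 0 ≤ ite _ _ _
    split_ifs
    · exact prod_nonneg fun s _ => hφ0 _ _
    · exact le_rfl
  have htr := transfer hReg Q hQN φ hφnn (fun b hb => by
      by_contra hc; exact hb (if_neg hc)) (∏ s ∈ J, cb s) (prod_nonneg fun s _ => (Real.exp_pos _).le) (by
      refine le_trans ?_ hpw
      apply pw_mono (fun p _ => hf0 p)
      intro b _
      show ite _ _ _ ≤ _
      split_ifs
      · exact le_rfl
      · exact prod_nonneg fun s _ => hφ0 _ _)
  have hTsum : ∑ t ∈ T, w t ≤ ∑ t ∈ powersetCard R (PN N), w t * φ (t ∩ Q) := by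
    calc ∑ t ∈ T, w t = ∑ t ∈ T, w t * φ (t ∩ Q) := by
          refine sum_congr rfl fun t ht => ?_
          have htP := (mem_powersetCard.1 (hT ht)).1
          obtain ⟨b1, b2⟩ := hbad t ht
          have hφ1 : φ (t ∩ Q) = 1 := by
            show ite _ _ _ = _
            rw [if_pos (by rw [← cnt_eq htP]; exact b1)]
            refine prod_eq_one fun s hs => ?_
            show ite _ _ _ = _
            rw [if_pos]
            intro k hk
            rw [mem_Icc] at hk
            obtain ⟨a1, a2, a3⟩ := hJf s hs
            have hk1 : (1:ℝ) ≤ k := by exact_mod_cast hk.1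
            have hkG : k * h ≤ G s.1 := by
              have h1 : (k:ℝ) ≤ Kf s.1 := by exact_mod_cast hk.2
              have h2 : (Kf s.1 : ℝ) ≤ G s.1 / h := Nat.floor_le (by positivity)
              rw [le_div_iff₀ (by linarith)] at h2
              exact le_trans (by gcongr) h2
            have hkh : h ≤ k * h := by nlinarith
            have e : t ∩ Q ∩ Qb s = t ∩ Qb s := by
              rw [inter_assoc, inter_eq_right.2 (hQbQ s hs)]
            rw [e]
            have := EvW_restrict (U := Ub s) (V := Ub s + 3 * G s.1) (u := Ub s + G s.1 + k * h) (G := G s.1) (h := h) (κ := κ)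
              (b := t) (fun p hp => (mem_PN.1 (htP hp)).2) (by linarith) (by linarith) a3.le
            rw [this]
            exact b2 s.1 (hLs2 s.1 a1).1 (hLs2 s.1 a1).2 s.2 a2 k hk.1 hkG
          rw [hφ1, mul_one]
      _ ≤ _ := sum_le_sum_of_subset_of_nonneg hT fun t _ _ => mul_nonneg (w_nonneg t) (hφnn _)
  refine hTsum.trans (htr.trans ?_)
  have hS := hReg.Spos
  gcongr
  rw [hcb, ← Real.exp_sum]
  apply Real.exp_le_exp.2
  rw [sum_neg_distrib, neg_le_neg_iff, hJ, sum_sigma]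
  have hCC : CC N = √(Real.log x) := rfl
  have hlx : 0 < Real.log x := by linarith [hL.lx]
  calc c1/4 * CC N = (Real.log x / 4) * (c1 / √(Real.log x)) := by
        rw [hCC]
        have : √(Real.log x) * √(Real.log x) = Real.log x := Real.mul_self_sqrt hlx.le
        have h0 : 0 < √(Real.log x) := by positivity
        rw [div_mul_div_comm, eq_div_iff (by positivity)]
        calc _ = c1 * (√(Real.log x) * √(Real.log x)) := by ring
          _ = _ := by rw [this]; ring
    _ ≤ Ls.card * (c1 / √(Real.log x)) := by gcongr
    _ ≤ _ := by
        rw [← nsmul_eq_mul]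
        refine card_nsmul_le_sum _ _ _ fun l hl => ?_
        dsimp only
        rw [sum_const, card_range, nsmul_eq_mul]
        exact level_sum hA (by linarith) hh1 hL (by linarith) hρ2 (by linarith [hrho.2]) (hLs2 l hl).1 (hLs2 l hl).2

end PNN

namespace PNN
open Finset Filter

/-- k-th smallest element of a finset (0-indexed) -/
noncomputable def gl (t : Finset ℕ) (k : ℕ) : ℕ := (t.sort (· ≤ ·)).getD k 0

lemma gl_mono {t : Finset ℕ} {j k : ℕ} (hjk : j < k) (hk : k < t.card) : gl t j < gl t k := by
  have hl : (t.sort (· ≤ ·)).length = t.card := Finset.length_sort _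
  have hs := Finset.sortedLT_sort t
  unfold gl
  rw [List.getD_eq_getElem _ _ (by omega), List.getD_eq_getElem _ _ (by omega)]
  exact hs.strictMono_get (a := ⟨j, by omega⟩) (b := ⟨k, by omega⟩) hjk

lemma gl_mem {t : Finset ℕ} {k : ℕ} (hk : k < t.card) : gl t k ∈ t := by
  have hl : (t.sort (· ≤ ·)).length = t.card := Finset.length_sort _
  unfold gl
  rw [List.getD_eq_getElem _ _ (by omega), ← Finset.mem_sort (· ≤ ·)]
  exact List.getElem_mem _

lemma gl_surj {t : Finset ℕ} {p : ℕ} (hp : p ∈ t) : ∃ k < t.card, gl t k = p := by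
  have hl : (t.sort (· ≤ ·)).length = t.card := Finset.length_sort _
  rw [← Finset.mem_sort (· ≤ ·)] at hp
  obtain ⟨k, hk, e⟩ := List.getElem_of_mem hp
  refine ⟨k, by omega, ?_⟩
  unfold gl
  rw [List.getD_eq_getElem _ _ (by omega), e]

lemma gl_inj {t : Finset ℕ} {k : ℕ} (hk : k ≤ t.card) : Set.InjOn (gl t) (range k : Finset ℕ) := by
  intro a ha b hb e
  simp only [coe_range, Set.mem_Iio] at ha hb
  rcases lt_trichotomy a b with h | h | h
  · have := gl_mono (t := t) h (by omega); omega
  · exact h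
  · have := gl_mono (t := t) h (by omega); omega

lemma filter_lt_gl {t : Finset ℕ} {k : ℕ} (hk : k < t.card) :
    t.filter (fun p => p < gl t k) = (range k).image (gl t) := by
  ext p
  simp only [mem_filter, mem_image, mem_range]
  constructor
  · rintro ⟨hp, hlt⟩
    obtain ⟨j, hj, rfl⟩ := gl_surj hp
    refine ⟨j, ?_, rfl⟩
    by_contra hc
    rcases eq_or_lt_of_le (not_lt.1 hc) with h | h
    · subst h; omega
    · have := gl_mono h hj; omega
  · rintro ⟨j, hj, rfl⟩
    exact ⟨gl_mem (by omega), gl_mono hj hk⟩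

lemma lam_mono {p q : ℕ} (hp : PPr p) (h : p ≤ q) : lam p ≤ lam q := by
  unfold lam
  apply Real.log_le_log (log_pos_of_PPr hp)
  apply Real.log_le_log (by exact_mod_cast hp.1.pos)
  exact_mod_cast h

lemma le_cnt_of {t : Finset ℕ} (ht : ∀ p ∈ t, PPr p) {k : ℕ} {v : ℝ} (hk : k < t.card) (h : lam (gl t k) ≤ v) :
    k + 1 ≤ cnt t v := by
  have : ((range (k+1)).image (gl t)) ⊆ t.filter (fun p => lam p ≤ v) := by
    intro p hp
    simp only [mem_image, mem_range] at hp
    obtain ⟨j, hj, rfl⟩ := hp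
    rw [mem_filter]
    have hm : gl t j ∈ t := gl_mem (by omega)
    refine ⟨hm, le_trans (lam_mono (ht _ hm) ?_) h⟩
    rcases eq_or_lt_of_le (Nat.lt_succ_iff.1 hj) with e | e
    · rw [e]
    · exact (gl_mono e hk).le
  have h2 := card_le_card this
  rw [card_image_of_injOn (gl_inj (by omega)), card_range] at h2
  exact h2

lemma cnt_filter_sub {t : Finset ℕ} (ht : ∀ p ∈ t, PPr p) {k : ℕ} {v : ℝ} (hk : k < t.card) (h : v < lam (gl t k)) :
    t.filter (fun p => lam p ≤ v) ⊆ t.filter (fun p => p < gl t k) := by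
  intro p hp
  rw [mem_filter] at hp ⊢
  refine ⟨hp.1, ?_⟩
  by_contra hc
  have := lam_mono (ht _ (gl_mem hk)) (not_lt.1 hc)
  linarith [hp.2]

lemma cnt_le_of {t : Finset ℕ} (ht : ∀ p ∈ t, PPr p) {k : ℕ} {v : ℝ} (hk : k < t.card) (h : v < lam (gl t k)) :
    cnt t v ≤ k := by
  have h2 := card_le_card (cnt_filter_sub ht hk h)
  rw [filter_lt_gl hk, card_image_of_injOn (gl_inj hk.le), card_range] at h2
  exact h2

/-- failure of (ii) at one index gives Low or High -/
lemma bad2_of_fail {t : Finset ℕ} (ht : ∀ p ∈ t, PPr p) {C : ℝ} {i : ℕ} (h1 : 1 ≤ i) (hi : i ≤ t.card)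
    (h : ¬ |(1/2) * lam (gl t (i-1)) - i| < dev C i) : Low C i t ∨ High C i t := by
  rw [not_lt, le_abs] at h
  rcases h with h | h
  · right
    unfold High
    have := cnt_le_of (v := 2 * (i + dev C i) - 1) ht (show i - 1 < t.card by omega) (by linarith)
    omega
  · left
    unfold Low
    have := le_cnt_of (v := 2 * (i - dev C i)) ht (show i - 1 < t.card by omega) (by linarith)
    omega

lemma cnt_erase_le (t : Finset ℕ) (p : ℕ) (v : ℝ) : cnt (t.erase p) v ≤ cnt t v :=
  card_le_card (filter_subset_filter _ (erase_subset _ _))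

lemma cnt_erase_eq (t : Finset ℕ) {p : ℕ} {v : ℝ} (h : v < lam p) : cnt (t.erase p) v = cnt t v := by
  unfold cnt
  congr 1
  ext q
  simp only [mem_filter, mem_erase]
  constructor
  · rintro ⟨⟨a, b⟩, c⟩; exact ⟨b, c⟩
  · rintro ⟨b, c⟩
    refine ⟨⟨?_, b⟩, c⟩
    rintro rfl; linarith

lemma dev_pos {C : ℝ} (hC : 0 < C) (i : ℕ) : 0 < dev C i := by
  unfold dev
  have : 0 < max (i:ℝ) C := lt_of_lt_of_le hC (le_max_right _ _)
  positivity

lemma Bad2_erase {C x : ℝ} {R : ℕ} {t : Finset ℕ} {p : ℕ} (hC : 0 < C) (hR : 2/3 * (R:ℝ) ≤ x/2) (hp : x/2 < lam p)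
    (h : Bad2 C R t) : Bad2 C R (t.erase p) := by
  obtain ⟨i, h1, h2, h3⟩ := h
  refine ⟨i, h1, h2, ?_⟩
  rcases h3 with h3 | h3
  · left
    unfold Low at h3 ⊢
    rw [cnt_erase_eq]
    · exact h3
    · have : 3 * (i:ℝ) ≤ R := by exact_mod_cast h2
      have := dev_pos hC i
      linarith
  · right
    exact lt_of_le_of_lt (cnt_erase_le _ _ _) h3

lemma EvW_erase {U u G h κ : ℝ} {t : Finset ℕ} {p : ℕ} (hG : 0 ≤ G) (hp : u + G < lam p)
    (hE : EvW U u G h κ (t.erase p)) : EvW U u G h κ t := by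
  obtain ⟨⟨q, hq, hq2⟩, h2, h3⟩ := hE
  refine ⟨⟨q, mem_of_mem_erase hq, hq2⟩, ?_, ?_⟩
  · intro q hq hc
    by_cases e : q = p
    · subst e; linarith [hc.2]
    · exact h2 q (mem_erase.2 ⟨e, hq⟩) hc
  · convert h3 using 2
    ext q
    simp only [mem_filter, mem_erase]
    constructor
    · rintro ⟨b, c⟩
      refine ⟨⟨?_, b⟩, c⟩
      rintro rfl; linarith [c.2]
    · rintro ⟨⟨a, b⟩, c⟩; exact ⟨b, c⟩

lemma u_bound {G V h : ℝ} {j k : ℕ} (hj : 3 * G * (j+1) ≤ V) (hk : k * h ≤ G) :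
    V + 3 * G * j + G + k * h + G ≤ 2 * V := by nlinarith

lemma Bad3_erase {h κ A x : ℝ} {R : ℕ} {t : Finset ℕ} {p : ℕ} (hA : 1 ≤ A) (hL : RegL A h x) (hp : x/2 < lam p)
    (hB : Bad3 h κ A x R t) : Bad3 h κ A x R (t.erase p) := by
  obtain ⟨h1, h2⟩ := hB
  refine ⟨le_trans (Nat.mul_le_mul_left 2 (cnt_erase_le _ _ _)) h1, ?_⟩
  intro l hl1 hl2 j hj k hk1 hk2 hE
  obtain ⟨g1, g2, g3, g4, g5⟩ := G_bounds hA hL hl1 hl2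
  refine h2 l hl1 hl2 j hj k hk1 hk2 (EvW_erase g4.le ?_ hE)
  have := u_bound hj hk2
  have := hL.x1
  linarith

lemma sq_exp_mono {a b : ℝ} (ha : 2 ≤ a) (hab : a ≤ b) : b^2 * Real.exp a ≤ a^2 * Real.exp b := by
  have h1 : b / a ≤ Real.exp ((b-a)/2) := by
    refine le_trans ?_ (Real.add_one_le_exp _)
    rw [div_le_iff₀ (by linarith)]
    nlinarith
  have h2 : b ≤ a * Real.exp ((b-a)/2) := by
    rw [div_le_iff₀ (by linarith)] at h1; linarith
  have e : Real.exp b = Real.exp a * Real.exp ((b-a)/2)^2 := by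
    rw [← Real.exp_nat_mul, ← Real.exp_add]; congr 1; push_cast; ring
  rw [e]
  have : b^2 ≤ (a * Real.exp ((b-a)/2))^2 := by gcongr; linarith
  have h0 := Real.exp_pos a
  calc b^2 * Real.exp a ≤ (a * Real.exp ((b-a)/2))^2 * Real.exp a := by gcongr
    _ = _ := by ring

/-- a gap event gives condition (iii) at index cnt + 1 -/
lemma gap_nice {t : Finset ℕ} (ht : ∀ p ∈ t, PPr p) {U u G h κ V L : ℝ} (hE : EvW U u G h κ t)
    (hκ : 1 ≤ κ) (hL : 0 < L) (hV : 1 ≤ V)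
    (hG : Real.exp G = 4 * (κ+1) * V^2 * L) (hcard : (t.card : ℝ) ≤ Real.exp G) (hUu : U + G ≤ u) 
    (hu2 : 2 ≤ u + G) (huV : u + G ≤ 2 * V) (hc : cnt t u < t.card) :
    (lam (gl t (cnt t u)))^2 * L * ∑ j ∈ range (cnt t u), Real.log (gl t j) ≤ Real.log (gl t (cnt t u)) := by
  set c := cnt t u with hcdef
  obtain ⟨_, h2, h3⟩ := EvW_imp hE
  have hm := gl_mem hc
  have hlam : u < lam (gl t c) := by
    by_contra hcon
    have := le_cnt_of ht hc (not_lt.1 hcon)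
    omega
  have hlam2 := h2 _ hm hlam
  have hsub := cnt_filter_sub ht hc hlam
  have hcardeq : (t.filter (fun p => p < gl t c)).card = c := by
    rw [filter_lt_gl hc, card_image_of_injOn (gl_inj hc.le), card_range]
  have heq := eq_of_subset_of_card_le hsub (by rw [hcardeq]; exact le_rfl)
  have hsum : ∑ j ∈ range c, Real.log (gl t j) = ∑ p ∈ t.filter (fun p => lam p ≤ u), Real.log p := by
    rw [heq, filter_lt_gl hc, sum_image (gl_inj hc.le)]
  have hU : ∑ p ∈ t.filter (fun p => lam p ≤ u), Real.log p ≤ (κ+1) * Real.exp u := by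
    have hspl := sum_filter_add_sum_filter_not (t.filter (fun p => lam p ≤ u)) (fun p => U < lam p) (fun p => Real.log p)
    rw [← hspl, filter_filter, filter_filter]
    have e1 : t.filter (fun p => lam p ≤ u ∧ U < lam p) = t.filter (fun p => U < lam p ∧ lam p ≤ u) := by
      ext p; simp only [mem_filter]; tauto
    rw [e1]
    have e2 : ∑ p ∈ t.filter (fun p => lam p ≤ u ∧ ¬ U < lam p), Real.log p ≤ Real.exp u := by
      calc _ ≤ ∑ p ∈ t.filter (fun p => lam p ≤ u ∧ ¬ U < lam p), Real.exp U := by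
            refine sum_le_sum fun p hp => ?_
            rw [mem_filter] at hp
            rw [← exp_lam (ht p hp.1)]
            exact Real.exp_le_exp.2 (not_lt.1 hp.2.2)
        _ ≤ t.card * Real.exp U := by
            rw [sum_const, nsmul_eq_mul]
            gcongr
            exact filter_subset _ _
        _ ≤ Real.exp G * Real.exp U := by gcongr
        _ ≤ Real.exp u := by rw [← Real.exp_add]; apply Real.exp_le_exp.2; linarith
    linarith
  rw [hsum, ← exp_lam (ht _ hm)]
  set y := lam (gl t c)
  have hm2 := sq_exp_mono hu2 hlam2.le
  have hu0 := Real.exp_pos u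
  have hv : (u+G)^2 ≤ 4 * V^2 := by nlinarith
  have key : (u+G)^2 * L * ((κ+1) * Real.exp u) ≤ Real.exp (u+G) := by
    rw [Real.exp_add, hG]
    calc _ ≤ (4 * V^2) * L * ((κ+1) * Real.exp u) := by gcongr
      _ = _ := by ring
  have hp1 := Real.exp_pos (u+G)
  have hp2 := Real.exp_pos y
  have step : y^2 * L * ((κ+1) * Real.exp u) * Real.exp (u+G) ≤ Real.exp y * Real.exp (u+G) := by
    calc _ = (y^2 * Real.exp (u+G)) * (L * ((κ+1) * Real.exp u)) := by ring
      _ ≤ ((u+G)^2 * Real.exp y) * (L * ((κ+1) * Real.exp u)) := by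
          gcongr
      _ = Real.exp y * ((u+G)^2 * L * ((κ+1) * Real.exp u)) := by ring
      _ ≤ _ := by gcongr
  refine le_trans ?_ (le_of_mul_le_mul_right step hp1)
  gcongr

end PNN

namespace PNN
open Finset Filter

lemma cnt_mono (t : Finset ℕ) {u v : ℝ} (h : u ≤ v) : cnt t u ≤ cnt t v := by
  apply card_le_card
  intro p hp
  rw [mem_filter] at hp ⊢
  exact ⟨hp.1, hp.2.trans h⟩

lemma dev_le_half {C : ℝ} {i : ℕ} (hC : 0 < C) (hi : 32 * C ≤ i) : dev C i ≤ i / 2 := by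
  have hi0 : (0:ℝ) < i := by linarith
  rw [dev_eq hC, max_eq_left (by linarith)]
  have : eta C i ≤ 1/2 := by
    unfold eta
    calc (C / i) ^ ((1:ℝ)/5) ≤ ((1/2:ℝ)^(5:ℝ)) ^ ((1:ℝ)/5) := by
          apply Real.rpow_le_rpow (by positivity) _ (by norm_num)
          rw [div_le_iff₀ hi0]
          norm_num; linarith
      _ = 1/2 := by rw [← Real.rpow_mul (by norm_num)]; norm_num
  nlinarith

lemma dev_le_self {C : ℝ} {i : ℕ} (hC : 0 < C) (hi : C ≤ i) : dev C i ≤ i := by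
  have hi0 : (0:ℝ) < i := by linarith
  rw [dev_eq hC, max_eq_left hi]
  have := eta_le hC hi
  nlinarith

lemma third_cnt {C x : ℝ} {R : ℕ} {t : Finset ℕ} (hC : RegC x C) (hR : 2/5 * x ≤ R) (hB : ¬ Bad2 C R t) :
    cnt t (x/8) < R / 3 := by
  have c2 := hC.C2
  have cx := hC.Cx
  have hx : 200000 ≤ x := by linarith
  set i := R / 3 with hi
  have h1 : R ≤ 3 * i + 2 := by omega
  have h1' : (R:ℝ) ≤ 3 * i + 2 := by exact_mod_cast h1
  have hix : x/8 ≤ i := by linarith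
  have hi1 : 1 ≤ i := by
    have : (1:ℝ) ≤ i := by linarith
    exact_mod_cast this
  have hL : ¬ Low C i t := fun h => hB ⟨i, hi1, by omega, Or.inl h⟩
  unfold Low at hL
  rw [not_le] at hL
  refine lt_of_le_of_lt (cnt_mono t ?_) hL
  have := dev_le_half (i := i) (by linarith) (by linarith)
  linarith

lemma root_cnt {C x : ℝ} {R : ℕ} {t : Finset ℕ} (hC : RegC x C) (hCx : C^2 = Real.log x) (hR : 2/5 * x ≤ R)
    (hR2 : (R:ℝ) ≤ 3/5*x) (hB : ¬ Bad2 C R t) {u : ℝ} (hu : 4 * √x ≤ u) :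
    √((R:ℝ)+1) ≤ cnt t u := by
  have c2 := hC.C2
  have cx := hC.Cx
  have hx : 200000 ≤ x := by linarith
  set i := ⌈√((R:ℝ)+1)⌉₊ with hi
  have hs := Real.mul_self_sqrt (show 0 ≤ x by linarith)
  have hs0 := Real.sqrt_nonneg x
  have hs5 : 100 ≤ √x := Real.le_sqrt_of_sq_le (by linarith)
  have hr : √((R:ℝ)+1) ≤ 4/5 * √x := by
    rw [Real.sqrt_le_left (by positivity)]
    nlinarith
  have i1 : √((R:ℝ)+1) ≤ i := Nat.le_ceil _
  have i2 : (i:ℝ) < √((R:ℝ)+1) + 1 := Nat.ceil_lt_add_one (by positivity)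
  have hlog : Real.log x ≤ 2 * (√x - 1) := by
    have := Real.log_le_sub_one_of_pos (show 0 < √x by linarith)
    have e : Real.log x = 2 * Real.log (√x) := by
      rw [Real.log_sqrt (by linarith)]; ring
    linarith
  have hCi : C ≤ i := by
    refine le_trans (Real.le_sqrt_of_sq_le ?_) i1
    nlinarith
  have h1 : 1 ≤ i := by
    have : (1:ℝ) ≤ i := by linarith
    exact_mod_cast this
  have h3 : 3 * i ≤ R := by
    have : 3 * (i:ℝ) ≤ R := by nlinarith
    exact_mod_cast this
  have hH : ¬ High C i t := fun h => hB ⟨i, h1, h3, Or.inr h⟩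
  unfold High at hH
  rw [not_lt] at hH
  have hd := dev_le_self (i := i) (by linarith) hCi
  have : i ≤ cnt t u := hH.trans (cnt_mono t (by linarith))
  exact i1.trans (by exact_mod_cast this)

lemma bad3_of_fail {h κ C x : ℝ} {R : ℕ} {t : Finset ℕ} (hh : 1 ≤ h) (hκ : 1 ≤ κ) (hC : RegC x C)
    (hCx : C^2 = Real.log x) (hR : 2/5 * x ≤ R) (hR2 : (R:ℝ) ≤ 3/5*x) (hL : RegL (4*(κ+1)) h x)
    (ht : ∀ p ∈ t, PPr p) (hcard : t.card = R+1) (hB : ¬ Bad2 C R t)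
    (hf : ¬ ∃ i : ℕ, √((R:ℝ)+1) / 2 < i ∧ (i:ℝ) < ((R:ℝ)+1)/2 ∧
      (lam (gl t (i-1)))^2 * Real.log x * ∑ j ∈ range (i-1), Real.log (gl t j) ≤ Real.log (gl t (i-1))) :
    Bad3 h κ (4*(κ+1)) x R t := by
  have hc1 := third_cnt hC hR hB
  refine ⟨by omega, ?_⟩
  intro l hl1 hl2 j hj k hk1 hk2 hE
  obtain ⟨g1, g2, g3, g4, g5⟩ := G_bounds (by linarith) hL hl1 hl2
  set G := GG (4*(κ+1)) x l
  set V : ℝ := 2^l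
  have hub := u_bound hj hk2
  set u := V + 3 * G * j + G + k * h with hu
  have hx1 : 200000 ≤ x := by linarith [hC.C2, hC.Cx]
  have hs := Real.mul_self_sqrt (show 0 ≤ x by linarith)
  have hs5 : 100 ≤ √x := Real.le_sqrt_of_sq_le (by linarith)
  have hk0 : 0 ≤ k * h := by positivity
  have hj0 : 0 ≤ 3 * G * j := by positivity
  have hc2 := root_cnt hC hCx hR hR2 hB (u := u) (by linarith)
  have hc3 : cnt t u ≤ cnt t (x/8) := cnt_mono t (by linarith)
  apply hf
  refine ⟨cnt t u + 1, ?_, ?_, ?_⟩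
  · push_cast
    have := Real.sqrt_nonneg ((R:ℝ)+1)
    linarith
  · have : 2 * (cnt t u + 1) < R + 1 := by omega
    have h' : 2 * ((cnt t u : ℝ) + 1) < R + 1 := by exact_mod_cast this
    push_cast; linarith
  · rw [Nat.add_sub_cancel]
    have hlx := hL.lx
    refine gap_nice ht hE hκ (by linarith) (by linarith) g5 ?_ (by linarith) (by linarith) hub (by omega)
    rw [g5, hcard]
    have b1 : 16 * x ≤ V^2 := by nlinarith
    have b2 : 16 * x ≤ 4*(κ+1) * V^2 := by nlinarith
    have b3 : 16 * x ≤ 4*(κ+1) * V^2 * Real.log x := by nlinarith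
    push_cast; linarith

end PNN

namespace PNN
open Finset Filter

lemma primeFactors_pr {N : ℝ} {t : Finset ℕ} (ht : t ⊆ PN N) : (pr t).primeFactors = t :=
  Nat.primeFactors_prod (fun p hp => prime_of_mem ht hp)

lemma PellDr_eq (r : ℕ) (N : ℝ) : PellDr r N = ((Dr r N N).image pr : Finset ℕ) := by
  ext d
  simp only [PellDr, PellD, Set.mem_ofPred_eq, coe_image, Set.mem_image, mem_coe, Dr, mem_filter, mem_powersetCard]
  constructor
  · rintro ⟨⟨h1, h2, h3⟩, h4, h5⟩
    have e : pr d.primeFactors = d := Nat.prod_primeFactors_of_squarefree h1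
    refine ⟨d.primeFactors, ⟨⟨?_, h5⟩, by rw [e]; exact h4⟩, e⟩
    intro p hp
    have hp1 := Nat.prime_of_mem_primeFactors hp
    have hp2 := Nat.dvd_of_mem_primeFactors hp
    rw [mem_PN]
    refine ⟨lt_of_le_of_lt ?_ h4, hp1, h3 p hp1 hp2⟩
    exact_mod_cast Nat.le_of_dvd h2 hp2
  · rintro ⟨t, ⟨⟨h1, h2⟩, h3⟩, rfl⟩
    have e := primeFactors_pr h1
    refine ⟨⟨?_, ?_, ?_⟩, h3, by rw [e]; exact h2⟩
    · have hpp : ∀ p ∈ t, p.Prime := fun p hp => prime_of_mem h1 hp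
      unfold pr
      refine Finset.squarefree_prod_of_pairwise_isCoprime ?_ (fun p hp => (hpp p hp).prime.squarefree)
      intro p hp q hq hne
      exact Nat.coprime_iff_isRelPrime.1 ((Nat.coprime_primes (hpp p hp) (hpp q hq)).2 hne)
    · exact prod_pos fun p hp => (prime_of_mem h1 hp).pos
    · intro p hp hd
      have : p ∈ (pr t).primeFactors := Nat.mem_primeFactors.2 ⟨hp, hd, (prod_pos fun p hp => (prime_of_mem h1 hp).pos).ne'⟩
      rw [e] at this
      exact (mem_PN.1 (h1 this)).2.2

lemma classify {N h κ : ℝ} {R : ℕ} {t : Finset ℕ} (hReg : Reg N R) (hC : RegC (xx N) (CC N)) (hL : RegL (4*(κ+1)) h (xx N))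
    (hh : 1 ≤ h) (hκ : 1 ≤ κ) (ht : t ⊆ PN N) (hcard : t.card = R + 1) (hn : ¬ NNice N (pr t)) :
    (∃ p ∈ t, ∃ q ∈ t, p < q ∧ q ≤ 2 * p ∧ Real.log (xx N) / 10 < lam p) ∨ Bad2 (CC N) R t ∨
      Bad3 h κ (4*(κ+1)) (xx N) R t := by
  by_contra hcon
  push Not at hcon
  obtain ⟨n1, n2, n3⟩ := hcon
  have hPP : ∀ p ∈ t, PPr p := fun p hp => (mem_PN.1 (ht hp)).2
  have hlist : primeList (pr t) = t.sort (· ≤ ·) := by unfold primeList; rw [primeFactors_pr ht]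
  have hlen : (primeList (pr t)).length = R + 1 := by rw [hlist, Finset.length_sort, hcard]
  have hgl : ∀ k, (primeList (pr t)).getD k 0 = gl t k := fun k => by rw [hlist]; rfl
  have hx0 : 0 < xx N := by linarith [hReg.hx]
  have hlx : 0 < Real.log (xx N) := by linarith [hL.lx]
  apply hn
  unfold NNice
  simp only [hlen, hgl]
  refine ⟨?_, ?_, ?_⟩
  · intro i hi hD
    by_contra hc
    rw [not_lt] at hc
    have hm : gl t i ∈ t := gl_mem (by omega)
    have h1 := n1 (gl t i) hm (gl t (i+1)) (gl_mem (by omega)) (gl_mono (by omega) (by omega)) (by exact_mod_cast hc)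
    have hp := hPP _ hm
    have hp0 : (0:ℝ) < gl t i := by exact_mod_cast hp.1.pos
    have h2 : xx N ^ ((1:ℝ)/10) < Real.log (gl t i) := (Real.lt_log_iff_exp_lt hp0).2 hD
    have h3 : Real.log (xx N ^ ((1:ℝ)/10)) < lam (gl t i) := Real.log_lt_log (by positivity) h2
    rw [Real.log_rpow hx0] at h3
    linarith
  · intro i hi hi3
    by_contra hc
    have h3 : 3 * i ≤ R := by
      have : (3 * i : ℝ) < R + 1 := by push_cast at hi3; linarith
      have : 3 * i < R + 1 := by exact_mod_cast this
      omega
    exact n2 ⟨i, hi, h3, bad2_of_fail hPP hi (by omega) hc⟩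
  · by_contra hc
    refine n3 (bad3_of_fail hh hκ hC (Real.sq_sqrt hlx.le) hReg.R1 hReg.R2 hL hPP hcard n2 ?_)
    push_cast at hc
    exact hc

open Classical in
lemma main_count : ∃ K : ℝ, 1 ≤ K ∧ ∀ᶠ N in atTop, ∀ R : ℕ, Reg N R → ∀ F ⊆ Dr (R+1) N N,
    (∀ t ∈ F, ¬ NNice N (pr t)) → (F.card : ℝ) ≤ K * (N / Real.log N * (SS N ^ R / R.factorial)) *
      Real.exp (-(Real.log (xx N)) ^ ((1:ℝ)/4)) := by
  obtain ⟨C1, hC1, H1⟩ := bad1_count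
  obtain ⟨C2, hC2, H2⟩ := ub23
  obtain ⟨K2, hK2, H3⟩ := bad2_weight
  obtain ⟨h, κ, hh, hκ, H4⟩ := bad3_weight
  obtain ⟨c, hc, H4⟩ := H4 (4*(κ+1)) (by linarith)
  have H5 : ∀ᶠ N in atTop, RegL (4*(κ+1)) h (xx N) := tendsto_xx.eventually (ev_RegL _ _)
  have H6 := tendsto_CC.eventually (ev_rpow (1/2) 1 (1/20) (by norm_num) (by norm_num))
  have H7 := tendsto_CC.eventually (ev_rpow (1/2) 1 c (by norm_num) hc)
  have H8 := tendsto_CC.eventually (ev_rpow (1/2) 2 (1/10) (by norm_num) (by norm_num))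
  refine ⟨C1 * 2 + C2 * (K2 + 4 + 1), by nlinarith, ?_⟩
  filter_upwards [H1, H2, H3, H4, H5, H6, H7, H8, ev_RegC] with N H1 H2 H3 H4 hL e1 e2 e3 hC R hReg F hF hFn
  set E := Real.exp (-(Real.log (xx N)) ^ ((1:ℝ)/4)) with hE
  have hx := hReg.hx
  have hlx : 0 < Real.log (xx N) := by linarith [hL.lx]
  have hlN := hReg.logpos
  have hCC : (CC N)^(2:ℝ) = Real.log (xx N) := by
    rw [Real.rpow_two]; exact Real.sq_sqrt hlx.le
  have hC0 : 0 ≤ CC N := Real.sqrt_nonneg _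
  have hq : (Real.log (xx N)) ^ ((1:ℝ)/4) = (CC N)^((1:ℝ)/2) := by
    rw [← hCC, ← Real.rpow_mul hC0]; norm_num
  rw [Real.rpow_one] at e1 e2
  rw [hCC] at e3
  rw [← hq] at e1 e2 e3
  have E1 : Real.exp (-(CC N / 20)) ≤ E := Real.exp_le_exp.2 (by linarith)
  have E2 : Real.exp (-(c * CC N)) ≤ E := Real.exp_le_exp.2 (by linarith)
  have E3 : Real.exp (-(Real.log (xx N)/10)) ≤ E := Real.exp_le_exp.2 (by linarith)
  have hexp : Real.exp (xx N) = Real.log N := Real.exp_log hlN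
  have hlogle : Real.log (xx N) ≤ xx N := (Real.log_le_sub_one_of_pos (by linarith)).trans (by linarith)
  have E4 : 1 / Real.log N ≤ E := by
    rw [← hexp, one_div, ← Real.exp_neg]; exact Real.exp_le_exp.2 (by linarith)
  have E5 : 1 / √(Real.log N) ≤ E := by
    rw [← hexp, ← Real.exp_half, one_div, ← Real.exp_neg]; exact Real.exp_le_exp.2 (by linarith)
  set S := SS N ^ R / (R.factorial : ℝ) with hS
  have hS0 : 0 ≤ S := by have := hReg.Spos; positivity
  have hN0 : 0 ≤ N / Real.log N := div_nonneg (by linarith [hReg.N2]) hlN.le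
  have hE0 : 0 < E := Real.exp_pos _
  let P1 : Finset ℕ → Prop := fun t => ∃ p ∈ t, ∃ q ∈ t, p < q ∧ q ≤ 2 * p ∧ Real.log (xx N) / 10 < lam p
  let P2 : Finset ℕ → Prop := fun t => Bad2 (CC N) R t ∨ Bad3 h κ (4*(κ+1)) (xx N) R t
  set A := (powersetCard R (PN N)).filter P2 with hA
  have hFmem : ∀ t ∈ F, t ⊆ PN N ∧ t.card = R + 1 := fun t ht => by
    have := hF ht
    unfold Dr at this
    rw [mem_filter, mem_powersetCard] at this
    exact this.1
  have hsplit : F ⊆ F.filter P1 ∪ F.filter P2 := by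
    intro t ht
    rw [mem_union, mem_filter, mem_filter]
    rcases classify hReg hC hL hh hκ (hFmem t ht).1 (hFmem t ht).2 (hFn t ht) with h | h
    · exact Or.inl ⟨ht, h⟩
    · exact Or.inr ⟨ht, h⟩
  have b1 := H1 R hReg (Real.log (xx N) / 10) (by positivity) (F.filter P1) ((filter_subset _ _).trans hF)
    (fun t ht => (mem_filter.1 ht).2)
  have b2 := H2 R hReg (F.filter P2) ((filter_subset _ _).trans hF) A (filter_subset _ _) (by
    intro t ht p hp hlam
    rw [mem_filter] at ht
    obtain ⟨m1, m2⟩ := hFmem t ht.1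
    rw [hA, mem_filter, mem_powersetCard]
    refine ⟨⟨(erase_subset _ _).trans m1, by rw [card_erase_of_mem hp, m2]; rfl⟩, ?_⟩
    rcases ht.2 with hb | hb
    · exact Or.inl (Bad2_erase (by linarith [hC.C2]) (by linarith [hReg.R2]) hlam hb)
    · exact Or.inr (Bad3_erase (by linarith) hL hlam hb))
  have b3 := H3 R hReg ((powersetCard R (PN N)).filter (Bad2 (CC N) R)) (filter_subset _ _) 
    (fun t ht => (mem_filter.1 ht).2)
  have b4 := H4 R hReg ((powersetCard R (PN N)).filter (Bad3 h κ (4*(κ+1)) (xx N) R)) (filter_subset _ _) 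
    (fun t ht => (mem_filter.1 ht).2)
  have b5 : ∑ t ∈ A, w t ≤ (K2 + 4) * (S * E) := by
    have : A = (powersetCard R (PN N)).filter (Bad2 (CC N) R) ∪ 
        (powersetCard R (PN N)).filter (Bad3 h κ (4*(κ+1)) (xx N) R) := by
      rw [hA, ← filter_or]
    rw [this]
    have hle := sum_union_inter (s₁ := (powersetCard R (PN N)).filter (Bad2 (CC N) R)) 
      (s₂ := (powersetCard R (PN N)).filter (Bad3 h κ (4*(κ+1)) (xx N) R)) (f := w)
    have hnn : 0 ≤ ∑ t ∈ (powersetCard R (PN N)).filter (Bad2 (CC N) R) ∩ 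
        (powersetCard R (PN N)).filter (Bad3 h κ (4*(κ+1)) (xx N) R), w t := sum_nonneg fun t _ => w_nonneg t
    have a1 : K2 * S * Real.exp (-(CC N / 20)) ≤ K2 * S * E := by gcongr
    have a2 : 4 * Real.exp (-(c * CC N)) * S ≤ 4 * E * S := by gcongr
    linarith
  have b6 : S / √(Real.log N) ≤ S * E := by
    rw [div_eq_mul_one_div]; gcongr
  calc (F.card : ℝ) ≤ ((F.filter P1).card : ℝ) + (F.filter P2).card := by
        exact_mod_cast (card_le_card hsplit).trans (card_union_le _ _)
    _ ≤ C1 * (N / Real.log N * S) * (E + E) + C2 * (N / Real.log N) * ((K2+4) * (S * E) + S * E) := by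
        refine add_le_add (b1.trans ?_) (b2.trans ?_)
        · gcongr
        · gcongr
    _ = _ := by ring

end PNN

open PNN in
theorem count_not_nice :
    ∃ C N₀ : ℝ, 0 < C ∧ 0 < N₀ ∧
      ∀ N : ℝ, N₀ ≤ N → ∀ r : ℕ, 0 < r →
        |(r : ℝ) - (1 / 2) * Real.log (Real.log N)| < (Real.log (Real.log N)) ^ ((2 : ℝ) / 3) →
        (({d ∈ PellDr r N | ¬ NNice N d}.ncard : ℝ)) ≤
          C * ((PellDr r N).ncard : ℝ) *
            Real.exp (-(Real.log (Real.log (Real.log N))) ^ ((1 : ℝ) / 4)) := by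
  classical
  obtain ⟨K, hK, HK⟩ := main_count
  obtain ⟨c, hc, Hc⟩ := lower_bound
  obtain ⟨N₀, HN⟩ := Filter.eventually_atTop.1 (HK.and (Hc.and regime))
  refine ⟨K / c, max N₀ 1, by positivity, by positivity, ?_⟩
  intro N hN r hr hyp
  obtain ⟨h1, h2, h3⟩ := HN N ((le_max_left _ _).trans hN)
  obtain ⟨R, rfl⟩ : ∃ R, r = R + 1 := ⟨r - 1, by omega⟩
  have hReg := h3 R hyp
  have hsub : ∀ t ∈ Dr (R+1) N N, t ⊆ PN N := fun t ht => by
    unfold Dr at ht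
    rw [Finset.mem_filter, Finset.mem_powersetCard] at ht
    exact ht.1.1
  have hinj : Set.InjOn pr (Dr (R+1) N N : Set (Finset ℕ)) := fun s hs t ht e => pr_inj (hsub s hs) (hsub t ht) e
  set F := (Dr (R+1) N N).filter (fun t => ¬ NNice N (pr t)) with hF
  have e1 : (PellDr (R+1) N).ncard = (Dr (R+1) N N).card := by
    rw [PellDr_eq, Set.ncard_coe_finset, Finset.card_image_of_injOn hinj]
  have e2 : {d ∈ PellDr (R+1) N | ¬ NNice N d} = (F.image pr : Finset ℕ) := by
    rw [PellDr_eq]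
    ext d
    simp only [hF, Set.mem_ofPred_eq, Finset.coe_image, Set.mem_image, Finset.mem_coe, Finset.mem_filter]
    constructor
    · rintro ⟨⟨t, ht, rfl⟩, hn⟩; exact ⟨t, ⟨ht, hn⟩, rfl⟩
    · rintro ⟨t, ⟨ht, hn⟩, rfl⟩; exact ⟨⟨t, ht, rfl⟩, hn⟩
  rw [e1, e2, Set.ncard_coe_finset]
  have a1 := h1 R hReg F (Finset.filter_subset _ _) (fun t ht => (Finset.mem_filter.1 ht).2)
  have a2 := h2 R hReg
  have a3 : ((F.image pr).card : ℝ) ≤ F.card := by exact_mod_cast Finset.card_image_le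
  refine a3.trans (a1.trans ?_)
  have hE := Real.exp_pos (-(Real.log (xx N)) ^ ((1:ℝ)/4))
  show _ ≤ K / c * _ * Real.exp (-(Real.log (xx N)) ^ ((1:ℝ)/4))
  gcongr ?_ * _
  calc K * (N / Real.log N * (SS N ^ R / R.factorial)) = K / c * (c * (N / Real.log N * (SS N ^ R / R.factorial))) := by
        field_simp
    _ ≤ _ := by gcongr
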